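/- arXiv:2310.06267 — 8 statements merged into one kernel-verified Lean document; each statement's English description precedes it below -/
import Mathlib

section
/- For any h ∈ M and g ∈ W with g ⪯ h, we have g⁻¹h ∈ M. -/
/-!
Let `(W,S)` be a Coxeter system, given by a Coxeter matrix `M : CoxeterMatrix B`
and `cs : CoxeterSystem M W`; the set `S` of simple reflections is the range of
`cs.simple`, and `S` is finite since `B` is finite.
-/

variable {B W : Type*} [Group W] {M : CoxeterMatrix B}

/-- The weak order on `W`: `p ⪯ g` iff `ℓ(p) + ℓ(p⁻¹g) = ℓ(g)`. -/
def WeakLe (cs : CoxeterSystem M W) (p g : W) : Prop :=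
  cs.length p + cs.length (p⁻¹ * g) = cs.length g

/-- `f ∈ W` is adjacent to the wall of the reflection `r` if `f⁻¹rf ∈ S`. -/
def AdjWall (cs : CoxeterSystem M W) (f r : W) : Prop :=
  ∃ i : B, f⁻¹ * r * f = cs.simple i

/-- The reflection `q` separates the identity from the wall of the reflection `r`
if `ℓ(qf) < ℓ(f)` for every `f` adjacent to the wall of `r`. -/
def SepIdWall (cs : CoxeterSystem M W) (q r : W) : Prop :=
  cs.IsReflection q ∧ ∀ f : W, AdjWall cs f r → cs.length (q * f) < cs.length f

/-- A reflection `r` is elementary if no reflection separates the identity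
from the wall of `r`. -/
def IsElementary (cs : CoxeterSystem M W) (r : W) : Prop :=
  cs.IsReflection r ∧ ¬ ∃ q : W, SepIdWall cs q r

/-- One step `g → gs` (with `s ∈ S`) crossing a non-elementary wall `gsg⁻¹ ∉ ℰ`. -/
def ShiStep (cs : CoxeterSystem M W) (g h : W) : Prop :=
  ∃ i : B, h = g * cs.simple i ∧ ¬ IsElementary cs (g * cs.simple i * g⁻¹)

/-- `g` and `h` lie in the same Shi part: there is a sequence `g = g₀, …, gₙ = h`
with `gᵢ₊₁ = gᵢsᵢ`, `sᵢ ∈ S`, and `gᵢsᵢgᵢ⁻¹ ∉ ℰ`. -/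
def SameShiPart (cs : CoxeterSystem M W) : W → W → Prop :=
  Relation.ReflTransGen (ShiStep cs)

section Aux
open Classical in
noncomputable def shiF (cs : CoxeterSystem M W) (i : B) : Function.End (W × ZMod 2) :=
  fun p => (cs.simple i * p.1 * cs.simple i, p.2 + if p.1 = cs.simple i then 1 else 0)

theorem shi_conj_pow (cs : CoxeterSystem M W) (i j : B) (k : ℕ) :
    cs.simple j * (cs.simple i * cs.simple j) ^ k * cs.simple j
      = ((cs.simple i * cs.simple j) ^ k)⁻¹ := by
  induction k with
  | zero => simp
  | succ k ih =>
    rw [pow_succ (n := k), mul_inv_rev, ← ih]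
    rw [mul_inv_rev, cs.inv_simple, cs.inv_simple]
    have : (cs.simple i * cs.simple j) ^ k * (cs.simple i * cs.simple j)
       = (cs.simple i * cs.simple j) * (cs.simple i * cs.simple j) ^ k := by
      rw [← pow_succ, ← pow_succ']
    rw [this]
    have h2 : cs.simple j * (cs.simple i * cs.simple j * (cs.simple i * cs.simple j) ^ k)
       * cs.simple j = cs.simple j * cs.simple i * (cs.simple j *
          (cs.simple i * cs.simple j) ^ k * cs.simple j) := by
      simp only [mul_assoc]
    rw [h2]

open Classical in
theorem shiF_pow (cs : CoxeterSystem M W) (i j : B) (k : ℕ) (t : W) (z : ZMod 2) :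
    ((shiF cs i * shiF cs j) ^ k) (t, z) =
      ((cs.simple i * cs.simple j) ^ k * t * ((cs.simple i * cs.simple j) ^ k)⁻¹,
        z + ∑ l ∈ Finset.range (2 * k),
          if t = ((cs.simple i * cs.simple j) ^ l)⁻¹ * cs.simple j then 1 else 0) := by
  induction k with
  | zero => simp; rfl
  | succ k ih =>
    have hstep : ((shiF cs i * shiF cs j) ^ (k+1)) (t, z)
        = shiF cs i (shiF cs j (((shiF cs i * shiF cs j) ^ k) (t, z))) := by
      rw [pow_succ']; rfl
    rw [hstep, ih]
    have e : 2 * (k + 1) = 2 * k + 1 + 1 := by ring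
    rw [e, Finset.sum_range_succ, Finset.sum_range_succ]
    have hc := shi_conj_pow cs i j k
    set x := cs.simple i * cs.simple j with hx
    have hsj := cs.simple_mul_simple_self j
    have hsi := cs.simple_mul_simple_self i
    have hxj : cs.simple j * x ^ k = (x ^ k)⁻¹ * cs.simple j := by
      rw [← hc]; simp [mul_assoc]
    have h1 : (x ^ k * t * (x ^ k)⁻¹ = cs.simple j) ↔ t = (x ^ (2 * k))⁻¹ * cs.simple j := by
      rw [mul_inv_eq_iff_eq_mul, hxj, ← eq_inv_mul_iff_mul_eq, two_mul, pow_add, mul_inv_rev,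
        mul_assoc]
    have h2 : (cs.simple j * (x ^ k * t * (x ^ k)⁻¹) * cs.simple j = cs.simple i) ↔
        t = (x ^ (2 * k + 1))⁻¹ * cs.simple j := by
      have a : (cs.simple j * (x ^ k * t * (x ^ k)⁻¹) * cs.simple j = cs.simple i) ↔
          x ^ k * t * (x ^ k)⁻¹ = x⁻¹ * cs.simple j := by
        have hxi : x⁻¹ = cs.simple j * cs.simple i := by
          rw [hx, mul_inv_rev, cs.inv_simple, cs.inv_simple]
        rw [hxi]
        generalize x ^ k * t * (x ^ k)⁻¹ = v
        constructor
        · intro h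
          rw [← h]
          simp [mul_assoc]
        · intro h
          rw [h]
          simp [mul_assoc]
      rw [a, mul_inv_eq_iff_eq_mul, mul_assoc, hxj, ← eq_inv_mul_iff_mul_eq]
      have : x ^ (2 * k + 1) = x ^ k * x * x ^ k := by
        rw [← pow_succ, ← pow_add]; congr 1; ring
      rw [this]
      simp [mul_assoc]
    simp only [shiF, h1, h2]
    ext
    · simp only [pow_succ' x k, mul_inv_rev]
      rw [hx, mul_inv_rev, cs.inv_simple, cs.inv_simple]
      simp only [mul_assoc]
    · simp only [add_assoc]

theorem shiF_liftable (cs : CoxeterSystem M W) : M.IsLiftable (shiF cs) := by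
  classical
  intro i j
  funext ⟨t, z⟩
  rw [shiF_pow, cs.simple_mul_simple_pow, two_mul, Finset.sum_range_add]
  simp only [pow_add, cs.simple_mul_simple_pow, one_mul]
  rw [CharTwo.add_self_eq_zero]
  simp
  rfl

theorem shi_cocycle (cs : CoxeterSystem M W) : ∃ N : W → W → ZMod 2,
    (∀ x y t, N (x * y) t = N x t + N y (x⁻¹ * t * x)) ∧
    (∀ i t, N (cs.simple i) t ≠ 0 ↔ t = cs.simple i) := by
  classical
  let ρ := cs.lift ⟨shiF cs, shiF_liftable cs⟩
  have hρs : ∀ i, ρ (cs.simple i) = shiF cs i := fun i => cs.lift_apply_simple _ i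
  have hmul : ∀ x y p, ρ (x * y) p = ρ x (ρ y p) := by
    intro x y p; rw [map_mul]; rfl
  have hρ : ∀ w t z, ρ w (t, z) = (w * t * w⁻¹, z + (ρ w (t, 0)).2) := by
    intro w
    induction w using cs.simple_induction_left with
    | one => intro t z; rw [map_one]; simp [show ∀ p, (1 : Function.End (W × ZMod 2)) p = p from fun _ => rfl]
    | mul_simple_left w i ih =>
      intro t z
      rw [hmul, hmul, hρs, ih t z, ih t 0]
      simp [shiF, mul_assoc, add_assoc]
  refine ⟨fun w t => (ρ w⁻¹ (t, 0)).2, ?_, ?_⟩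
  · intro x y t
    simp only [mul_inv_rev]
    rw [hmul, hρ x⁻¹ t 0, hρ y⁻¹]
    simp
  · intro i t
    simp only [cs.inv_simple, hρs, shiF]
    simp

theorem shi_inv (cs : CoxeterSystem M W) : ∃ N : W → W → ZMod 2,
    (∀ x y t, N (x * y) t = N x t + N y (x⁻¹ * t * x)) ∧
    (∀ i t, N (cs.simple i) t ≠ 0 ↔ t = cs.simple i) ∧
    (∀ w t, cs.IsReflection t → (N w t ≠ 0 ↔ cs.length (t * w) < cs.length w)) := by
  obtain ⟨N, hmul, hs⟩ := shi_cocycle cs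
  refine ⟨N, hmul, hs, ?_⟩
  have h1 : ∀ t, N 1 t = 0 := by
    intro t
    have := hmul 1 1 t
    simpa using this
  have two : ∀ a : ZMod 2, a ≠ 0 → a = 1 := by decide
  have htt : ∀ t, cs.IsReflection t → N t t = 1 := by
    rintro t ⟨u, i, rfl⟩
    have a := hmul (u * cs.simple i) u⁻¹ (u * cs.simple i * u⁻¹)
    have b := hmul u (cs.simple i) (u * cs.simple i * u⁻¹)
    have c := hmul u u⁻¹ (u * cs.simple i * u⁻¹)
    have e1 : (u * cs.simple i)⁻¹ * (u * cs.simple i * u⁻¹) * (u * cs.simple i) = cs.simple i := by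
      simp [mul_assoc]
    have e2 : u⁻¹ * (u * cs.simple i * u⁻¹) * u = cs.simple i := by
      simp [mul_assoc]
    rw [e1] at a
    rw [e2] at b c
    rw [mul_inv_cancel, h1] at c
    have d := two _ ((hs i (cs.simple i)).2 rfl)
    rw [a, b, d]
    linear_combination -c
  have hmem : ∀ ω : List B, ∀ t, N (cs.wordProd ω) t ≠ 0 → t ∈ cs.leftInvSeq ω := by
    intro ω
    induction ω with
    | nil => intro t h; simp [h1] at h
    | cons i ω ih =>
      intro t h
      rw [cs.wordProd_cons, hmul] at h
      by_cases ht : t = cs.simple i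
      · simp [CoxeterSystem.leftInvSeq, ht]
      · have : N (cs.simple i) t = 0 := by
          by_contra h'; exact ht ((hs i t).1 h')
        rw [this, zero_add] at h
        have := ih _ h
        simp only [CoxeterSystem.leftInvSeq, List.mem_cons, List.mem_map]
        right
        exact ⟨_, this, by simp [mul_assoc]⟩
  have hlt : ∀ w t, N w t ≠ 0 → cs.length (t * w) < cs.length w := by
    intro w t h
    obtain ⟨ω, hω, rfl⟩ := cs.exists_isReduced w
    exact (cs.isLeftInversion_of_mem_leftInvSeq hω (hmem ω t h)).2
  intro w t ht
  refine ⟨hlt w t, fun h h0 => ?_⟩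
  have a := hmul t w t
  rw [htt t ht] at a
  have e : t⁻¹ * t * t = t := by simp
  rw [e, h0] at a
  have b := hlt (t * w) t (by rw [a]; decide)
  rw [← mul_assoc, ht.mul_self, one_mul] at b
  omega

theorem shi_disj (cs : CoxeterSystem M W) {g h q : W} (hgh : WeakLe cs g h)
    (hq : cs.IsReflection q) (h1 : cs.length (q * (g⁻¹ * h)) < cs.length (g⁻¹ * h)) :
    ¬ cs.length (g * q * g⁻¹ * g) < cs.length g := by
  intro h2
  have := cs.length_mul_le (g * q * g⁻¹ * g) (q * (g⁻¹ * h))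
  have e : (g * q * g⁻¹ * g) * (q * (g⁻¹ * h)) = h := by
    have : (g * q * g⁻¹ * g) * (q * (g⁻¹ * h)) = g * (q * q) * g⁻¹ * h := by group
    rw [this, hq.mul_self]; simp
  rw [e] at this
  unfold WeakLe at hgh
  omega

end Aux

/-- For `h ∈ M = {m(g) : g ∈ W}` and `g ⪯ h`, we have `g⁻¹h ∈ M`. -/
theorem suffix_mem_M [Finite B] (cs : CoxeterSystem M W) (m : W → W)
    (hm : ∀ g : W, SameShiPart cs g (m g) ∧
      ∀ h : W, SameShiPart cs g h → WeakLe cs (m g) h)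
    (h : W) (hh : h ∈ Set.range m) (g : W) (hgh : WeakLe cs g h) :
    g⁻¹ * h ∈ Set.range m := by
  classical
  obtain ⟨N, hmul, hs, hN⟩ := shi_inv cs
  obtain ⟨g0, rfl⟩ := hh
  set h := m g0 with hh
  -- right descents of `h` are elementary
  have hel : ∀ i, cs.length (h * cs.simple i) < cs.length h →
      IsElementary cs (h * cs.simple i * h⁻¹) := by
    intro i hi
    by_contra hne
    have := (hm g0).2 (h * cs.simple i) ((hm g0).1.tail ⟨i, rfl, hne⟩)
    unfold WeakLe at this
    rw [← hh] at this
    omega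
  have hw : cs.length g + cs.length (g⁻¹ * h) = cs.length h := hgh
  have hel2 : ∀ i, cs.length (g⁻¹ * h * cs.simple i) < cs.length (g⁻¹ * h) →
      IsElementary cs (g⁻¹ * h * cs.simple i * (g⁻¹ * h)⁻¹) := by
    intro i hi
    have hhi : cs.length (h * cs.simple i) < cs.length h := by
      have := cs.length_mul_le g (g⁻¹ * h * cs.simple i)
      have e : g * (g⁻¹ * h * cs.simple i) = h * cs.simple i := by group
      rw [e] at this
      omega
    refine ⟨⟨_, i, rfl⟩, ?_⟩
    rintro ⟨q, hq, hsep⟩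
    apply (hel i hhi).2
    refine ⟨g * q * g⁻¹, hq.conj g, ?_⟩
    have hy := hsep (g⁻¹ * h) ⟨i, by group⟩
    have hd := shi_disj cs hgh hq hy
    rw [← hN g _ (hq.conj g), not_not] at hd
    rintro f ⟨j, hj⟩
    have hf := hsep (g⁻¹ * f) ⟨j, by rw [← hj]; group⟩
    rw [← hN _ _ hq] at hf
    rw [← hN _ _ (hq.conj g)]
    have a := hmul g (g⁻¹ * f) (g * q * g⁻¹)
    have e1 : g * (g⁻¹ * f) = f := by group
    have e2 : g⁻¹ * (g * q * g⁻¹) * g = q := by group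
    rw [e1, e2, hd, zero_add] at a
    rwa [a]
  set y := g⁻¹ * h with hy
  refine ⟨y, ?_⟩
  obtain ⟨hshi, hmin⟩ := hm y
  have hle := hmin y Relation.ReflTransGen.refl
  set p := m y with hp
  by_contra hne
  have hne1 : p⁻¹ * y ≠ 1 := by
    intro h1
    exact hne (inv_mul_eq_one.1 h1)
  obtain ⟨i, hi⟩ := cs.exists_rightDescent_of_ne_one hne1
  have hi' : cs.length (p⁻¹ * y * cs.simple i) < cs.length (p⁻¹ * y) := hi
  have hyi : cs.length (y * cs.simple i) < cs.length y := by
    have := cs.length_mul_le p (p⁻¹ * y * cs.simple i)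
    have e : p * (p⁻¹ * y * cs.simple i) = y * cs.simple i := by group
    rw [e] at this
    unfold WeakLe at hle
    omega
  have her := hel2 i hyi
  set r := y * cs.simple i * y⁻¹ with hr
  have hconst : ∀ z, SameShiPart cs y z → N z r = N y r := by
    intro z hz
    induction hz with
    | refl => rfl
    | tail _ hst ih =>
      obtain ⟨j, rfl, hj⟩ := hst
      rw [hmul, ih, add_eq_left]
      by_contra hcon
      rw [← Ne, hs] at hcon
      apply hj
      rw [← hcon]
      convert her using 1
      group
  have hpr := hconst p hshi
  have hyr : N y r ≠ 0 := by
    rw [hN y r her.1]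
    have e : r * y = y * cs.simple i := by rw [hr]; group
    rwa [e]
  rw [← hpr, hN p r her.1] at hyr
  have hq : cs.IsReflection (p⁻¹ * r * p) := by
    have := her.1.conj p⁻¹
    rwa [inv_inv] at this
  refine shi_disj cs hle hq ?_ ?_
  · have e : p⁻¹ * r * p * (p⁻¹ * y) = p⁻¹ * y * cs.simple i := by rw [hr]; group
    rwa [e]
  · have e : p * (p⁻¹ * r * p) * p⁻¹ * p = r * p := by group
    rwa [e]
end

section
/- An element h ∈ W is the smallest element of its Shi part (i.e., h = m(h)) if and only if for every s ∈ S with ℓ(hs) < ℓ(h), the reflection hsh⁻¹ is elementary. -/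
/-!
Let `(W,S)` be a Coxeter system, given by a Coxeter matrix `M : CoxeterMatrix B`
and `cs : CoxeterSystem M W`; the set `S` of simple reflections is the range of
`cs.simple`, and `S` is finite since `B` is finite.
-/

variable {B W : Type*} [Group W] {M : CoxeterMatrix B}

open Classical in
/-- Action of a simple reflection on signed reflections. -/
noncomputable def shiAct (cs : CoxeterSystem M W) (i : B) : Function.End (W × ZMod 2) :=
  fun p => (cs.simple i * p.1 * cs.simple i, p.2 + if p.1 = cs.simple i then 1 else 0)

theorem shi_dihedral (a b : W) (ha : a * a = 1) (hb : b * b = 1) (j : ℕ) :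
    b * (a * b) ^ j = ((a * b)⁻¹) ^ j * b := by
  have ha' : a⁻¹ = a := inv_eq_of_mul_eq_one_left ha
  have hb' : b⁻¹ = b := inv_eq_of_mul_eq_one_left hb
  induction j with
  | zero => simp
  | succ n ih =>
    rw [pow_succ, ← mul_assoc, ih, pow_succ, mul_inv_rev, ha', hb']
    simp [mul_assoc]

open Classical in
theorem shiAct_pow (cs : CoxeterSystem M W) (i i' : B) (k : ℕ) (t : W) (e : ZMod 2) :
    ((shiAct cs i * shiAct cs i') ^ k : Function.End (W × ZMod 2)) (t, e) =
      ((cs.simple i * cs.simple i') ^ k * t * ((cs.simple i * cs.simple i') ^ k)⁻¹,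
        e + ∑ j ∈ Finset.range (2 * k),
          if t = ((cs.simple i * cs.simple i')⁻¹) ^ j * cs.simple i' then 1 else 0) := by
  have ha := cs.simple_mul_simple_self i
  have hb := cs.simple_mul_simple_self i'
  have hd := shi_dihedral _ _ ha hb
  have ha' := cs.inv_simple i
  have hb' := cs.inv_simple i'
  induction k with
  | zero => simp; rfl
  | succ n ih =>
    have h1 : ((shiAct cs i * shiAct cs i') ^ (n+1) : Function.End (W × ZMod 2)) (t, e) =
      shiAct cs i (shiAct cs i' (((shiAct cs i * shiAct cs i') ^ n : Function.End (W × ZMod 2)) (t, e))) := by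
      rw [pow_succ']; rfl
    rw [h1, ih, show 2 * (n+1) = 2 * n + 1 + 1 by ring, Finset.sum_range_succ,
      Finset.sum_range_succ]
    clear ih h1
    set b := cs.simple i'
    set x := cs.simple i * b with hx0
    have hx := hx0.symm
    have e1 : (x ^ n * t * (x ^ n)⁻¹ = b) ↔ t = x⁻¹ ^ (2 * n) * b := by
      rw [mul_inv_eq_iff_eq_mul, hd, ← eq_inv_mul_iff_mul_eq, two_mul, pow_add, mul_assoc, inv_pow]
    have e2 : (b * (x ^ n * t * (x ^ n)⁻¹) * b = cs.simple i) ↔ t = x⁻¹ ^ (2 * n + 1) * b := by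
      have : x⁻¹ ^ (2 * n + 1) * b = (x^n)⁻¹ * (b * cs.simple i * b) * x^n := by
        rw [mul_assoc, mul_assoc _ b, hd, ← inv_pow]
        rw [show b * cs.simple i = x⁻¹ by rw [hx0, mul_inv_rev, ha', hb']]
        rw [← mul_assoc, ← mul_assoc, ← pow_succ, ← pow_add]
        congr 2; ring
      rw [this]
      constructor
      · intro h
        rw [← h]
        have : b * (b * (x ^ n * t * (x ^ n)⁻¹) * b) * b = (b * b) * (x ^ n * t * (x ^ n)⁻¹) * (b * b) := by
          group
        rw [this, hb]; group
      · intro h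
        rw [h]
        have : b * (x ^ n * ((x ^ n)⁻¹ * (b * cs.simple i * b) * x ^ n) * (x ^ n)⁻¹) * b =
          (b * b) * cs.simple i * (b * b) := by group
        rw [this, hb]; simp
    refine Prod.ext ?_ ?_
    · change cs.simple i * (b * (x ^ n * t * (x ^ n)⁻¹) * b) * cs.simple i = _
      rw [pow_succ', mul_inv_rev, show x⁻¹ = b * cs.simple i by rw [hx0, mul_inv_rev, ha', hb']]
      simp only [mul_assoc, hx0]
    · change (e + ∑ j ∈ Finset.range (2 * n), if t = x⁻¹ ^ j * b then 1 else 0) +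
          (if x ^ n * t * (x ^ n)⁻¹ = b then 1 else 0) +
          (if b * (x ^ n * t * (x ^ n)⁻¹) * b = cs.simple i then 1 else 0) = 
          e + ((∑ j ∈ Finset.range (2 * n), if t = x⁻¹ ^ j * b then 1 else 0) +
            (if t = x⁻¹ ^ (2 * n) * b then 1 else 0) +
            (if t = x⁻¹ ^ (2 * n + 1) * b then 1 else 0))
      rw [if_congr e1 rfl rfl, if_congr e2 rfl rfl]
      simp only [add_assoc]

theorem shiAct_liftable (cs : CoxeterSystem M W) : M.IsLiftable (shiAct cs) := by
  classical
  intro i i'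
  funext ⟨t, e⟩
  rw [shiAct_pow, cs.simple_mul_simple_pow]
  have h : ((cs.simple i * cs.simple i')⁻¹) ^ M i i' = 1 := by
    rw [inv_pow, cs.simple_mul_simple_pow, inv_one]
  rw [two_mul, Finset.sum_range_add]
  simp only [pow_add, h, one_mul, CharTwo.add_self_eq_zero]
  simp
  rfl

/-- The signed action of `W`. -/
noncomputable def shiHom (cs : CoxeterSystem M W) : W →* Function.End (W × ZMod 2) :=
  cs.lift ⟨shiAct cs, shiAct_liftable cs⟩

theorem shiHom_simple (cs : CoxeterSystem M W) (i : B) : shiHom cs (cs.simple i) = shiAct cs i :=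
  cs.lift_apply_simple (shiAct_liftable cs) i

open Classical in
theorem shiHom_word (cs : CoxeterSystem M W) (ω : List B) (t : W) (e : ZMod 2) :
    shiHom cs (cs.wordProd ω) (t, e) =
      (cs.wordProd ω * t * (cs.wordProd ω)⁻¹, e + ((cs.rightInvSeq ω).count t : ℕ)) := by
  induction ω with
  | nil => simp; rfl
  | cons i ω ih =>
    rw [cs.wordProd_cons, map_mul]
    change shiHom cs (cs.simple i) (shiHom cs (cs.wordProd ω) (t, e)) = _
    rw [ih, shiHom_simple, CoxeterSystem.rightInvSeq, List.count_cons]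
    have : (cs.wordProd ω * t * (cs.wordProd ω)⁻¹ = cs.simple i) ↔
        ((cs.wordProd ω)⁻¹ * cs.simple i * cs.wordProd ω = t) := by
      constructor
      · intro h; rw [← h]; group
      · intro h; rw [← h]; group
    simp only [shiAct, this, mul_inv_rev, cs.inv_simple, beq_iff_eq]
    push_cast
    simp [mul_assoc, add_assoc]

/-- The inversion cocycle. -/
noncomputable def shiEta (cs : CoxeterSystem M W) (w t : W) : ZMod 2 := (shiHom cs w (t, 0)).2

theorem shiHom_eq (cs : CoxeterSystem M W) (w t : W) (e : ZMod 2) :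
    shiHom cs w (t, e) = (w * t * w⁻¹, e + shiEta cs w t) := by
  obtain ⟨ω, rfl⟩ := cs.wordProd_surjective w
  simp [shiEta, shiHom_word]

theorem shiEta_mul (cs : CoxeterSystem M W) (v w t : W) :
    shiEta cs (v * w) t = shiEta cs w t + shiEta cs v (w * t * w⁻¹) := by
  have : shiHom cs (v * w) (t, 0) = shiHom cs v (shiHom cs w (t, 0)) := by
    rw [map_mul]; rfl
  rw [shiEta, this, shiHom_eq, shiHom_eq]; simp

open Classical in
theorem shiEta_simple (cs : CoxeterSystem M W) (i : B) (t : W) :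
    shiEta cs (cs.simple i) t = if t = cs.simple i then 1 else 0 := by
  simp [shiEta, shiHom_simple, shiAct]

theorem shiEta_one (cs : CoxeterSystem M W) (t : W) : shiEta cs 1 t = 0 := by
  rw [shiEta, map_one]; rfl

theorem shiEta_self (cs : CoxeterSystem M W) {t : W} (ht : cs.IsReflection t) :
    shiEta cs t t = 1 := by
  obtain ⟨u, i, rfl⟩ := ht
  have h0 := shiEta_mul cs u u⁻¹ (u * cs.simple i * u⁻¹)
  have hc : u⁻¹ * (u * cs.simple i * u⁻¹) * u⁻¹⁻¹ = cs.simple i := by group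
  rw [hc, mul_inv_cancel, shiEta_one] at h0
  rw [shiEta_mul, hc, shiEta_mul, shiEta_simple]
  simp only [cs.inv_simple, cs.simple_mul_simple_self, one_mul, if_true]
  linear_combination -h0

theorem shiEta_lt (cs : CoxeterSystem M W) {w t : W} (h : shiEta cs w t ≠ 0) :
    cs.length (w * t) < cs.length w := by
  classical
  obtain ⟨ω, hω, rfl⟩ := cs.exists_isReduced w
  rw [shiEta, shiHom_word] at h
  have : t ∈ cs.rightInvSeq ω := by
    by_contra hn
    exact h (by simp [List.count_eq_zero_of_not_mem hn])
  exact (cs.isRightInversion_of_mem_rightInvSeq hω this).2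

theorem shiEta_of_lt (cs : CoxeterSystem M W) {w t : W} (ht : cs.IsReflection t)
    (h : cs.length (w * t) < cs.length w) : shiEta cs w t = 1 := by
  by_contra hn
  have h0 : shiEta cs w t = 0 := by
    generalize shiEta cs w t = x at *
    revert x; decide
  have h1 : shiEta cs (w * t) t ≠ 0 := by
    rw [shiEta_mul, shiEta_self cs ht]
    simp [h0]
  have := shiEta_lt cs h1
  rw [mul_assoc, ht.mul_self, mul_one] at this
  omega

theorem shiEta_path (cs : CoxeterSystem M W) {r : W} (hr : IsElementary cs r) {g h : W}
    (hgh : SameShiPart cs g h) : shiEta cs g⁻¹ r = shiEta cs h⁻¹ r := by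
  induction hgh with
  | refl => rfl
  | tail _ hst ih =>
    obtain ⟨i, rfl, hne⟩ := hst
    rw [ih, mul_inv_rev, shiEta_mul, cs.inv_simple, shiEta_simple, if_neg, add_zero]
    intro hc
    apply hne
    rw [← hc]
    convert hr using 1
    group

/-- `h ∈ W` is the smallest element of its Shi part iff for every `s ∈ S` with
`ℓ(hs) < ℓ(h)`, the reflection `hsh⁻¹` is elementary. -/
theorem eq_m_iff [Finite B] (cs : CoxeterSystem M W) (m : W → W)
    (hm : ∀ g : W, SameShiPart cs g (m g) ∧
      ∀ h : W, SameShiPart cs g h → WeakLe cs (m g) h)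
    (h : W) :
    h = m h ↔ ∀ i : B, cs.length (h * cs.simple i) < cs.length h →
      IsElementary cs (h * cs.simple i * h⁻¹) := by
  constructor
  · intro hh i hi
    by_contra hne
    have h1 := (hm h).2 (h * cs.simple i) (Relation.ReflTransGen.single ⟨i, rfl, hne⟩)
    rw [← hh, WeakLe] at h1
    omega
  · intro H
    by_contra hne
    obtain ⟨hp, hmin⟩ := hm h
    have hle := hmin h Relation.ReflTransGen.refl
    generalize m h = p at *
    have hv : p⁻¹ * h ≠ 1 := fun h1 => hne (inv_mul_eq_one.mp h1).symm
    obtain ⟨i, hi⟩ := cs.exists_rightDescent_of_ne_one hv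
    have hi' : cs.length (p⁻¹ * h * cs.simple i) < cs.length (p⁻¹ * h) := hi
    have hlt : cs.length (h * cs.simple i) < cs.length h := by
      have := cs.length_mul_le p (p⁻¹ * h * cs.simple i)
      rw [show p * (p⁻¹ * h * cs.simple i) = h * cs.simple i by group] at this
      rw [WeakLe] at hle
      omega
    have hel := H i hlt
    have key := shiEta_path cs hel hp
    have e2 := shiEta_mul cs (p⁻¹ * h)⁻¹ p⁻¹ (h * cs.simple i * h⁻¹)
    rw [show (p⁻¹ * h)⁻¹ * p⁻¹ = h⁻¹ by group, key] at e2
    have e3 : shiEta cs (p⁻¹ * h)⁻¹ (p⁻¹ * (h * cs.simple i * h⁻¹) * p⁻¹⁻¹) = 1 := by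
      apply shiEta_of_lt cs (hel.1.conj p⁻¹)
      rw [show (p⁻¹ * h)⁻¹ * (p⁻¹ * (h * cs.simple i * h⁻¹) * p⁻¹⁻¹) =
        (p⁻¹ * h * (cs.simple i)⁻¹)⁻¹ by group, cs.inv_simple, cs.length_inv, cs.length_inv]
      exact hi'
    rw [e3] at e2
    simp at e2
end

section
/- Cone type parts are convex in the Cayley graph: if g, g' ∈ W satisfy T(g⁻¹) = T(g'⁻¹), then every f ∈ W lying on a geodesic from g to g' (i.e., with ℓ(g⁻¹g') = ℓ(g⁻¹f) + ℓ(f⁻¹g')) satisfies T(f⁻¹) = T(g⁻¹). -/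
/-!
Let `(W,S)` be a Coxeter system, given by a Coxeter matrix `M : CoxeterMatrix B`
and `cs : CoxeterSystem M W`; the set `S` of simple reflections is the range of
`cs.simple`, and `S` is finite since `B` is finite.
-/

variable {B W : Type*} [Group W] {M : CoxeterMatrix B}

/-- The cone type of `g`: `T(g) = {h ∈ W : ℓ(gh) = ℓ(g) + ℓ(h)}`. -/
def ConeType (cs : CoxeterSystem M W) (g : W) : Set W :=
  {h : W | cs.length (g * h) = cs.length g + cs.length h}

open Classical in
/-- The action of a generator on `W × ZMod 2`. -/
noncomputable def ctStep (cs : CoxeterSystem M W) (i : B) : Equiv.Perm (W × ZMod 2) where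
  toFun p := (cs.simple i * p.1 * cs.simple i, p.2 + if p.1 = cs.simple i then 1 else 0)
  invFun p := (cs.simple i * p.1 * cs.simple i, p.2 + if p.1 = cs.simple i then 1 else 0)
  left_inv := by
    rintro ⟨t, z⟩
    have h : cs.simple i * t * cs.simple i = cs.simple i ↔ t = cs.simple i := by
      constructor
      · intro h
        have := congrArg (fun x => cs.simple i * x * cs.simple i) h
        simpa [mul_assoc] using this
      · rintro rfl; simp
    simp only [h, Prod.mk.injEq]
    refine ⟨by simp [mul_assoc], ?_⟩
    rw [add_assoc, CharTwo.add_self_eq_zero, add_zero]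
  right_inv := by
    rintro ⟨t, z⟩
    have h : cs.simple i * t * cs.simple i = cs.simple i ↔ t = cs.simple i := by
      constructor
      · intro h
        have := congrArg (fun x => cs.simple i * x * cs.simple i) h
        simpa [mul_assoc] using this
      · rintro rfl; simp
    simp only [h, Prod.mk.injEq]
    refine ⟨by simp [mul_assoc], ?_⟩
    rw [add_assoc, CharTwo.add_self_eq_zero, add_zero]

open Classical in
theorem ctStep_apply (cs : CoxeterSystem M W) (i : B) (t : W) (z : ZMod 2) :
    ctStep cs i (t, z) =
      (cs.simple i * t * cs.simple i, z + if t = cs.simple i then 1 else 0) := rfl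

theorem ct_conj {G : Type*} [Group G] {a b : G} (ha : a * a = 1) (hb : b * b = 1) (n : ℕ) :
    ((a * b) ^ n)⁻¹ * b = b * (a * b) ^ n := by
  have ha' : a⁻¹ = a := inv_eq_of_mul_eq_one_left ha
  have hb' : b⁻¹ = b := inv_eq_of_mul_eq_one_left hb
  induction n with
  | zero => simp
  | succ n ih =>
    have e : (a * b)⁻¹ * b = b * (a * b) := by
      rw [mul_inv_rev, ha', hb', mul_assoc]
    rw [pow_succ, mul_inv_rev, mul_assoc, ih, ← mul_assoc, e]
    rw [mul_assoc, ← pow_succ', ← pow_succ]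

open Classical in
theorem ctStep_pow (cs : CoxeterSystem M W) (i j : B) (n : ℕ) (t : W) (z : ZMod 2) :
    ((ctStep cs i * ctStep cs j) ^ n) (t, z) =
      ((cs.simple i * cs.simple j) ^ n * t * ((cs.simple i * cs.simple j) ^ n)⁻¹,
        z + ∑ k ∈ Finset.range (2 * n),
          if t = ((cs.simple i * cs.simple j) ^ k)⁻¹ * cs.simple j then 1 else 0) := by
  have ha : cs.simple i * cs.simple i = 1 := by simp
  have hb : cs.simple j * cs.simple j = 1 := by simp
  have ha' : (cs.simple i)⁻¹ = cs.simple i := by simp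
  have hb' : (cs.simple j)⁻¹ = cs.simple j := by simp
  have hc := ct_conj ha hb
  induction n with
  | zero => simp
  | succ n ih =>
    rw [pow_succ', Equiv.Perm.mul_apply, ih, Equiv.Perm.mul_apply, ctStep_apply, ctStep_apply]
    rw [show 2 * (n + 1) = 2 * n + 1 + 1 by ring, Finset.sum_range_succ, Finset.sum_range_succ]
    generalize cs.simple i = a at *
    generalize cs.simple j = b at *
    have h1 : (a * b) ^ n * t * ((a * b) ^ n)⁻¹ = b ↔ t = ((a * b) ^ (2 * n))⁻¹ * b := by
      rw [mul_inv_eq_iff_eq_mul, ← eq_inv_mul_iff_mul_eq, ← hc, ← mul_assoc, ← mul_inv_rev,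
        ← pow_add, two_mul]
    have h2 : b * ((a * b) ^ n * t * ((a * b) ^ n)⁻¹) * b = a ↔
        t = ((a * b) ^ (2 * n + 1))⁻¹ * b := by
      rw [← eq_mul_inv_iff_mul_eq, ← eq_inv_mul_iff_mul_eq, mul_inv_eq_iff_eq_mul,
        ← eq_inv_mul_iff_mul_eq, hb']
      have : ((a * b) ^ (2 * n + 1))⁻¹ * b = ((a * b) ^ n)⁻¹ * (b * (a * b) * (a * b) ^ n) := by
        rw [show 2 * n + 1 = (n + 1) + n by ring, pow_add, mul_inv_rev, mul_assoc, hc (n+1),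
          pow_succ']
        simp only [mul_assoc]
      rw [this]
    simp only [h1, h2]
    refine Prod.ext ?_ ?_
    · simp only [pow_succ', mul_inv_rev, ha', hb', mul_assoc]
    · simp only [add_assoc]

theorem ctStep_liftable (cs : CoxeterSystem M W) : M.IsLiftable (ctStep cs) := by
  classical
  intro i j
  ext1 ⟨t, z⟩
  rw [ctStep_pow]
  have hm : (cs.simple i * cs.simple j) ^ M i j = 1 := cs.simple_mul_simple_pow i j
  rw [two_mul, Finset.sum_range_add]
  simp only [pow_add, hm, one_mul, inv_one, mul_one, CharTwo.add_self_eq_zero, add_zero]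
  rfl

/-- The sign representation on `W × ZMod 2`. -/
noncomputable def ctHom (cs : CoxeterSystem M W) : W →* Equiv.Perm (W × ZMod 2) :=
  cs.lift ⟨ctStep cs, ctStep_liftable cs⟩

/-- The inversion cocycle. -/
noncomputable def ctEta (cs : CoxeterSystem M W) (w t : W) : ZMod 2 := (ctHom cs w (t, 0)).2

theorem ctHom_simple (cs : CoxeterSystem M W) (i : B) : ctHom cs (cs.simple i) = ctStep cs i :=
  cs.lift_apply_simple (ctStep_liftable cs) i

theorem ctHom_apply (cs : CoxeterSystem M W) (w : W) :
    ∀ (t : W) (z : ZMod 2), ctHom cs w (t, z) = (w * t * w⁻¹, z + ctEta cs w t) := by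
  classical
  induction w using cs.simple_induction_left with
  | one => intro t z; simp [ctEta]
  | mul_simple_left w i ih =>
    intro t z
    unfold ctEta
    rw [map_mul, Equiv.Perm.mul_apply, Equiv.Perm.mul_apply, ih, ih, ctHom_simple, ctStep_apply,
      ctStep_apply]
    simp [mul_assoc, add_assoc]

theorem ctEta_mul (cs : CoxeterSystem M W) (w x t : W) :
    ctEta cs (w * x) t = ctEta cs x t + ctEta cs w (x * t * x⁻¹) := by
  rw [ctEta, map_mul, Equiv.Perm.mul_apply, ctHom_apply, ctHom_apply]
  simp

open Classical in
theorem ctEta_simple (cs : CoxeterSystem M W) (i : B) (t : W) :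
    ctEta cs (cs.simple i) t = if t = cs.simple i then 1 else 0 := by
  rw [ctEta, ctHom_simple, ctStep_apply]; simp

theorem ctEta_mem (cs : CoxeterSystem M W) (t : W) (ω : List B)
    (h : ctEta cs (cs.wordProd ω) t ≠ 0) : t ∈ cs.rightInvSeq ω := by
  classical
  induction ω with
  | nil => simp [ctEta] at h
  | cons i ω ih =>
    rw [cs.wordProd_cons, ctEta_mul, ctEta_simple] at h
    rw [CoxeterSystem.rightInvSeq, List.mem_cons]
    by_cases h0 : ctEta cs (cs.wordProd ω) t = 0
    · left
      rw [h0, zero_add] at h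
      have : cs.wordProd ω * t * (cs.wordProd ω)⁻¹ = cs.simple i := by
        by_contra hne
        simp [hne] at h
      rw [← this]; group
    · exact Or.inr (ih h0)

theorem ctEta_lt (cs : CoxeterSystem M W) (w t : W) (h : ctEta cs w t ≠ 0) :
    cs.length (w * t) < cs.length w := by
  obtain ⟨ω, hω, rfl⟩ := cs.exists_isReduced w
  exact (cs.isRightInversion_of_mem_rightInvSeq hω (ctEta_mem cs t ω h)).2

theorem ctEta_zero_iff (cs : CoxeterSystem M W) (w : W) (i : B) :
    ctEta cs w (cs.simple i) = 0 ↔ cs.length (w * cs.simple i) = cs.length w + 1 := by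
  classical
  constructor
  · intro h
    have h1 : ctEta cs (w * cs.simple i) (cs.simple i) ≠ 0 := by
      rw [ctEta_mul, ctEta_simple]; simp [h]
    have := ctEta_lt cs _ _ h1
    rw [mul_assoc, cs.simple_mul_simple_self, mul_one] at this
    rcases cs.length_mul_simple w i with h | h <;> omega
  · intro h
    by_contra hne
    have := ctEta_lt cs _ _ hne
    omega

theorem ct_convex (cs : CoxeterSystem M W) (g g' f h : W) (i : B)
    (hf : cs.length (g⁻¹ * g') = cs.length (g⁻¹ * f) + cs.length (f⁻¹ * g'))
    (h1 : ctEta cs (g⁻¹ * h) (cs.simple i) = ctEta cs (g'⁻¹ * h) (cs.simple i)) :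
    ctEta cs (f⁻¹ * h) (cs.simple i) = ctEta cs (g⁻¹ * h) (cs.simple i) := by
  by_contra hne
  have key : ∀ x : W, ctEta cs (f⁻¹ * h) (cs.simple i) ≠ ctEta cs (x⁻¹ * h) (cs.simple i) →
      cs.length (x⁻¹ * f * (f⁻¹ * h * cs.simple i * (f⁻¹ * h)⁻¹)) < cs.length (x⁻¹ * f) := by
    intro x hx
    apply ctEta_lt
    intro h0
    apply hx
    have := ctEta_mul cs (x⁻¹ * f) (f⁻¹ * h) (cs.simple i)
    rw [h0, add_zero] at this
    rw [← this]; congr 1; group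
  have k1 := key g hne
  have k2 := key g' (h1 ▸ hne)
  rw [← cs.length_inv (g'⁻¹ * f), ← cs.length_inv (g'⁻¹ * f * _)] at k2
  have k3 := cs.length_mul_le (g⁻¹ * f * (f⁻¹ * h * cs.simple i * (f⁻¹ * h)⁻¹))
    (g'⁻¹ * f * (f⁻¹ * h * cs.simple i * (f⁻¹ * h)⁻¹))⁻¹
  have e1 : (g⁻¹ * f * (f⁻¹ * h * cs.simple i * (f⁻¹ * h)⁻¹)) *
    (g'⁻¹ * f * (f⁻¹ * h * cs.simple i * (f⁻¹ * h)⁻¹))⁻¹ = g⁻¹ * g' := by group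
  have e2 : (g'⁻¹ * f)⁻¹ = f⁻¹ * g' := by group
  rw [e1] at k3
  rw [e2] at k2
  omega

theorem ct_mem_step (cs : CoxeterSystem M W) (x h : W) (i : B)
    (hl : cs.length (h * cs.simple i) = cs.length h + 1) :
    h * cs.simple i ∈ ConeType cs x ↔
      h ∈ ConeType cs x ∧ ctEta cs (x * h) (cs.simple i) = 0 := by
  rw [ctEta_zero_iff]
  simp only [ConeType, Set.mem_ofPred_eq, hl, ← mul_assoc]
  have h1 := cs.length_mul_le x h
  have h2 := cs.length_mul_simple (x * h) i
  omega

/-- Cone type parts are convex: if `T(g⁻¹) = T(g'⁻¹)` and `f` lies on a geodesic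
from `g` to `g'`, then `T(f⁻¹) = T(g⁻¹)`. -/
theorem cone_type_part_convex [Finite B] (cs : CoxeterSystem M W) (g g' : W)
    (hgg' : ConeType cs g⁻¹ = ConeType cs g'⁻¹) (f : W)
    (hf : cs.length (g⁻¹ * g') = cs.length (g⁻¹ * f) + cs.length (f⁻¹ * g')) :
    ConeType cs f⁻¹ = ConeType cs g⁻¹ := by
  have main : ∀ n : ℕ, ∀ h : W, cs.length h = n →
      (h ∈ ConeType cs f⁻¹ ↔ h ∈ ConeType cs g⁻¹) := by
    intro n
    induction n with
    | zero =>
      intro h hh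
      rw [cs.length_eq_zero_iff] at hh
      subst hh
      simp [ConeType]
    | succ n ih =>
      intro h hh
      have hne : h ≠ 1 := by
        rintro rfl
        simp at hh
      obtain ⟨i, hi⟩ := cs.exists_rightDescent_of_ne_one hne
      rw [cs.isRightDescent_iff] at hi
      obtain ⟨k, rfl⟩ : ∃ k, h = k * cs.simple i := ⟨h * cs.simple i, by simp [mul_assoc]⟩
      rw [mul_assoc, cs.simple_mul_simple_self, mul_one] at hi
      have hk := ih k (by omega)
      have hG' : k * cs.simple i ∈ ConeType cs g⁻¹ ↔ k * cs.simple i ∈ ConeType cs g'⁻¹ := by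
        rw [hgg']
      rw [ct_mem_step cs _ _ _ hi.symm, ct_mem_step cs _ _ _ hi.symm, ← hgg'] at hG'
      rw [ct_mem_step cs _ _ _ hi.symm, ct_mem_step cs _ _ _ hi.symm, hk]
      refine and_congr_right fun hkg => ?_
      have h0 : ctEta cs (g⁻¹ * k) (cs.simple i) = 0 ↔ ctEta cs (g'⁻¹ * k) (cs.simple i) = 0 := by
        simpa [hkg] using hG'
      have h1 : ctEta cs (g⁻¹ * k) (cs.simple i) = ctEta cs (g'⁻¹ * k) (cs.simple i) := by
        have hz : ∀ a b : ZMod 2, (a = 0 ↔ b = 0) → a = b := by decide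
        exact hz _ _ h0
      rw [ct_convex cs g g' f k i hf h1]
  ext h
  exact main _ h rfl
end

section
/- For all g, h ∈ W with g ⪯ h, we have μ(g) ⪯ μ(h). -/
/-!
Let `(W,S)` be a Coxeter system, given by a Coxeter matrix `M : CoxeterMatrix B`
and `cs : CoxeterSystem M W`; the set `S` of simple reflections is the range of
`cs.simple`, and `S` is finite since `B` is finite.
-/

variable {B W : Type*} [Group W] {M : CoxeterMatrix B}

open CoxeterSystem in
theorem aux_smul (cs : CoxeterSystem M W) (i : B) (x : W) :
    cs.simple i * (cs.simple i * x) = x := by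
  rw [← mul_assoc, cs.simple_mul_simple_self, one_mul]

open Classical in
/-- sign permutation -/
noncomputable def sgnPerm (cs : CoxeterSystem M W) (i : B) : Equiv.Perm (W × ZMod 2) where
  toFun p := (cs.simple i * p.1 * cs.simple i, p.2 + if p.1 = cs.simple i then 1 else 0)
  invFun p := (cs.simple i * p.1 * cs.simple i, p.2 + if p.1 = cs.simple i then 1 else 0)
  left_inv p := by
    have h : (cs.simple i * p.1 * cs.simple i = cs.simple i) ↔ p.1 = cs.simple i := by
      constructor
      · intro h
        have := congrArg (fun x => cs.simple i * x * cs.simple i) h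
        simpa [mul_assoc, aux_smul] using this
      · intro h; simp [h]
    ext
    · simp [mul_assoc, aux_smul]
    · simp only [h, add_assoc, ← two_mul]
      rw [show (2 : ZMod 2) = 0 from rfl]; simp
  right_inv p := by
    have h : (cs.simple i * p.1 * cs.simple i = cs.simple i) ↔ p.1 = cs.simple i := by
      constructor
      · intro h
        have := congrArg (fun x => cs.simple i * x * cs.simple i) h
        simpa [mul_assoc, aux_smul] using this
      · intro h; simp [h]
    ext
    · simp [mul_assoc, aux_smul]
    · simp only [h, add_assoc, ← two_mul]
      rw [show (2 : ZMod 2) = 0 from rfl]; simp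

theorem aux_conj_pow (cs : CoxeterSystem M W) (i j : B) (k : ℕ) :
    cs.simple j * (cs.simple i * cs.simple j) ^ k =
      ((cs.simple i * cs.simple j)⁻¹) ^ k * cs.simple j := by
  induction k with
  | zero => simp
  | succ k ih =>
    rw [pow_succ, ← mul_assoc, ih, pow_succ]
    simp [mul_assoc]

open Classical in
theorem sgnPerm_pow (cs : CoxeterSystem M W) (i j : B) (k : ℕ) (p : W × ZMod 2) :
    ((sgnPerm cs i * sgnPerm cs j) ^ k) p =
      ((cs.simple i * cs.simple j) ^ k * p.1 * ((cs.simple i * cs.simple j) ^ k)⁻¹,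
        p.2 + ∑ n ∈ Finset.range (2 * k),
          if p.1 = ((cs.simple i * cs.simple j)⁻¹) ^ n * cs.simple j then 1 else 0) := by
  induction k with
  | zero => simp
  | succ k ih =>
    rw [pow_succ', Equiv.Perm.mul_apply, ih, Equiv.Perm.mul_apply]
    have e1 : ((cs.simple i * cs.simple j) ^ k * p.1 * ((cs.simple i * cs.simple j) ^ k)⁻¹
        = cs.simple j) ↔ p.1 = ((cs.simple i * cs.simple j)⁻¹) ^ (2 * k) * cs.simple j := by
      rw [mul_inv_eq_iff_eq_mul, aux_conj_pow, ← eq_inv_mul_iff_mul_eq, two_mul, pow_add,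
        inv_pow, mul_assoc]
    have e2 : (cs.simple j * ((cs.simple i * cs.simple j) ^ k * p.1 *
        ((cs.simple i * cs.simple j) ^ k)⁻¹) * cs.simple j
        = cs.simple i) ↔ p.1 = ((cs.simple i * cs.simple j)⁻¹) ^ (2 * k + 1) * cs.simple j := by
      have : (cs.simple j * ((cs.simple i * cs.simple j) ^ k * p.1 *
        ((cs.simple i * cs.simple j) ^ k)⁻¹) * cs.simple j
        = cs.simple i) ↔ (((cs.simple i * cs.simple j) ^ k * p.1 *
        ((cs.simple i * cs.simple j) ^ k)⁻¹) =
          (cs.simple i * cs.simple j)⁻¹ * cs.simple j) := by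
        constructor
        · intro h
          have := congrArg (fun x => cs.simple j * x * cs.simple j) h
          simpa [mul_assoc, aux_smul] using this
        · intro h
          rw [h]; simp [mul_assoc, aux_smul]
      rw [this, mul_inv_eq_iff_eq_mul, mul_assoc _ (cs.simple j) (_ ^ k), aux_conj_pow,
        ← eq_inv_mul_iff_mul_eq, ← inv_pow, ← mul_assoc, ← mul_assoc, ← pow_succ, ← pow_add,
        show k + 1 + k = 2 * k + 1 by ring]
    rw [show 2 * (k + 1) = 2 * k + 1 + 1 by ring, Finset.sum_range_succ, Finset.sum_range_succ]
    simp only [sgnPerm, Equiv.coe_fn_mk]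
    ext
    · simp [pow_succ', mul_assoc]
    · simp only [e1, e2]; ring

theorem sgnPerm_liftable (cs : CoxeterSystem M W) : M.IsLiftable (sgnPerm cs) := by
  classical
  intro i j
  ext1 p
  have h := cs.simple_mul_simple_pow i j
  rw [sgnPerm_pow, h]
  have : ∑ n ∈ Finset.range (2 * M i j),
      (if p.1 = ((cs.simple i * cs.simple j)⁻¹) ^ n * cs.simple j then (1 : ZMod 2) else 0) = 0 := by
    rw [two_mul, Finset.sum_range_add]
    simp only [pow_add, inv_pow _ (M i j), h]
    simp only [inv_one, one_mul, ← two_mul]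
    rw [show (2 : ZMod 2) = 0 from rfl]; simp
  rw [this]; simp

theorem mem_lis (cs : CoxeterSystem M W) (ω : List B) (t : W) (e : ZMod 2)
    (h : (cs.lift ⟨sgnPerm cs, sgnPerm_liftable cs⟩ (cs.wordProd ω)⁻¹ (t, e)).2 ≠ e) :
    t ∈ cs.leftInvSeq ω := by
  induction ω generalizing t e with
  | nil => simp at h
  | cons i ω ih =>
    rw [cs.wordProd_cons, mul_inv_rev, cs.inv_simple, map_mul, Equiv.Perm.mul_apply,
      cs.lift_apply_simple (sgnPerm_liftable cs)] at h
    rw [CoxeterSystem.leftInvSeq]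
    by_cases ht : t = cs.simple i
    · simp [ht]
    · simp only [sgnPerm, Equiv.coe_fn_mk, ht, if_false, add_zero] at h
      have := ih _ _ h
      refine List.mem_cons_of_mem _ (List.mem_map.2 ⟨_, this, ?_⟩)
      simp [mul_assoc, aux_smul]

theorem exchange0 (cs : CoxeterSystem M W) (i : B) (ω : List B)
    (h : cs.length (cs.simple i * cs.wordProd ω) < cs.length (cs.wordProd ω)) :
    ∃ k < ω.length, cs.simple i * cs.wordProd ω = cs.wordProd (ω.eraseIdx k) := by
  have hm : cs.simple i ∈ cs.leftInvSeq ω := by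
    by_contra hn
    have h0 : ∀ e, (cs.lift ⟨sgnPerm cs, sgnPerm_liftable cs⟩ (cs.wordProd ω)⁻¹
        (cs.simple i, e)).2 = e := by
      intro e
      by_contra h1
      exact hn (mem_lis cs ω _ e h1)
    obtain ⟨ω', hr, hw⟩ := cs.exists_isReduced (cs.simple i * cs.wordProd ω)
    have hw' : cs.wordProd ω = cs.simple i * cs.wordProd ω' := by rw [← hw, aux_smul]
    have h1 := h0 0
    rw [hw', mul_inv_rev, cs.inv_simple, map_mul, Equiv.Perm.mul_apply,
      cs.lift_apply_simple (sgnPerm_liftable cs)] at h1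
    simp only [sgnPerm, Equiv.coe_fn_mk, if_true, cs.simple_mul_simple_self, one_mul, zero_add]
      at h1
    have h2 := mem_lis cs ω' (cs.simple i) 1 (by
      intro h3
      have := h3.symm.trans h1
      exact absurd this (by decide))
    have h3 := (cs.isLeftInversion_of_mem_leftInvSeq hr h2).2
    rw [← hw', ← hw] at h3
    omega
  obtain ⟨k, hk, hk'⟩ := List.getElem_of_mem hm
  refine ⟨k, by simpa using hk, ?_⟩
  rw [← cs.getD_leftInvSeq_mul_wordProd, List.getD_eq_getElem _ _ hk, hk']

theorem exchange (cs : CoxeterSystem M W) (i : B) (x y : W)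
    (h : cs.length (cs.simple i * (x * y)) < cs.length (x * y))
    (hx : cs.length x < cs.length (cs.simple i * x)) :
    cs.length (x⁻¹ * (cs.simple i * (x * y))) < cs.length y := by
  obtain ⟨ω, hr, rfl⟩ := cs.exists_isReduced x
  obtain ⟨ω', hr', rfl⟩ := cs.exists_isReduced y
  rw [← cs.wordProd_append] at h ⊢
  obtain ⟨k, hk, he⟩ := exchange0 cs i _ h
  rw [List.length_append] at hk
  by_cases hk' : k < ω.length
  · exfalso
    rw [List.eraseIdx_append_of_lt_length hk', cs.wordProd_append, cs.wordProd_append,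
      ← mul_assoc, mul_left_inj] at he
    have h1 := cs.length_wordProd_le (ω.eraseIdx k)
    rw [← he, List.length_eraseIdx_of_lt hk'] at h1
    rw [hr.eq] at hx
    omega
  · rw [he, List.eraseIdx_append_of_length_le (by omega), cs.wordProd_append, inv_mul_cancel_left]
    have h1 := cs.length_wordProd_le (ω'.eraseIdx (k - ω.length))
    rw [List.length_eraseIdx_of_lt (by omega)] at h1
    rw [hr'.eq]
    omega

/-- parabolic subgroup membership -/
def InJ (cs : CoxeterSystem M W) (J : Set B) (d : W) : Prop :=
  ∃ ω : List B, (∀ x ∈ ω, x ∈ J) ∧ cs.wordProd ω = d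

theorem InJ.mul {cs : CoxeterSystem M W} {J : Set B} {c d : W} (hc : InJ cs J c)
    (hd : InJ cs J d) : InJ cs J (c * d) := by
  obtain ⟨ω, h, rfl⟩ := hc
  obtain ⟨ω', h', rfl⟩ := hd
  refine ⟨ω ++ ω', ?_, cs.wordProd_append _ _⟩
  intro x hx
  rcases List.mem_append.1 hx with hx | hx
  · exact h x hx
  · exact h' x hx

theorem InJ.inv {cs : CoxeterSystem M W} {J : Set B} {c : W} (hc : InJ cs J c) :
    InJ cs J c⁻¹ := by
  obtain ⟨ω, h, rfl⟩ := hc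
  exact ⟨ω.reverse, by simpa using h, cs.wordProd_reverse _⟩

theorem InJ.one {cs : CoxeterSystem M W} {J : Set B} : InJ cs J 1 := ⟨[], by simp, by simp⟩

theorem InJ.simple {cs : CoxeterSystem M W} {J : Set B} {i : B} (hi : i ∈ J) :
    InJ cs J (cs.simple i) := ⟨[i], by simpa using hi, by simp⟩

theorem InJ.reduced {cs : CoxeterSystem M W} {J : Set B} {d : W} (hd : InJ cs J d) :
    ∃ ω : List B, (∀ x ∈ ω, x ∈ J) ∧ cs.IsReduced ω ∧ cs.wordProd ω = d := by
  obtain ⟨ω, h, rfl⟩ := hd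
  induction ω with
  | nil => exact ⟨[], by simp, by simp [CoxeterSystem.IsReduced], rfl⟩
  | cons i ω ih =>
    obtain ⟨ω', h1, h2, h3⟩ := ih (fun x hx => h x (List.mem_cons_of_mem _ hx))
    have hi : i ∈ J := h i (by simp)
    rcases cs.length_simple_mul (cs.wordProd ω') i with h4 | h4
    · refine ⟨i :: ω', ?_, ?_, ?_⟩
      · intro x hx
        rcases List.mem_cons.1 hx with rfl | hx
        · exact hi
        · exact h1 x hx
      · rw [CoxeterSystem.IsReduced, cs.wordProd_cons, h4, h2.eq, List.length_cons]
      · rw [cs.wordProd_cons, cs.wordProd_cons, h3]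
    · obtain ⟨k, hk, he⟩ := exchange0 cs i ω' (by omega)
      refine ⟨ω'.eraseIdx k, fun x hx => h1 x (List.mem_of_mem_eraseIdx hx), ?_, ?_⟩
      · rw [CoxeterSystem.IsReduced, ← he, List.length_eraseIdx_of_lt hk]
        rw [h2.eq] at h4
        omega
      · rw [← he, cs.wordProd_cons, h3]

theorem reduced_tail {cs : CoxeterSystem M W} {i : B} {ω : List B}
    (h : cs.IsReduced (i :: ω)) : cs.IsReduced ω := by
  simpa using h.drop 1

theorem reduced_cons_lt {cs : CoxeterSystem M W} {i : B} {ω : List B}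
    (h : cs.IsReduced (i :: ω)) :
    cs.length (cs.wordProd ω) < cs.length (cs.simple i * cs.wordProd ω) := by
  have h1 := h.eq
  rw [cs.wordProd_cons, List.length_cons] at h1
  have := cs.length_wordProd_le ω
  omega

/-- minimal left coset representatives -/
def JMin (cs : CoxeterSystem M W) (J : Set B) (x : W) : Prop :=
  ∀ d, InJ cs J d → cs.length (d * x) = cs.length d + cs.length x

theorem jmin_of_min (cs : CoxeterSystem M W) (J : Set B) (x : W)
    (hx : ∀ d, InJ cs J d → cs.length x ≤ cs.length (d * x)) : JMin cs J x := by
  intro d hd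
  obtain ⟨ω, h, hr, rfl⟩ := hd.reduced
  clear hd
  induction ω with
  | nil => simp
  | cons k ω ih =>
    have hω : ∀ x ∈ ω, x ∈ J := fun x hx => h x (List.mem_cons_of_mem _ hx)
    have h1 := ih hω (reduced_tail hr)
    have h2 := hr.eq
    have h3 := (reduced_tail hr).eq
    have h5 := reduced_cons_lt hr
    rw [cs.wordProd_cons, List.length_cons] at h2
    rw [cs.wordProd_cons, mul_assoc]
    rcases cs.length_simple_mul (cs.wordProd ω * x) k with h4 | h4
    · omega
    · exfalso
      have h6 := exchange cs k (cs.wordProd ω) x (by omega) h5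
      have hI : InJ cs J (cs.wordProd ω) := ⟨ω, hω, rfl⟩
      have h7 := hx _ ((hI.inv.mul (InJ.simple (h k (by simp)))).mul hI)
      simp only [mul_assoc] at h6 h7
      omega

theorem exists_min {p : W → Prop} (f : W → ℕ) (h : ∃ x, p x) :
    ∃ x, p x ∧ ∀ y, p y → f x ≤ f y := by
  obtain ⟨x, hx, hm⟩ := WellFounded.has_min (measure f).wf {x | p x} h
  exact ⟨x, hx, fun y hy => not_lt.1 (hm y hy)⟩

theorem jmin_of_desc (cs : CoxeterSystem M W) (J : Set B) (x : W)
    (hx : ∀ k ∈ J, cs.length x < cs.length (cs.simple k * x)) : JMin cs J x := by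
  obtain ⟨d, hd, hm⟩ := exists_min (p := InJ cs J) (fun d => cs.length (d * x)) ⟨1, InJ.one⟩
  have h0 : JMin cs J (d * x) := by
    apply jmin_of_min
    intro c hc
    have := hm (c * d) (hc.mul hd)
    simpa [mul_assoc] using this
  obtain ⟨ω, h, hr, he⟩ := hd.inv.reduced
  cases ω with
  | nil =>
    have : d = 1 := by simpa using he.symm
    simpa [this] using h0
  | cons k ω =>
    exfalso
    have h1 := hx k (h k (by simp))
    have hω : InJ cs J (cs.wordProd ω) := ⟨ω, fun x hx => h x (List.mem_cons_of_mem _ hx), rfl⟩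
    have h2 := h0 _ hω
    have h3 := h0 _ hd.inv
    have h5 := reduced_cons_lt hr
    rw [← cs.wordProd_cons, he] at h5
    have h6 : cs.wordProd ω = cs.simple k * d⁻¹ := by
      rw [← he, cs.wordProd_cons, aux_smul]
    rw [h6] at h2 h5
    simp only [mul_assoc, inv_mul_cancel_left] at h2 h3
    omega

theorem jmax (cs : CoxeterSystem M W) (J : Set B) (h : W)
    (hh : ∀ k ∈ J, cs.length (h * cs.simple k) < cs.length h) (d : W) (hd : InJ cs J d) :
    cs.length (h * d) + cs.length d = cs.length h := by
  obtain ⟨ω, hJ, hr, rfl⟩ := hd.reduced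
  clear hd
  induction ω with
  | nil => simp
  | cons k ω ih =>
    have h1 := ih (fun x hx => hJ x (List.mem_cons_of_mem _ hx)) (reduced_tail hr)
    have h2 := hr.eq
    have h3 := (reduced_tail hr).eq
    have h5 := reduced_cons_lt hr
    have h6 := hh k (hJ k (by simp))
    have h7 := exchange cs k (cs.wordProd ω) ((cs.wordProd ω)⁻¹ * h⁻¹) (by
      rw [mul_inv_cancel_left, ← cs.length_inv, mul_inv_rev, inv_inv, cs.inv_simple,
        cs.length_inv]
      exact h6) h5
    rw [mul_inv_cancel_left, ← mul_inv_rev, cs.length_inv, ← cs.length_inv] at h7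
    have h8 : ((cs.wordProd ω)⁻¹ * (cs.simple k * h⁻¹))⁻¹ = h * cs.wordProd (k :: ω) := by
      simp [cs.wordProd_cons, mul_assoc]
    rw [h8] at h7
    have h9 := cs.length_le_length_mul_add_right h (cs.wordProd (k :: ω))
    rw [List.length_cons] at h2
    omega

theorem length_one_InJ (cs : CoxeterSystem M W) (J : Set B) (d : W) (hd : InJ cs J d)
    (h : cs.length d = 1) : ∃ k ∈ J, d = cs.simple k := by
  obtain ⟨ω, hJ, hr, rfl⟩ := hd.reduced
  have := hr.eq
  rw [h] at this
  obtain ⟨k, rfl⟩ := List.length_eq_one_iff.1 this.symm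
  exact ⟨k, hJ k (by simp), by simp⟩

/-- core combinatorial lemma -/
theorem core (cs : CoxeterSystem M W) (J : Set B) (b v : W) (i j : B)
    (hi : i ∈ J) (hj : j ∈ J) (hJ : ∀ k ∈ J, cs.simple k = cs.simple i ∨ cs.simple k = cs.simple j)
    (hb : ∀ k ∈ J, cs.length b < cs.length (b * cs.simple k))
    (hv : cs.length (b * v) + cs.length b = cs.length v)
    (hv1 : ¬ JMin cs J v) (hv2 : ¬ JMin cs J (cs.simple j * v)) :
    ∃ u, cs.length (b * u) + cs.length b = cs.length u ∧ JMin cs J (cs.simple i * u) ∧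
      cs.length u = cs.length (cs.simple i * u) + 1 := by
  obtain ⟨v, ⟨hv, hv1, hv2⟩, hmin⟩ := exists_min (p := fun v =>
    cs.length (b * v) + cs.length b = cs.length v ∧ ¬ JMin cs J v ∧
      ¬ JMin cs J (cs.simple j * v)) cs.length ⟨v, hv, hv1, hv2⟩
  have hmin' : ∀ y, cs.length (b * y) + cs.length b = cs.length y → cs.length y < cs.length v →
      JMin cs J y ∨ JMin cs J (cs.simple j * y) := by
    intro y hy hlt
    by_contra hc
    rw [not_or] at hc
    have := hmin y ⟨hy, hc.1, hc.2⟩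
    omega
  have L : ∀ k ∈ J, cs.length (cs.simple k * v) < cs.length v →
      cs.length (b * (cs.simple k * v)) + cs.length b = cs.length (cs.simple k * v) ∧
      cs.length v = cs.length (cs.simple k * v) + 1 := by
    intro k hk hlt
    have h1 := exchange cs k b⁻¹ (b * v) (by simpa using hlt) (by
      rw [← cs.length_inv (cs.simple k * b⁻¹)]
      simpa using hb k hk)
    simp only [inv_mul_cancel_left, inv_inv] at h1
    have h2 := cs.length_le_length_mul_add_left b (cs.simple k * v)
    have h3 := cs.length_simple_mul v k
    omega
  have hjd : cs.length v < cs.length (cs.simple j * v) := by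
    by_contra hc
    have hne := cs.length_simple_mul_ne v j
    have hlt : cs.length (cs.simple j * v) < cs.length v := by omega
    rcases hmin' _ (L j hj hlt).1 hlt with h | h
    · exact hv2 h
    · rw [aux_smul] at h; exact hv1 h
  have hid : cs.length (cs.simple i * v) < cs.length v := by
    by_contra hc
    have hne := cs.length_simple_mul_ne v i
    apply hv1
    apply jmin_of_desc
    intro k hk
    rcases hJ k hk with h | h <;> rw [h]
    · omega
    · exact hjd
  obtain ⟨hA, hl⟩ := L i hi hid
  rcases hmin' _ hA hid with h | h
  · exact ⟨v, hv, h, hl⟩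
  exfalso
  set x := cs.simple j * (cs.simple i * v) with hx
  have hvx : v = cs.simple i * (cs.simple j * x) := by rw [hx, aux_smul, aux_smul]
  have Ii : InJ cs J (cs.simple i) := InJ.simple hi
  have Ij : InJ cs J (cs.simple j) := InJ.simple hj
  have l1 := h _ Ij
  rw [hx, aux_smul, ← hx, cs.length_simple] at l1
  have l2 := h _ (Ii.mul Ij)
  rw [mul_assoc, ← hvx] at l2
  have l2' : cs.length (cs.simple j * cs.simple i) = cs.length (cs.simple i * cs.simple j) := by
    rw [← cs.length_inv]; simp
  have l3 := h _ (Ij.mul (Ii.mul Ij))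
  rw [mul_assoc, mul_assoc, ← hvx] at l3
  have hbv : cs.length (b * v) ≠ 0 := by omega
  obtain ⟨ω, hr, hω⟩ := cs.exists_isReduced (b * v)⁻¹
  have hl' := hr.eq
  cases ω with
  | nil =>
    rw [← hω, cs.length_inv] at hl'
    exact hbv hl'
  | cons q ω =>
    have h5 := reduced_cons_lt hr
    have h6 : cs.wordProd ω = (b * (v * cs.simple q))⁻¹ := by
      rw [cs.wordProd_cons] at hω
      rw [← mul_assoc, mul_inv_rev, hω, cs.inv_simple, aux_smul]
    rw [← cs.wordProd_cons, ← hω, h6, cs.length_inv, cs.length_inv] at h5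
    have h7 := cs.length_le_length_mul_add_left b (v * cs.simple q)
    have h8 := cs.length_mul_simple v q
    have h8' := cs.length_mul_simple (b * v) q
    rw [mul_assoc] at h8'
    have h9 := cs.length_mul_simple x q
    rcases hmin' (v * cs.simple q) (by omega) (by omega) with hq | hq
    · have := hq _ (Ij.mul Ii)
      rw [show cs.simple j * cs.simple i * (v * cs.simple q) = x * cs.simple q by
        rw [hx]; simp only [mul_assoc]] at this
      omega
    · have a1 := hq _ (Ij.mul (Ii.mul Ij))
      have a2 := hq _ Ij
      rw [show cs.simple j * (cs.simple i * cs.simple j) * (cs.simple j * (v * cs.simple q))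
        = x * cs.simple q by
        rw [hx]; simp only [mul_assoc, aux_smul]] at a1
      rw [aux_smul, cs.length_simple] at a2
      omega

theorem weakLe_cone {cs : CoxeterSystem M W} {g h : W} (hgh : WeakLe cs g h) :
    ConeType cs h⁻¹ ⊆ ConeType cs g⁻¹ := by
  intro w hw
  simp only [ConeType, Set.mem_setOf_eq, cs.length_inv] at hw ⊢
  unfold WeakLe at hgh
  have h1 := cs.length_mul_le (g⁻¹ * h)⁻¹ (g⁻¹ * w)
  rw [cs.length_inv, show (g⁻¹ * h)⁻¹ * (g⁻¹ * w) = h⁻¹ * w by group] at h1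
  have h2 := cs.length_mul_le g⁻¹ w
  rw [cs.length_inv] at h2
  omega

theorem weakLe_refl (cs : CoxeterSystem M W) (g : W) : WeakLe cs g g := by simp [WeakLe]

theorem weakLe_trans {cs : CoxeterSystem M W} {a b c : W} (h1 : WeakLe cs a b)
    (h2 : WeakLe cs b c) : WeakLe cs a c := by
  unfold WeakLe at *
  have h3 := cs.length_mul_le (a⁻¹ * b) (b⁻¹ * c)
  rw [show (a⁻¹ * b) * (b⁻¹ * c) = a⁻¹ * c by group] at h3
  have h4 := cs.length_mul_le a (a⁻¹ * c)
  rw [mul_inv_cancel_left] at h4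
  omega

theorem weakLe_simple {cs : CoxeterSystem M W} {h : W} {s : B}
    (hs : cs.length (h * cs.simple s) < cs.length h) : WeakLe cs (h * cs.simple s) h := by
  unfold WeakLe
  have := cs.length_mul_simple h s
  simp only [mul_inv_rev, cs.inv_simple, inv_mul_cancel_right, cs.length_simple]
  omega

theorem weakLe_step {cs : CoxeterSystem M W} {g h : W} (hgh : WeakLe cs g h) (hne : g ≠ h) :
    ∃ s, cs.length (h * cs.simple s) < cs.length h ∧ WeakLe cs g (h * cs.simple s) := by
  unfold WeakLe at *
  obtain ⟨ω, hr, hω⟩ := cs.exists_isReduced (g⁻¹ * h)⁻¹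
  cases ω with
  | nil =>
    exfalso; apply hne
    simpa [inv_mul_eq_one, mul_inv_eq_one, eq_comm] using hω
  | cons q ω =>
    have h5 := reduced_cons_lt hr
    have h6 : cs.wordProd ω = (g⁻¹ * (h * cs.simple q))⁻¹ := by
      rw [cs.wordProd_cons] at hω
      rw [← mul_assoc, mul_inv_rev, hω, cs.inv_simple, aux_smul]
    rw [← cs.wordProd_cons, ← hω, h6, cs.length_inv, cs.length_inv] at h5
    have h7 := cs.length_mul_le g (g⁻¹ * (h * cs.simple q))
    rw [mul_inv_cancel_left] at h7
    have h8 := cs.length_mul_simple h q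
    exact ⟨q, by omega, by omega⟩

theorem claim (cs : CoxeterSystem M W) (h : W) (s t : B) (hst : cs.simple s ≠ cs.simple t)
    (hs : cs.length (h * cs.simple s) < cs.length h)
    (ht : cs.length (h * cs.simple t) < cs.length h)
    (hc : ConeType cs (h * cs.simple t)⁻¹ = ConeType cs h⁻¹) :
    ∃ b, WeakLe cs b (h * cs.simple t) ∧
      ConeType cs b⁻¹ = ConeType cs (h * cs.simple s)⁻¹ := by
  set J : Set B := {s, t} with hJ
  have sJ : s ∈ J := by simp [hJ]
  have tJ : t ∈ J := by simp [hJ]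
  have hmax := jmax cs J h (by
    intro k hk
    rcases hk with rfl | hk
    · exact hs
    · rw [Set.mem_singleton_iff.1 hk]; exact ht)
  obtain ⟨d, hd, hm⟩ := exists_min (p := InJ cs J) (fun d => cs.length (h * d)) ⟨1, InJ.one⟩
  have hm' : ∀ e, InJ cs J e → cs.length e ≤ cs.length d := by
    intro e he
    have h1 : cs.length (h * d) ≤ cs.length (h * e) := hm e he
    have h2 := hmax e he
    have h3 := hmax d hd
    omega
  have dR := jmax cs J d (by
    intro k hk
    have := hm' _ (hd.mul (InJ.simple hk))
    have := cs.length_mul_simple_ne d k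
    omega)
  have dL := jmax cs J d⁻¹ (by
    intro k hk
    have h1 := hm' _ (hd.inv.mul (InJ.simple hk))
    have h2 := cs.length_mul_simple_ne d⁻¹ k
    rw [cs.length_inv] at h2 ⊢
    omega)
  set b := h * d with hb
  have hbadd : ∀ e, InJ cs J e → cs.length (b * e) = cs.length b + cs.length e := by
    intro e he
    have h1 := hmax _ (hd.mul he)
    have h2 := dR e he
    have h3 := hmax d hd
    rw [hb, mul_assoc]
    omega
  have hh : h = b * d⁻¹ := by rw [hb]; group
  have sI : InJ cs J (cs.simple s) := InJ.simple sJ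
  have tI : InJ cs J (cs.simple t) := InJ.simple tJ
  have conjJ : ∀ k ∈ J, ∃ i ∈ J, cs.simple i = d⁻¹ * cs.simple k * d := by
    intro k hk
    have kI : InJ cs J (cs.simple k) := InJ.simple hk
    have h1 := dL _ (kI.mul hd)
    have h2 := dL _ kI
    rw [← cs.length_inv (d⁻¹ * cs.simple k), mul_inv_rev, inv_inv, cs.inv_simple,
      cs.length_simple, cs.length_inv] at h2
    rw [cs.length_inv, ← mul_assoc] at h1
    obtain ⟨i, hi, he⟩ := length_one_InJ cs J _ ((hd.inv.mul kI).mul hd) (by omega)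
    exact ⟨i, hi, he.symm⟩
  obtain ⟨i, hi, ei⟩ := conjJ t tJ
  obtain ⟨j, hj, ej⟩ := conjJ s sJ
  have hij : cs.simple i ≠ cs.simple j := by
    rw [ei, ej]
    intro he
    apply hst
    exact (mul_left_cancel (mul_right_cancel he)).symm
  have hJ' : ∀ k ∈ J, cs.simple k = cs.simple i ∨ cs.simple k = cs.simple j := by
    intro k hk
    have a : ∀ k ∈ J, k = s ∨ k = t := by
      intro k hk
      simpa [hJ] using hk
    rcases a k hk with rfl | rfl <;> rcases a i hi with rfl | rfl <;>
      rcases a j hj with rfl | rfl <;> first | exact absurd rfl hij | simp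
  have wle : ∀ e, InJ cs J e → WeakLe cs b (b * e) := by
    intro e he
    unfold WeakLe
    rw [inv_mul_cancel_left, hbadd e he]
  have eS : h * cs.simple s = b * (d⁻¹ * cs.simple s) := by rw [hh, mul_assoc]
  have eT : h * cs.simple t = b * (d⁻¹ * cs.simple t) := by rw [hh, mul_assoc]
  have IS := hd.inv.mul sI
  have IT := hd.inv.mul tI
  have lS := dL _ sI
  have lT := dL _ tI
  rw [cs.length_simple, cs.length_inv] at lS lT
  refine ⟨b, eT ▸ wle _ IT, ?_⟩
  apply Set.Subset.antisymm _ (weakLe_cone (eS ▸ wle _ IS))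
  intro w hw
  by_contra hw'
  -- translation between cone types and additivity
  have key : ∀ e, InJ cs J e → ∀ u, cs.length (b * u) + cs.length b = cs.length u →
      ((b * u) ∈ ConeType cs (b * e)⁻¹ ↔ cs.length (e⁻¹ * u) = cs.length e + cs.length u) := by
    intro e he u hu
    simp only [ConeType, Set.mem_setOf_eq, cs.length_inv, hbadd e he]
    rw [show (b * e)⁻¹ * (b * u) = e⁻¹ * u by group]
    omega
  have hv : cs.length (b * (b⁻¹ * w)) + cs.length b = cs.length (b⁻¹ * w) := by
    simp only [ConeType, Set.mem_setOf_eq, cs.length_inv] at hw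
    rw [mul_inv_cancel_left]; omega
  have hw2 := key _ IS (b⁻¹ * w) hv
  rw [mul_inv_cancel_left, ← eS] at hw2
  have hw3 := fun H => hw' (hw2.2 H)
  obtain ⟨u, hu, hu1, hu2⟩ := core cs J b (b⁻¹ * w) i j hi hj hJ'
    (by intro k hk; rw [hbadd _ (InJ.simple hk), cs.length_simple]; omega) hv
    (by
      intro hJm
      apply hw3
      rw [hJm _ IS.inv, cs.length_inv])
    (by
      intro hJm
      apply hw3
      have h1 := hJm _ hd
      have h2 := hJm _ (InJ.simple hj)
      rw [aux_smul, cs.length_simple] at h2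
      rw [show d * (cs.simple j * (b⁻¹ * w)) = (d⁻¹ * cs.simple s)⁻¹ * (b⁻¹ * w) by
        rw [ej, mul_inv_rev _ (cs.simple s), cs.inv_simple]; simp only [mul_assoc, inv_inv, mul_inv_cancel_left]] at h1
      omega)
  have k1 := key _ IT u hu
  have k2 := key _ hd.inv u hu
  rw [← eT, hc] at k1
  rw [← hh] at k2
  have k3 := k1.symm.trans k2
  have m1 := hu1 _ hd
  have m2 := hu1 _ (hd.mul (InJ.simple hi))
  rw [mul_assoc, aux_smul] at m2
  have m3 := dR _ (InJ.simple hi)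
  rw [cs.length_simple] at m3
  rw [show d * (cs.simple i * u) = (d⁻¹ * cs.simple t)⁻¹ * u by
    rw [ei, mul_inv_rev _ (cs.simple t), cs.inv_simple]; simp only [mul_assoc, inv_inv, mul_inv_cancel_left]] at m1
  rw [inv_inv, cs.length_inv] at k3
  omega

/-- For all `g, h ∈ W` with `g ⪯ h`, we have `μ(g) ⪯ μ(h)`. -/
theorem mu_monotone [Finite B] (cs : CoxeterSystem M W) (mu : W → W)
    (hmu : ∀ g : W, ConeType cs (mu g)⁻¹ = ConeType cs g⁻¹ ∧
      ∀ h : W, ConeType cs h⁻¹ = ConeType cs g⁻¹ → WeakLe cs (mu g) h)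
    (g h : W) (hgh : WeakLe cs g h) :
    WeakLe cs (mu g) (mu h) := by
  have eqv : ∀ x y, ConeType cs x⁻¹ = ConeType cs y⁻¹ → WeakLe cs (mu x) (mu y) := by
    intro x y hxy
    exact (hmu x).2 _ ((hmu y).1.trans hxy.symm)
  have mle : ∀ x, WeakLe cs (mu x) x := fun x => (hmu x).2 x rfl
  induction hn : cs.length h using Nat.strong_induction_on generalizing g h with
  | _ n ih =>
    by_cases hne : g = h
    · rw [hne]; exact weakLe_refl _ _
    obtain ⟨s, hs, hgs⟩ := weakLe_step hgh hne
    refine weakLe_trans (ih _ (hn ▸ hs) g _ hgs rfl) ?_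
    by_cases hmh : mu h = h
    · rw [hmh]; exact weakLe_trans (mle _) (weakLe_simple hs)
    obtain ⟨t, ht, hmt⟩ := weakLe_step (mle h) hmh
    have hc : ConeType cs (h * cs.simple t)⁻¹ = ConeType cs h⁻¹ := by
      apply Set.Subset.antisymm
      · rw [← (hmu h).1]; exact weakLe_cone hmt
      · exact weakLe_cone (weakLe_simple ht)
    by_cases hst : cs.simple s = cs.simple t
    · rw [hst]; exact eqv _ _ hc
    obtain ⟨b, hb, hbc⟩ := claim cs h s t hst hs ht hc
    exact weakLe_trans (eqv _ _ hbc.symm)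
      (weakLe_trans (ih _ (hn ▸ ht) b _ hb rfl) (eqv _ _ hc))
end

section
/- The set Γ is a Garside shadow, i.e.: S ⊆ Γ; whenever h ∈ Γ and g ⪯ h, the element g⁻¹h belongs to Γ; and whenever g, g' ∈ Γ and the join of g and g' exists, the join belongs to Γ. -/
/-!
Let `(W,S)` be a Coxeter system, given by a Coxeter matrix `M : CoxeterMatrix B`
and `cs : CoxeterSystem M W`; the set `S` of simple reflections is the range of
`cs.simple`, and `S` is finite since `B` is finite.
-/

variable {B W : Type*} [Group W] {M : CoxeterMatrix B}

/-- `j` is the join of `g` and `g'` with respect to the weak order. -/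
def IsJoin (cs : CoxeterSystem M W) (g g' j : W) : Prop :=
  WeakLe cs g j ∧ WeakLe cs g' j ∧
    ∀ f : W, WeakLe cs g f → WeakLe cs g' f → WeakLe cs j f

namespace GS
open Classical in
/-- The involution on signed elements attached to a simple reflection. -/
noncomputable def rho (cs : CoxeterSystem M W) (i : B) : Equiv.Perm (W × ZMod 2) :=
  Function.Involutive.toPerm
    (fun p => (cs.simple i * p.1 * cs.simple i, p.2 + if p.1 = cs.simple i then 1 else 0)) (by
      rintro ⟨x, e⟩
      have h : (cs.simple i * x * cs.simple i = cs.simple i) ↔ x = cs.simple i := by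
        constructor
        · intro h
          have := congrArg (fun z => cs.simple i * z * cs.simple i) h
          simpa [mul_assoc] using this
        · rintro rfl; simp
      have h2 : (1 : ZMod 2) + 1 = 0 := by decide
      ext
      · simp [mul_assoc]
      · simp only [h]
        split_ifs
        · rw [add_assoc, h2, add_zero]
        · simp)

open Classical in
theorem rho_apply (cs : CoxeterSystem M W) (i : B) (x : W) (e : ZMod 2) :
    rho cs i (x, e) =
      (cs.simple i * x * cs.simple i, e + if x = cs.simple i then 1 else 0) := rfl

theorem sc_comm (cs : CoxeterSystem M W) (i j : B) (k : ℕ) :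
    cs.simple j * (cs.simple i * cs.simple j) ^ k =
      ((cs.simple i * cs.simple j) ^ k)⁻¹ * cs.simple j := by
  induction k with
  | zero => simp
  | succ k ih =>
    rw [pow_succ, ← mul_assoc, ih, ← pow_succ, pow_succ']
    simp [mul_assoc]

open Classical in
theorem rho_pow (cs : CoxeterSystem M W) (i j : B) (k : ℕ) (x : W) (e : ZMod 2) :
    ((rho cs i * rho cs j) ^ k) (x, e) =
      ((cs.simple i * cs.simple j) ^ k * x * ((cs.simple i * cs.simple j) ^ k)⁻¹,
        e + ∑ n ∈ Finset.range (2 * k),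
          if x = cs.simple j * (cs.simple i * cs.simple j) ^ n then 1 else 0) := by
  induction k with
  | zero => simp
  | succ k ih =>
    rw [pow_succ', Equiv.Perm.mul_apply, ih, Equiv.Perm.mul_apply, rho_apply, rho_apply]
    have e1 : 2 * (k + 1) = 2 * k + 1 + 1 := by ring
    rw [e1, Finset.sum_range_succ, Finset.sum_range_succ]
    set c := cs.simple i * cs.simple j with hc
    have h1 : (c ^ k * x * (c ^ k)⁻¹ = cs.simple j) ↔ x = cs.simple j * c ^ (2 * k) := by
      rw [two_mul, pow_add, ← mul_assoc, sc_comm, ← hc, mul_inv_eq_iff_eq_mul, mul_assoc _ (cs.simple j),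
        eq_inv_mul_iff_mul_eq]
    have h2 : (cs.simple j * (c ^ k * x * (c ^ k)⁻¹) * cs.simple j = cs.simple i) ↔
        x = cs.simple j * c ^ (2 * k + 1) := by
      have : cs.simple j * c ^ (2 * k + 1) = (c ^ k)⁻¹ * (cs.simple j * c) * c ^ k := by
        have : 2 * k + 1 = k + (k + 1) := by ring
        rw [this, pow_add, ← mul_assoc, sc_comm, ← hc, pow_succ']; simp [mul_assoc]
      rw [this]
      constructor
      · intro h
        have h' := congrArg (fun z => (c ^ k)⁻¹ * (cs.simple j * z * cs.simple j) * c ^ k) h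
        simp only [mul_assoc, cs.simple_mul_simple_cancel_left, cs.simple_mul_simple_self] at h'
        simp only [hc, mul_assoc] at h' ⊢
        simpa using h'
      · intro h
        rw [h]
        simp [hc, mul_assoc]
    simp only [h1, h2]
    ext
    · simp [pow_succ', hc, mul_assoc]
    · simp [add_assoc]

theorem rho_liftable (cs : CoxeterSystem M W) : M.IsLiftable (rho cs) := by
  classical
  intro i j
  ext1 ⟨x, e⟩
  rw [rho_pow]
  have hc : (cs.simple i * cs.simple j) ^ M i j = 1 := cs.simple_mul_simple_pow i j
  have h2 : ∀ a : ZMod 2, a + a = 0 := by decide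
  rw [two_mul, Finset.sum_range_add]
  simp only [pow_add, hc, one_mul, h2]
  simp

/-- The signed permutation representation. -/
noncomputable def Rho (cs : CoxeterSystem M W) : W →* Equiv.Perm (W × ZMod 2) :=
  cs.lift ⟨rho cs, rho_liftable cs⟩

theorem Rho_simple (cs : CoxeterSystem M W) (i : B) : Rho cs (cs.simple i) = rho cs i :=
  cs.lift_apply_simple (rho_liftable cs) i

open Classical in
theorem Rho_word (cs : CoxeterSystem M W) (ω : List B) (x : W) (e : ZMod 2) :
    Rho cs (cs.wordProd ω) (x, e) = (cs.wordProd ω * x * (cs.wordProd ω)⁻¹,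
      e + ((cs.rightInvSeq ω).count x : ZMod 2)) := by
  induction ω with
  | nil => simp
  | cons i ω ih =>
    rw [cs.wordProd_cons, map_mul, Equiv.Perm.mul_apply, ih, Rho_simple, rho_apply]
    have h : (cs.wordProd ω * x * (cs.wordProd ω)⁻¹ = cs.simple i) ↔
        ((cs.wordProd ω)⁻¹ * cs.simple i * cs.wordProd ω = x) := by
      constructor
      · intro h; rw [← h]; group
      · intro h; rw [← h]; group
    simp only [h, CoxeterSystem.rightInvSeq, List.count_cons, beq_iff_eq]
    ext
    · simp [mul_assoc]
    · push_cast
      simp [add_assoc]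

theorem Rho_fst (cs : CoxeterSystem M W) (w x : W) (e : ZMod 2) :
    (Rho cs w (x, e)).1 = w * x * w⁻¹ := by
  obtain ⟨ω, -, rfl⟩ := cs.exists_isReduced w
  rw [Rho_word]

theorem Rho_snd (cs : CoxeterSystem M W) (w x : W) (e : ZMod 2) :
    (Rho cs w (x, e)).2 = e + (Rho cs w (x, 0)).2 := by
  obtain ⟨ω, -, rfl⟩ := cs.exists_isReduced w
  rw [Rho_word, Rho_word]; simp

theorem Rho_refl (cs : CoxeterSystem M W) (t : W) (ht : cs.IsReflection t) :
    (Rho cs t (t, 0)).2 = 1 := by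
  obtain ⟨w, i, rfl⟩ := ht
  set t := w * cs.simple i * w⁻¹
  have h1 : Rho cs w⁻¹ (t, 0) = (cs.simple i, (Rho cs w⁻¹ (t, 0)).2) := by
    ext
    · rw [Rho_fst]; simp [t, mul_assoc]
    · rfl
  have h3 : Rho cs w (cs.simple i, (Rho cs w⁻¹ (t, 0)).2) = (t, 0) := by
    rw [← h1, ← Equiv.Perm.mul_apply, ← map_mul]; simp
  have h4 : Rho cs t (t, 0) = Rho cs w (Rho cs (cs.simple i) (Rho cs w⁻¹ (t, 0))) := by
    rw [← Equiv.Perm.mul_apply, ← Equiv.Perm.mul_apply, ← map_mul, ← map_mul]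
  rw [h4, h1, Rho_simple, rho_apply]
  have h5 : cs.simple i * cs.simple i * cs.simple i = cs.simple i := by simp
  rw [h5, Rho_snd]
  have h6 := congrArg Prod.snd h3
  rw [Rho_snd] at h6
  simp only at h6
  simp only [if_true]
  rw [add_right_comm, h6, zero_add]

theorem mem_ris (cs : CoxeterSystem M W) (ω : List B) (t : W) (ht : cs.IsReflection t)
    (h : cs.length (cs.wordProd ω * t) < cs.length (cs.wordProd ω)) :
    t ∈ cs.rightInvSeq ω := by
  classical
  by_contra hn
  obtain ⟨ω', hω', he⟩ := cs.exists_isReduced (cs.wordProd ω * t)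
  have h1 : (Rho cs (cs.wordProd ω * t) (t, 0)).2 = 1 := by
    rw [map_mul, Equiv.Perm.mul_apply]
    have : Rho cs t (t, 0) = (t, 1) := by
      ext
      · rw [Rho_fst]; simp
      · exact Rho_refl cs t ht
    rw [this, Rho_word, List.count_eq_zero_of_not_mem hn]; simp
  rw [he, Rho_word] at h1
  have h2 : t ∈ cs.rightInvSeq ω' := by
    by_contra h3
    rw [List.count_eq_zero_of_not_mem h3] at h1
    simp at h1
  have h4 := (cs.isRightInversion_of_mem_rightInvSeq hω' h2).2
  rw [← he, mul_assoc, ht.mul_self, mul_one] at h4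
  omega

theorem exchange (cs : CoxeterSystem M W) (ω : List B) (t : W) (ht : cs.IsReflection t)
    (h : cs.length (t * cs.wordProd ω) < cs.length (cs.wordProd ω)) :
    ∃ k < ω.length, t * cs.wordProd ω = cs.wordProd (ω.eraseIdx k) := by
  have h1 : t ∈ cs.rightInvSeq ω.reverse := by
    apply mem_ris cs _ t ht
    rw [cs.wordProd_reverse, cs.length_inv, ← cs.length_inv]
    simpa [ht.inv] using h
  rw [cs.rightInvSeq_reverse, List.mem_reverse] at h1
  obtain ⟨k, hk, rfl⟩ := List.mem_iff_getElem.1 h1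
  refine ⟨k, by simpa using hk, ?_⟩
  rw [← cs.getD_leftInvSeq_mul_wordProd, List.getD_eq_getElem _ _ hk]

theorem lift_step (cs : CoxeterSystem M W) (u t : W) (k : B) (ht : cs.IsReflection t)
    (h1 : cs.length (t * u) + 1 = cs.length u)
    (h2 : cs.length (cs.simple k * u) + 1 = cs.length u) (hne : t ≠ cs.simple k) :
    cs.length (cs.simple k * (t * u)) + 1 = cs.length (t * u) := by
  obtain ⟨ω, hω, he⟩ := cs.exists_isReduced (cs.simple k * u)
  have hu : u = cs.wordProd (k :: ω) := by rw [cs.wordProd_cons, ← he]; simp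
  have hlen : ω.length = cs.length (cs.simple k * u) := by rw [he, hω.eq]
  obtain ⟨n, hn, hk⟩ := exchange cs (k :: ω) t ht (by rw [← hu]; omega)
  rw [← hu] at hk
  cases n with
  | zero =>
    exfalso; apply hne
    simp only [List.eraseIdx_cons_zero] at hk
    rw [← he] at hk
    exact mul_right_cancel hk
  | succ n =>
    simp only [List.length_cons] at hn
    rw [List.eraseIdx_cons_succ, cs.wordProd_cons] at hk
    have h3 : cs.simple k * (t * u) = cs.wordProd (ω.eraseIdx n) := by rw [hk]; simp
    have h4 := cs.length_wordProd_le (ω.eraseIdx n)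
    rw [← h3] at h4
    have h5 := List.length_eraseIdx_add_one (l := ω) (i := n) (by omega)
    rcases cs.length_simple_mul (t * u) k with h | h <;> omega

theorem le_trans' (cs : CoxeterSystem M W) {a b c : W} (h1 : WeakLe cs a b)
    (h2 : WeakLe cs b c) : WeakLe cs a c := by
  unfold WeakLe at *
  have h3 := cs.length_mul_le (a⁻¹ * b) (b⁻¹ * c)
  have h4 := cs.length_mul_le a (a⁻¹ * c)
  have e1 : a⁻¹ * b * (b⁻¹ * c) = a⁻¹ * c := by group
  have e2 : a * (a⁻¹ * c) = c := by group
  rw [e1] at h3; rw [e2] at h4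
  omega

theorem le_antisymm' (cs : CoxeterSystem M W) {a b : W} (h1 : WeakLe cs a b)
    (h2 : WeakLe cs b a) : a = b := by
  unfold WeakLe at *
  have h3 : cs.length (a⁻¹ * b) = 0 := by omega
  rw [cs.length_eq_zero_iff] at h3
  exact (inv_mul_eq_one.1 h3)

theorem le_refl' (cs : CoxeterSystem M W) (a : W) : WeakLe cs a a := by
  simp [WeakLe]

theorem simple_le (cs : CoxeterSystem M W) (i : B) (f : W) :
    WeakLe cs (cs.simple i) f ↔ cs.length (cs.simple i * f) + 1 = cs.length f := by
  simp [WeakLe, add_comm]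

/-- Lemma A. -/
theorem lemA (cs : CoxeterSystem M W) (i : B) (f : W)
    (hf : cs.length (cs.simple i * f) + 1 = cs.length f) :
    ∀ n (a : W), cs.length a = n → WeakLe cs a f →
      cs.length (cs.simple i * a) = cs.length a + 1 → WeakLe cs a (cs.simple i * f) := by
  intro n
  induction n with
  | zero =>
    intro a ha _ _
    rw [cs.length_eq_zero_iff] at ha
    subst ha; simp [WeakLe]
  | succ n ih =>
    intro a ha haf hia
    have hne : a ≠ 1 := by rintro rfl; simp at ha
    obtain ⟨k, hk⟩ := cs.exists_rightDescent_of_ne_one hne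
    rw [cs.isRightDescent_iff] at hk
    obtain ⟨a', rfl⟩ : ∃ a', a = a' * cs.simple k := ⟨a * cs.simple k, by simp⟩
    rw [cs.simple_mul_simple_cancel_right] at hk
    have haa : WeakLe cs a' (a' * cs.simple k) := by simp [WeakLe]; omega
    have ha'f := le_trans' cs haa haf
    have h1 : cs.length (cs.simple i * a') = cs.length a' + 1 := by
      rcases cs.length_simple_mul a' i with h | h
      · exact h
      · have := cs.length_mul_le (cs.simple i * a') (cs.simple k)
        rw [cs.length_simple, mul_assoc] at this
        omega
    have h2 := ih a' (by omega) ha'f h1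
    have e1 : a'⁻¹ * cs.simple i * a' * (a'⁻¹ * f) = a'⁻¹ * (cs.simple i * f) := by group
    have e2 : cs.simple k * (a'⁻¹ * f) = (a' * cs.simple k)⁻¹ * f := by simp [mul_assoc]
    have e3 : cs.simple k * (a'⁻¹ * (cs.simple i * f)) =
        (a' * cs.simple k)⁻¹ * (cs.simple i * f) := by simp [mul_assoc]
    unfold WeakLe at *
    have h3 := lift_step cs (a'⁻¹ * f) (a'⁻¹ * cs.simple i * a') k
      ⟨a'⁻¹, i, by simp⟩ (by rw [e1]; omega) (by rw [e2]; omega) (by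
        intro h
        have : cs.simple i * a' = a' * cs.simple k := by rw [← h]; group
        rw [← this] at hia
        simp at hia
        rw [this] at hia; omega)
    rw [e1, e3] at h3
    omega

/-- Minimal upper bounds stay in cone types. -/
theorem lemB (cs : CoxeterSystem M W) : ∀ n (c a b f : W), cs.length c = n →
    WeakLe cs a f → WeakLe cs b f →
    (∀ f', WeakLe cs a f' → WeakLe cs b f' → cs.length f ≤ cs.length f') →
    cs.length (c * a) = cs.length c + cs.length a →
    cs.length (c * b) = cs.length c + cs.length b →
    cs.length (c * f) = cs.length c + cs.length f := by
  intro n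
  induction n with
  | zero =>
    intro c a b f hc _ _ _ _ _
    rw [cs.length_eq_zero_iff] at hc; subst hc; simp
  | succ n ih =>
    intro c a b f hc haf hbf hmin ha hb
    have hne : c ≠ 1 := by rintro rfl; simp at hc
    obtain ⟨k, hk⟩ := cs.exists_rightDescent_of_ne_one hne
    rw [cs.isRightDescent_iff] at hk
    obtain ⟨c', rfl⟩ : ∃ a', c = a' * cs.simple k := ⟨c * cs.simple k, by simp⟩
    rw [cs.simple_mul_simple_cancel_right] at hk
    rw [mul_assoc] at ha hb ⊢
    have key : ∀ a, cs.length (c' * (cs.simple k * a)) =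
        cs.length (c' * cs.simple k) + cs.length a →
        cs.length (cs.simple k * a) = cs.length a + 1 := by
      intro a ha
      have := cs.length_mul_le c' (cs.simple k * a)
      rcases cs.length_simple_mul a k with h | h <;> omega
    have ka := key a ha
    have kb := key b hb
    have kf : cs.length (cs.simple k * f) = cs.length f + 1 := by
      rcases cs.length_simple_mul f k with h | h
      · exact h
      · have := hmin _ (lemA cs k f h _ a rfl haf ka) (lemA cs k f h _ b rfl hbf kb)
        omega
    have up : ∀ a, WeakLe cs a f → cs.length (cs.simple k * a) = cs.length a + 1 →
        WeakLe cs (cs.simple k * a) (cs.simple k * f) := by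
      intro a h1 h2
      have e : (cs.simple k * a)⁻¹ * (cs.simple k * f) = a⁻¹ * f := by simp [mul_assoc]
      unfold WeakLe at *
      rw [e]; omega
    have down : ∀ a f', cs.length (cs.simple k * a) = cs.length a + 1 →
        WeakLe cs (cs.simple k * a) f' → WeakLe cs a (cs.simple k * f') ∧
          cs.length (cs.simple k * f') + 1 = cs.length f' := by
      intro a f' h1 h2
      have e : (cs.simple k * a)⁻¹ * f' = a⁻¹ * (cs.simple k * f') := by simp [mul_assoc]
      unfold WeakLe at *
      rw [e] at h2
      have := cs.length_mul_le a (a⁻¹ * (cs.simple k * f'))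
      rw [mul_inv_cancel_left] at this
      rcases cs.length_simple_mul f' k with h | h <;> constructor <;> omega
    have := ih c' (cs.simple k * a) (cs.simple k * b) (cs.simple k * f) (by omega)
      (up a haf ka) (up b hbf kb) (by
        intro f' h1 h2
        obtain ⟨h3, h4⟩ := down a f' ka h1
        obtain ⟨h5, _⟩ := down b f' kb h2
        have := hmin _ h3 h5
        omega) (by omega) (by omega)
    omega

/-- The standard parabolic subgroup. -/
def InD (cs : CoxeterSystem M W) (I : Set B) (v : W) : Prop :=
  ∃ ω : List B, (∀ i ∈ ω, i ∈ I) ∧ cs.wordProd ω = v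

theorem InD.mul (cs : CoxeterSystem M W) {I : Set B} {v v' : W} (h : InD cs I v)
    (h' : InD cs I v') : InD cs I (v * v') := by
  obtain ⟨ω, h1, rfl⟩ := h
  obtain ⟨ω', h2, rfl⟩ := h'
  refine ⟨ω ++ ω', ?_, cs.wordProd_append _ _⟩
  intro i hi
  rcases List.mem_append.1 hi with h | h
  exacts [h1 i h, h2 i h]

theorem InD.inv (cs : CoxeterSystem M W) {I : Set B} {v : W} (h : InD cs I v) :
    InD cs I v⁻¹ := by
  obtain ⟨ω, h1, rfl⟩ := h
  exact ⟨ω.reverse, by simpa using h1, cs.wordProd_reverse _⟩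

theorem InD.simple (cs : CoxeterSystem M W) {I : Set B} {i : B} (h : i ∈ I) :
    InD cs I (cs.simple i) := ⟨[i], by simpa using h, by simp⟩

theorem InD.one (cs : CoxeterSystem M W) {I : Set B} :
    InD cs I 1 := ⟨[], by simp, by simp⟩

theorem InD.reduced (cs : CoxeterSystem M W) {I : Set B} {v : W} (h : InD cs I v) :
    ∃ ω : List B, (∀ i ∈ ω, i ∈ I) ∧ cs.wordProd ω = v ∧ cs.IsReduced ω := by
  obtain ⟨ω, h1, rfl⟩ := h
  induction ω with
  | nil => exact ⟨[], by simp, rfl, by simp [CoxeterSystem.IsReduced]⟩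
  | cons i ω ih =>
    obtain ⟨ω', h2, h3, h4⟩ := ih (fun k hk => h1 k (List.mem_cons_of_mem _ hk))
    have hi := h1 i List.mem_cons_self
    rcases cs.length_simple_mul (cs.wordProd ω') i with h | h
    · refine ⟨i :: ω', ?_, ?_, ?_⟩
      · intro k hk
        rcases List.mem_cons.1 hk with rfl | hk
        exacts [hi, h2 k hk]
      · rw [cs.wordProd_cons, cs.wordProd_cons, h3]
      · unfold CoxeterSystem.IsReduced
        rw [cs.wordProd_cons, h, h4.eq]; simp
    · obtain ⟨n, hn, hk⟩ := exchange cs ω' _ (cs.isReflection_simple i) (by omega)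
      refine ⟨ω'.eraseIdx n, fun k hk => h2 k (List.mem_of_mem_eraseIdx hk), ?_, ?_⟩
      · rw [← hk, h3, cs.wordProd_cons]
      · unfold CoxeterSystem.IsReduced
        have := List.length_eraseIdx_add_one hn
        rw [← hk]
        have := h4.eq
        omega

theorem InD.ind (cs : CoxeterSystem M W) {I : Set B} {P : W → Prop} (h1 : P 1)
    (hs : ∀ i ∈ I, ∀ v, InD cs I v → cs.length (cs.simple i * v) = cs.length v + 1 → P v →
      P (cs.simple i * v)) {v : W} (h : InD cs I v) : P v := by
  obtain ⟨ω, h2, rfl, h3⟩ := h.reduced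
  induction ω with
  | nil => simpa using h1
  | cons i ω ih =>
    have h4 : cs.IsReduced ω := by simpa using h3.drop 1
    have h5 : ∀ i ∈ ω, i ∈ I := fun k hk => h2 k (List.mem_cons_of_mem _ hk)
    have h6 := h3.eq
    rw [cs.wordProd_cons] at h6 ⊢
    exact hs i (h2 i List.mem_cons_self) _ ⟨ω, h5, rfl⟩ (by rw [h6, h4.eq]; simp)
      (ih h5 h4 ⟨ω, h5, rfl⟩)

/-- `e` with all left descents is the largest element. -/
theorem longest (cs : CoxeterSystem M W) {I : Set B} {e v : W}
    (he : ∀ i ∈ I, cs.length (cs.simple i * e) + 1 = cs.length e) (h : InD cs I v) :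
    WeakLe cs v e := by
  refine InD.ind cs (P := fun v => WeakLe cs v e) (by simp [WeakLe]) ?_ h
  intro i hi v _ h1 h2
  have h3 := lemA cs i e (he i hi) _ v rfl h2 h1
  have e1 : (cs.simple i * v)⁻¹ * e = v⁻¹ * (cs.simple i * e) := by simp [mul_assoc]
  have := he i hi
  unfold WeakLe at *
  rw [e1]; omega

theorem longest_conj (cs : CoxeterSystem M W) {I : Set B} {e : W} (hD : InD cs I e)
    (he : ∀ i ∈ I, cs.length (cs.simple i * e) + 1 = cs.length e) (i : B) (hi : i ∈ I) :
    ∃ k ∈ I, cs.simple i * e = e * cs.simple k := by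
  have h0 := longest cs he hD.inv
  have hee : e * e = 1 := by
    unfold WeakLe at h0
    rw [cs.length_inv, inv_inv] at h0
    rw [← cs.length_eq_zero_iff]; omega
  have hinv : e⁻¹ = e := inv_eq_of_mul_eq_one_left hee
  have hD2 : InD cs I (cs.simple i * e) := (InD.simple cs hi).mul cs hD
  have h1 := longest cs he hD2
  have h2 := he i hi
  have h3 : cs.length (e * cs.simple i * e) = 1 := by
    unfold WeakLe at h1
    simp only [mul_inv_rev, hinv, cs.inv_simple] at h1
    omega
  have hD3 : InD cs I (e * cs.simple i * e) := by rw [mul_assoc]; exact hD.mul cs hD2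
  obtain ⟨ω, h4, h5, h6⟩ := hD3.reduced
  have h7 := h6.eq
  rw [h5, h3] at h7
  obtain ⟨k, rfl⟩ := List.length_eq_one_iff.1 h7.symm
  refine ⟨k, h4 k (by simp), ?_⟩
  rw [cs.wordProd_singleton] at h5
  rw [h5, ← mul_assoc, ← mul_assoc, hee, one_mul]

theorem min_add (cs : CoxeterSystem M W) {I : Set B} {y0 v : W}
    (hmin : ∀ v, InD cs I v → cs.length y0 ≤ cs.length (v * y0)) (h : InD cs I v) :
    cs.length (v * y0) = cs.length v + cs.length y0 := by
  refine InD.ind cs (P := fun v => cs.length (v * y0) = cs.length v + cs.length y0)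
    (by simp) ?_ h
  intro i hi v hv h1 h2
  rw [mul_assoc]
  rcases cs.length_simple_mul (v * y0) i with h | h
  · omega
  · exfalso
    have h3 := lemA cs i (v * y0) h _ v rfl (by simp [WeakLe, h2]) h1
    have h4 := hmin (v⁻¹ * (cs.simple i * v)) (hv.inv.mul cs ((InD.simple cs hi).mul cs hv))
    have e1 : v⁻¹ * (cs.simple i * v) * y0 = v⁻¹ * (cs.simple i * (v * y0)) := by group
    unfold WeakLe at h3
    rw [e1] at h4
    omega

theorem exists_min (cs : CoxeterSystem M W) (I : Set B) (y : W) :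
    ∃ v y0, InD cs I v ∧ y = v * y0 ∧
      ∀ v, InD cs I v → cs.length (v * y0) = cs.length v + cs.length y0 := by
  have hex : ∃ n, ∃ v, InD cs I v ∧ cs.length (v * y) = n := ⟨_, 1, InD.one cs, rfl⟩
  classical
  obtain ⟨v, hv, hn⟩ := Nat.find_spec hex
  refine ⟨v⁻¹, v * y, hv.inv, by simp, fun v' hv' => min_add cs ?_ hv'⟩
  intro u hu
  rw [hn, ← mul_assoc]
  exact Nat.find_min' hex ⟨_, hu.mul cs hv, rfl⟩

theorem nodesc_add (cs : CoxeterSystem M W) {I : Set B} {y v : W}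
    (hy : ∀ i ∈ I, cs.length (cs.simple i * y) = cs.length y + 1) (h : InD cs I v) :
    cs.length (v * y) = cs.length v + cs.length y := by
  obtain ⟨u, y0, hu, rfl, h0⟩ := exists_min cs I y
  obtain ⟨ω, h1, rfl, h2⟩ := hu.reduced
  cases ω with
  | nil => simpa using h0 v h
  | cons i ω =>
    exfalso
    have h3 := hy i (h1 i List.mem_cons_self)
    have h4 := h0 _ hu
    have h5 := h0 (cs.wordProd ω) ⟨ω, fun k hk => h1 k (List.mem_cons_of_mem _ hk), rfl⟩
    have h6 := h2.eq
    have h7 := cs.length_wordProd_le ω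
    rw [cs.wordProd_cons] at h3 h4 h6
    rw [mul_assoc, cs.simple_mul_simple_cancel_left] at h3
    rw [mul_assoc] at h4
    simp only [List.length_cons] at h6
    omega

/-- The local step. -/
theorem local_step (cs : CoxeterSystem M W) (j : W) (s r : B)
    (hs : cs.length (j * cs.simple s) + 1 = cs.length j)
    (hr : cs.length (j * cs.simple r) + 1 = cs.length j)
    (hT : ConeType cs (j * cs.simple s)⁻¹ = ConeType cs j⁻¹) :
    ∃ w, WeakLe cs w (j * cs.simple s) ∧ ConeType cs w⁻¹ = ConeType cs (j * cs.simple r)⁻¹ := by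
  obtain ⟨e, w', he, hj, hw⟩ := exists_min cs {s, r} j⁻¹
  have hs' : s ∈ ({s, r} : Set B) := by simp
  have hr' : r ∈ ({s, r} : Set B) := by simp
  have hj2 : j = w'⁻¹ * e⁻¹ := by rw [← mul_inv_rev, ← hj, inv_inv]
  have hlj : ∀ i, cs.length (j * cs.simple i) = cs.length (cs.simple i * e * w') := by
    intro i
    rw [← cs.length_inv, mul_inv_rev, hj, cs.inv_simple, mul_assoc]
  have hlj0 : cs.length j = cs.length e + cs.length w' := by
    rw [← cs.length_inv, hj, hw e he]
  have hse := hw _ ((InD.simple cs hs').mul cs he)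
  have hre := hw _ ((InD.simple cs hr').mul cs he)
  have hedesc : ∀ i ∈ ({s, r} : Set B), cs.length (cs.simple i * e) + 1 = cs.length e := by
    rintro i (rfl | rfl)
    · rw [hlj, hse] at hs; omega
    · rw [hlj, hre] at hr; omega
  have hes := hedesc s hs'
  have her := hedesc r hr'
  obtain ⟨a, ha, hea⟩ := longest_conj cs he hedesc s hs'
  obtain ⟨b, hb, heb⟩ := longest_conj cs he hedesc r hr'
  -- membership in cone types, in terms of y
  have mem : ∀ u, InD cs {s, r} u → ∀ x, x ∈ ConeType cs (u * w') ↔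
      (WeakLe cs w' (w' * x) ∧ cs.length (u * (w' * x)) = cs.length u + cs.length (w' * x)) := by
    intro u hu x
    have h1 := hw u hu
    have h2 := cs.length_mul_le u (w' * x)
    have h3 := cs.length_mul_le w' x
    simp only [ConeType, Set.mem_ofPred_eq, WeakLe, inv_mul_cancel_left, mul_assoc]
    constructor
    · intro h; constructor <;> omega
    · rintro ⟨h, h'⟩; omega
  have ejs : (j * cs.simple s)⁻¹ = cs.simple s * e * w' := by
    rw [mul_inv_rev, hj, cs.inv_simple, mul_assoc]
  have ejr : (j * cs.simple r)⁻¹ = cs.simple r * e * w' := by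
    rw [mul_inv_rev, hj, cs.inv_simple, mul_assoc]
  rw [ejs, hj] at hT
  have Dse := (InD.simple cs hs').mul cs he
  have Dre := (InD.simple cs hr').mul cs he
  -- no common upper bound of w' and a
  have claim : ∀ y, WeakLe cs w' y → ¬ WeakLe cs (cs.simple a) y := by
    intro y1 hy1 hy2
    have hex : ∃ n, ∃ y, WeakLe cs w' y ∧ WeakLe cs (cs.simple a) y ∧ cs.length y = n :=
      ⟨_, y1, hy1, hy2, rfl⟩
    classical
    obtain ⟨y, h1, h2, h3⟩ := Nat.find_spec hex
    have h4 := lemB cs _ (cs.simple s * e) w' (cs.simple a) y rfl h1 h2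
      (fun f' h5 h6 => by rw [h3]; exact Nat.find_min' hex ⟨f', h5, h6, rfl⟩) hse
      (by rw [hea, cs.simple_mul_simple_cancel_right, ← hea, cs.length_simple]; omega)
    have h5 : w'⁻¹ * y ∈ ConeType cs (e * w') := by
      rw [← hT, mem _ Dse]
      rw [mul_inv_cancel_left]
      exact ⟨h1, h4⟩
    rw [mem _ he, mul_inv_cancel_left] at h5
    have h6 := (simple_le cs a y).1 h2
    have h7 := cs.length_mul_le (cs.simple s * e) (cs.simple a * y)
    have e1 : cs.simple s * e * (cs.simple a * y) = e * y := by rw [hea]; simp [mul_assoc]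
    rw [e1] at h7
    omega
  refine ⟨w'⁻¹, ?_, ?_⟩
  · unfold WeakLe
    rw [← cs.length_inv (j * cs.simple s), ejs, hse, cs.length_inv, ← cs.length_inv (w'⁻¹⁻¹ * _),
      mul_inv_rev, ejs]
    simp only [inv_inv, mul_inv_cancel_right]
    omega
  · rw [inv_inv, ejr]
    ext x
    rw [mem _ Dre, ← one_mul w', mem _ (InD.one cs)]
    simp only [one_mul, cs.length_one, zero_add, and_true]
    refine ⟨fun h => ⟨h, ?_⟩, fun h => h.1⟩
    generalize w' * x = y at h ⊢
    have hI : ∀ i ∈ ({s, r} : Set B), cs.simple i = cs.simple a ∨ cs.simple i = cs.simple b := by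
      have hsr : cs.simple a = cs.simple b → cs.simple s = cs.simple r := by
        intro h
        rw [h, ← heb] at hea
        exact mul_right_cancel hea
      rintro i (rfl | rfl) <;> rcases ha with rfl | rfl <;> rcases hb with rfl | rfl <;>
        first | exact Or.inl rfl | exact Or.inr rfl | exact Or.inl (hsr rfl) | exact Or.inl (hsr rfl).symm
    have hasc : ∀ i ∈ ({s, r} : Set B), cs.length (cs.simple i * w') = cs.length w' + 1 := by
      intro i hi
      rw [hw _ (InD.simple cs hi), cs.length_simple, add_comm]
    have na : ∀ y, WeakLe cs w' y → cs.length (cs.simple a * y) = cs.length y + 1 := by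
      intro y hy
      rcases cs.length_simple_mul y a with h' | h'
      · exact h'
      · exact absurd ((simple_le cs a y).2 h') (claim y hy)
    rcases cs.length_simple_mul y b with h' | h'
    · refine nodesc_add cs (I := {s, r}) ?_ Dre
      intro i hi
      rcases hI i hi with h0 | h0 <;> rw [h0]
      · exact na y h
      · exact h'
    · have h2 := lemA cs b y h' _ w' rfl h (hasc b hb)
      have h3 : ∀ i ∈ ({s, r} : Set B), cs.length (cs.simple i * (cs.simple b * y)) =
          cs.length (cs.simple b * y) + 1 := by
        intro i hi
        rcases hI i hi with h0 | h0 <;> rw [h0]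
        · exact na _ h2
        · rw [cs.simple_mul_simple_cancel_left, h']
      have h4 := nodesc_add cs h3 he
      have e1 : cs.simple r * e * y = e * (cs.simple b * y) := by rw [heb, mul_assoc]
      rw [e1]
      omega

theorem cone_anti (cs : CoxeterSystem M W) {a b : W} (h : WeakLe cs a b) :
    ConeType cs b⁻¹ ⊆ ConeType cs a⁻¹ := by
  intro x hx
  simp only [ConeType, Set.mem_ofPred_eq, cs.length_inv] at *
  unfold WeakLe at h
  have h1 := cs.length_mul_le (a⁻¹ * b)⁻¹ (a⁻¹ * x)
  have h2 := cs.length_mul_le a⁻¹ x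
  rw [cs.length_inv] at h1 h2
  have e : (a⁻¹ * b)⁻¹ * (a⁻¹ * x) = b⁻¹ * x := by group
  rw [e] at h1
  omega

theorem exists_cover (cs : CoxeterSystem M W) {a b : W} (h : WeakLe cs a b) (hne : a ≠ b) :
    ∃ i, cs.length (b * cs.simple i) + 1 = cs.length b ∧ WeakLe cs a (b * cs.simple i) := by
  have h1 : a⁻¹ * b ≠ 1 := fun h => hne (inv_mul_eq_one.1 h)
  obtain ⟨k, hk⟩ := cs.exists_rightDescent_of_ne_one h1
  rw [cs.isRightDescent_iff] at hk
  have h2 := cs.length_mul_le a (a⁻¹ * b * cs.simple k)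
  have e : a * (a⁻¹ * b * cs.simple k) = b * cs.simple k := by group
  have e2 : a⁻¹ * (b * cs.simple k) = a⁻¹ * b * cs.simple k := by group
  rw [e] at h2
  unfold WeakLe at *
  refine ⟨k, ?_, ?_⟩ <;> try rw [e2]
  all_goals rcases cs.length_mul_simple b k with h' | h' <;> omega

theorem mono (cs : CoxeterSystem M W) (mu : W → W)
    (hmu : ∀ g : W, ConeType cs (mu g)⁻¹ = ConeType cs g⁻¹ ∧
      ∀ h : W, ConeType cs h⁻¹ = ConeType cs g⁻¹ → WeakLe cs (mu g) h)
    (g : W) (hg : mu g = g) : ∀ n (j : W), cs.length j = n → WeakLe cs g j →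
      WeakLe cs g (mu j) := by
  have heq : ∀ a b, ConeType cs a⁻¹ = ConeType cs b⁻¹ → mu a = mu b := by
    intro a b h
    apply le_antisymm' cs
    · exact (hmu a).2 _ ((hmu b).1.trans h.symm)
    · exact (hmu b).2 _ ((hmu a).1.trans h)
  intro n
  induction n using Nat.strong_induction_on with
  | _ n ih =>
  intro j hn hj
  by_cases hgj : g = j
  · subst hgj; rw [hg]; exact le_refl' cs g
  by_cases hmj : mu j = j
  · rwa [hmj]
  obtain ⟨r, hr, hgr⟩ := exists_cover cs hj hgj
  obtain ⟨s, hs, hms⟩ := exists_cover cs ((hmu j).2 j rfl) hmj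
  have hle : WeakLe cs (j * cs.simple s) j := by
    simp [WeakLe, hs]
  have hT : ConeType cs (j * cs.simple s)⁻¹ = ConeType cs j⁻¹ := by
    apply subset_antisymm
    · rw [← (hmu j).1]; exact cone_anti cs hms
    · exact cone_anti cs hle
  obtain ⟨w, hw, hwT⟩ := local_step cs j s r hs hr hT
  have h1 := ih _ (by omega) (j * cs.simple r) rfl hgr
  have h2 : WeakLe cs (mu (j * cs.simple r)) w := (hmu _).2 w hwT
  have h3 := ih _ (by omega) (j * cs.simple s) rfl (le_trans' cs (le_trans' cs h1 h2) hw)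
  rwa [heq _ _ hT] at h3

end GS

/-- `Γ = {μ(g) : g ∈ W}` is a Garside shadow: it contains `S`, contains `g⁻¹h`
whenever `h ∈ Γ` and `g ⪯ h`, and contains every existing join of its elements. -/
theorem Gamma_isGarsideShadow [Finite B] (cs : CoxeterSystem M W) (mu : W → W)
    (hmu : ∀ g : W, ConeType cs (mu g)⁻¹ = ConeType cs g⁻¹ ∧
      ∀ h : W, ConeType cs h⁻¹ = ConeType cs g⁻¹ → WeakLe cs (mu g) h) :
    (∀ i : B, cs.simple i ∈ Set.range mu) ∧
    (∀ h ∈ Set.range mu, ∀ g : W, WeakLe cs g h → g⁻¹ * h ∈ Set.range mu) ∧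
    (∀ g ∈ Set.range mu, ∀ g' ∈ Set.range mu, ∀ j : W,
      IsJoin cs g g' j → j ∈ Set.range mu) := by
  have hfix : ∀ g, mu (mu g) = mu g := by
    intro g
    apply GS.le_antisymm' cs
    · exact (hmu (mu g)).2 _ rfl
    · exact (hmu g).2 _ ((hmu (mu g)).1.trans (hmu g).1)
  have hfix2 : ∀ h ∈ Set.range mu, mu h = h := by
    rintro _ ⟨g, rfl⟩; exact hfix g
  refine ⟨?_, ?_, ?_⟩
  · intro i
    refine ⟨cs.simple i, ?_⟩
    by_contra hne
    have h1 := (hmu (cs.simple i)).2 _ rfl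
    have h2 := (hmu (cs.simple i)).1
    have h3 : mu (cs.simple i) = 1 := by
      unfold WeakLe at h1
      rw [cs.length_simple] at h1
      have : cs.length ((mu (cs.simple i))⁻¹ * cs.simple i) ≠ 0 := by
        rw [Ne, cs.length_eq_zero_iff, inv_mul_eq_one]; exact hne
      rw [← cs.length_eq_zero_iff]; omega
    rw [h3] at h2
    have h4 : cs.simple i ∈ ConeType cs (1 : W)⁻¹ := by simp [ConeType]
    rw [h2] at h4
    simp [ConeType] at h4
  · intro h hh g hgh
    refine ⟨g⁻¹ * h, ?_⟩
    have hm := hfix2 h hh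
    generalize hk : g⁻¹ * h = k at *
    obtain rfl : h = g * k := by rw [← hk]; group
    have h1 := (hmu k).2 _ rfl
    have h2 := (hmu k).1
    generalize mu k = k' at *
    have mem : ∀ k, cs.length g + cs.length k = cs.length (g * k) → ∀ x,
        x ∈ ConeType cs (g * k)⁻¹ ↔ (cs.length (g⁻¹ * x) = cs.length g + cs.length x ∧
          g⁻¹ * x ∈ ConeType cs k⁻¹) := by
      intro k hk x
      have e : (g * k)⁻¹ * x = k⁻¹ * (g⁻¹ * x) := by group
      have h3 := cs.length_mul_le k⁻¹ (g⁻¹ * x)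
      have h4 := cs.length_mul_le g⁻¹ x
      simp only [ConeType, Set.mem_ofPred_eq, cs.length_inv, e] at *
      constructor
      · intro h; constructor <;> omega
      · rintro ⟨h, h'⟩; omega
    have hgk : cs.length g + cs.length k = cs.length (g * k) := by
      unfold WeakLe at hgh; rwa [hk] at hgh
    have hgk' : cs.length g + cs.length k' = cs.length (g * k') := by
      have h3 := cs.length_mul_le (g * k') (k'⁻¹ * k)
      have h4 := cs.length_mul_le g k'
      have e : g * k' * (k'⁻¹ * k) = g * k := by group
      rw [e] at h3
      unfold WeakLe at h1
      omega
    have h5 : ConeType cs (g * k')⁻¹ = ConeType cs (g * k)⁻¹ := by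
      ext x
      rw [mem _ hgk', mem _ hgk, h2]
    have h6 := (hmu (g * k)).2 _ h5
    rw [hm] at h6
    have h7 : cs.length (k⁻¹ * k') = 0 := by
      have e : (g * k)⁻¹ * (g * k') = k⁻¹ * k' := by group
      unfold WeakLe at h6 h1
      rw [e] at h6
      omega
    rw [cs.length_eq_zero_iff, inv_mul_eq_one] at h7
    exact h7.symm
  · rintro g hg g' hg' j ⟨h1, h2, h3⟩
    refine ⟨j, ?_⟩
    apply GS.le_antisymm' cs
    · exact (hmu j).2 _ rfl
    · exact h3 _ (GS.mono cs mu hmu g (hfix2 g hg) _ j rfl h1)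
        (GS.mono cs mu hmu g' (hfix2 g' hg') _ j rfl h2)
end

section
/- Shi parts are closed under finite residues at local maxima: let g ∈ W and s, t ∈ S with s ≠ t, ℓ(gs) < ℓ(g) and ℓ(gt) < ℓ(g). If neither gsg⁻¹ nor gtg⁻¹ is elementary, then every element of the residue g⟨s,t⟩ lies in the Shi part of g. -/
/-!
Let `(W,S)` be a Coxeter system, given by a Coxeter matrix `M : CoxeterMatrix B`
and `cs : CoxeterSystem M W`; the set `S` of simple reflections is the range of
`cs.simple`, and `S` is finite since `B` is finite.
-/

variable {B W : Type*} [Group W] {M : CoxeterMatrix B}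

namespace ShiAux

open CoxeterSystem

open Classical in
/-- The signed permutation attached to a simple reflection. -/
noncomputable def signMap (cs : CoxeterSystem M W) (i : B) : Function.End (W × ZMod 2) :=
  fun p => (cs.simple i * p.1 * cs.simple i, p.2 + if p.1 = cs.simple i then 1 else 0)

theorem end_one_apply {α : Type*} (p : α) : (1 : Function.End α) p = p := rfl

open Classical in
theorem signMap_pow (cs : CoxeterSystem M W) (i j : B) (n : ℕ) (p : W × ZMod 2) :
    ((signMap cs i * signMap cs j) ^ n) p =
      ((cs.simple i * cs.simple j) ^ n * p.1 * ((cs.simple i * cs.simple j) ^ n)⁻¹,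
        p.2 + ∑ l ∈ Finset.range (2 * n),
          if p.1 = cs.simple j * (cs.simple i * cs.simple j) ^ l then 1 else 0) := by
  induction n with
  | zero => rw [pow_zero]; ext <;> simp [end_one_apply]
  | succ n ih =>
    rw [pow_succ']
    change signMap cs i (signMap cs j (((signMap cs i * signMap cs j) ^ n) p)) = _
    rw [ih]
    have hj : cs.simple j * cs.simple j = 1 := cs.simple_mul_simple_self j
    have hi : cs.simple i * cs.simple i = 1 := cs.simple_mul_simple_self i
    have hj' : (cs.simple j)⁻¹ = cs.simple j := cs.inv_simple j
    have hi' : (cs.simple i)⁻¹ = cs.simple i := cs.inv_simple i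
    set a := cs.simple i
    set b := cs.simple j
    have key : ∀ k : ℕ, b * (a * b) ^ k = ((a * b) ^ k)⁻¹ * b := by
      intro k
      have h1 : b * (a * b) * b⁻¹ = (a * b)⁻¹ := by simp [hi', hj', mul_assoc, hj]
      have h2 : b * (a * b) ^ k * b⁻¹ = ((a * b) ^ k)⁻¹ := by
        rw [← conj_pow, h1, inv_pow]
      rw [← h2]; simp
    set c := (a * b) ^ n with hc
    have e1 : (c * p.1 * c⁻¹ = b) ↔ p.1 = b * (a * b) ^ (2 * n) := by
      rw [two_mul, pow_add, ← mul_assoc, key n, ← hc]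
      constructor
      · intro h; rw [← h]; group
      · intro h; rw [h]; group
    have e2 : (b * (c * p.1 * c⁻¹) * b = a) ↔ p.1 = b * (a * b) ^ (2 * n + 1) := by
      have : b * (a * b) ^ (2 * n + 1) = c⁻¹ * (b * a * b) * c := by
        rw [show 2 * n + 1 = n + (1 + n) by ring, pow_add, ← mul_assoc, key n, pow_add, ← hc]
        simp [mul_assoc]
      rw [this]
      constructor
      · intro h; rw [← h]
        have : b * (b * (c * p.1 * c⁻¹) * b) * b = c * p.1 * c⁻¹ := by
          simp only [mul_assoc, hj, mul_one]; simp only [← mul_assoc, hj, one_mul]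
        rw [this]; group
      · intro h; rw [h]
        have : c * (c⁻¹ * (b * a * b) * c) * c⁻¹ = b * a * b := by group
        rw [this]
        simp only [mul_assoc, hj, mul_one]; simp only [← mul_assoc, hj, one_mul]
    rw [show 2 * (n + 1) = 2 * n + 1 + 1 by ring, Finset.sum_range_succ, Finset.sum_range_succ]
    simp only [signMap]
    change (a * (b * (c * p.1 * c⁻¹) * b) * a, _ + (if c * p.1 * c⁻¹ = b then (1 : ZMod 2) else 0) +
      (if b * (c * p.1 * c⁻¹) * b = a then (1 : ZMod 2) else 0)) = _
    simp only [e1, e2]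
    ext
    · simp only [pow_succ', ← hc]; simp [mul_assoc, hi', hj']
    · simp only; ring

theorem signMap_liftable (cs : CoxeterSystem M W) : M.IsLiftable (signMap cs) := by
  classical
  intro i j
  funext p
  rw [signMap_pow]
  have h := cs.simple_mul_simple_pow i j
  rw [h, two_mul, Finset.sum_range_add]
  simp only [pow_add, h, one_mul]
  rw [CharTwo.add_self_eq_zero]
  ext <;> simp [end_one_apply]

noncomputable def signHom (cs : CoxeterSystem M W) : W →* Function.End (W × ZMod 2) :=
  cs.lift ⟨signMap cs, signMap_liftable cs⟩

theorem signHom_simple (cs : CoxeterSystem M W) (i : B) :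
    signHom cs (cs.simple i) = signMap cs i := cs.lift_apply_simple _ _

/-- the sign cocycle -/
noncomputable def eta (cs : CoxeterSystem M W) (w t : W) : ZMod 2 := (signHom cs w⁻¹ (t, 0)).2

theorem signHom_apply (cs : CoxeterSystem M W) (w : W) (t : W) (e : ZMod 2) :
    signHom cs w (t, e) = (w * t * w⁻¹, e + (signHom cs w (t, 0)).2) := by
  induction w using cs.simple_induction_left generalizing t e with
  | one => rw [map_one]; ext <;> simp [end_one_apply]
  | mul_simple_left w i ih =>
    rw [map_mul]
    change signHom cs (cs.simple i) (signHom cs w (t, e)) =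
      (_, e + (signHom cs (cs.simple i) (signHom cs w (t, 0))).2)
    rw [ih t e, ih t 0, signHom_simple]
    simp only [signMap]
    ext
    · simp [mul_assoc]
    · simp [add_assoc]

theorem eta_mul (cs : CoxeterSystem M W) (x y t : W) :
    eta cs (x * y) t = eta cs x t + eta cs y (x⁻¹ * t * x) := by
  unfold eta
  rw [mul_inv_rev, map_mul]
  change (signHom cs y⁻¹ (signHom cs x⁻¹ (t, 0))).2 = _
  rw [signHom_apply cs x⁻¹, signHom_apply cs y⁻¹]
  simp

theorem eta_one (cs : CoxeterSystem M W) (t : W) : eta cs 1 t = 0 := by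
  unfold eta; simp [end_one_apply]

open Classical in
theorem eta_simple (cs : CoxeterSystem M W) (i : B) (t : W) :
    eta cs (cs.simple i) t = if t = cs.simple i then 1 else 0 := by
  unfold eta; rw [cs.inv_simple, signHom_simple]; simp [signMap]

/-- `t` is an inversion of `w`. -/
def N (cs : CoxeterSystem M W) (w t : W) : Prop := eta cs w t = 1

theorem N_mul (cs : CoxeterSystem M W) (x y t : W) :
    N cs (x * y) t ↔ ¬ (N cs x t ↔ N cs y (x⁻¹ * t * x)) := by
  unfold N; rw [eta_mul]
  generalize eta cs x t = a
  generalize eta cs y _ = b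
  revert a b; decide

theorem N_one (cs : CoxeterSystem M W) (t : W) : ¬ N cs 1 t := by
  unfold N; rw [eta_one]; decide

theorem N_simple (cs : CoxeterSystem M W) (i : B) (t : W) :
    N cs (cs.simple i) t ↔ t = cs.simple i := by
  classical
  unfold N; rw [eta_simple]; split_ifs with h <;> simp [h]

theorem mem_lis_of_N (cs : CoxeterSystem M W) (ω : List B) (t : W)
    (h : N cs (cs.wordProd ω) t) : t ∈ cs.leftInvSeq ω := by
  induction ω generalizing t with
  | nil => exact absurd h (by simpa using N_one cs t)
  | cons i ω ih =>
    rw [cs.wordProd_cons, N_mul, N_simple] at h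
    simp only [leftInvSeq, List.mem_cons, List.mem_map]
    by_cases ht : t = cs.simple i
    · exact Or.inl ht
    · right
      refine ⟨_, ih _ (by tauto : N cs (cs.wordProd ω) ((cs.simple i)⁻¹ * t * cs.simple i)), ?_⟩
      simp [mul_assoc]

theorem inv_of_N (cs : CoxeterSystem M W) {w t : W} (h : N cs w t) : cs.IsLeftInversion w t := by
  obtain ⟨ω, hω, rfl⟩ := cs.exists_isReduced w
  exact cs.isLeftInversion_of_mem_leftInvSeq hω (mem_lis_of_N cs ω t h)

theorem N_self (cs : CoxeterSystem M W) {t : W} (ht : cs.IsReflection t) : N cs t t := by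
  obtain ⟨x, i, rfl⟩ := ht
  have h1 := N_mul cs x x⁻¹ (x * cs.simple i * x⁻¹)
  rw [mul_inv_cancel] at h1
  have h2 := N_one cs (x * cs.simple i * x⁻¹)
  have e : x⁻¹ * (x * cs.simple i * x⁻¹) * x = cs.simple i := by group
  have e2 : (cs.simple i)⁻¹ * cs.simple i * cs.simple i = cs.simple i := by simp
  rw [e] at h1
  have h3 := N_mul cs x (cs.simple i * x⁻¹) (x * cs.simple i * x⁻¹)
  rw [e, N_mul cs (cs.simple i), e2, N_simple, ← mul_assoc] at h3
  tauto

theorem N_iff (cs : CoxeterSystem M W) {w t : W} (ht : cs.IsReflection t) :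
    N cs w t ↔ cs.length (t * w) < cs.length w := by
  refine ⟨fun h => (inv_of_N cs h).2, fun h => ?_⟩
  by_contra hn
  have h1 := N_mul cs t w t
  have e : t⁻¹ * t * t = t := by group
  rw [e] at h1
  have h2 := N_self cs ht
  have h3 : N cs (t * w) t := by tauto
  have h4 := (inv_of_N cs h3).2
  rw [← mul_assoc, ht.mul_self, one_mul] at h4
  omega

theorem N_prefix_step (cs : CoxeterSystem M W) {w : W} {i : B}
    (h : cs.length w < cs.length (w * cs.simple i)) {q : W} (hq : N cs w q) :
    N cs (w * cs.simple i) q := by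
  rw [N_mul, N_simple]
  intro hc
  have h1 := hc.1 hq
  have h2 : q = w * cs.simple i * w⁻¹ := by rw [← h1]; group
  have h3 := (inv_of_N cs hq).2
  have h4 : q * w = w * cs.simple i := by rw [h2]; group
  rw [h4] at h3
  omega

theorem N_prefix (cs : CoxeterSystem M W) (u : W) : ∀ (n : ℕ) (w : W), cs.length w = n → N cs w u →
    ∃ f i, u * f = f * cs.simple i ∧ (∀ q, N cs f q → N cs w q) ∧
      (∀ q, N cs (u * f) q → N cs w q) := by
  intro n
  induction n using Nat.strong_induction_on with
  | _ n ih =>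
    intro w hw hN
    have hw1 : w ≠ 1 := by rintro rfl; exact N_one cs u hN
    obtain ⟨i, hi⟩ := cs.exists_rightDescent_of_ne_one hw1
    unfold IsRightDescent at hi
    obtain ⟨w', rfl⟩ : ∃ w', w = w' * cs.simple i := ⟨w * cs.simple i, by simp⟩
    rw [cs.simple_mul_simple_cancel_right] at hi
    by_cases hu : N cs w' u
    · obtain ⟨f, j, h1, h2, h3⟩ := ih _ (hw ▸ hi) w' rfl hu
      exact ⟨f, j, h1, fun q hq => N_prefix_step cs hi (h2 q hq),
        fun q hq => N_prefix_step cs hi (h3 q hq)⟩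
    · rw [N_mul, N_simple] at hN
      have h1 : w'⁻¹ * u * w' = cs.simple i := by tauto
      have h2 : u * w' = w' * cs.simple i := by rw [← h1]; group
      refine ⟨w', i, h2, fun q hq => N_prefix_step cs hi hq, fun q hq => ?_⟩
      rwa [h2] at hq

theorem sep_iff (cs : CoxeterSystem M W) {q r : W} (hr : cs.IsReflection r) :
    SepIdWall cs q r ↔ cs.IsReflection q ∧ q ≠ r ∧ ∀ w, N cs w r → N cs w q := by
  constructor
  · rintro ⟨hq, h⟩
    refine ⟨hq, ?_, ?_⟩
    · rintro rfl
      obtain ⟨x, i, hx⟩ := id hr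
      have a1 := h x ⟨i, by rw [hx]; group⟩
      have a2 := h (q * x) ⟨i, by rw [mul_inv_rev, hr.inv, hx]; simp [mul_assoc]⟩
      rw [← mul_assoc, hr.mul_self, one_mul] at a2
      omega
    · intro w hw
      obtain ⟨f, i, h1, h2, -⟩ := N_prefix cs r _ w rfl hw
      exact h2 q ((N_iff cs hq).2 (h f ⟨i, by rw [mul_assoc, h1]; group⟩))
  · rintro ⟨hq, hne, h⟩
    refine ⟨hq, ?_⟩
    rintro f ⟨i, hi⟩
    rw [← N_iff cs hq]
    by_cases hf : N cs f r
    · exact h f hf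
    · have e : f * cs.simple i = r * f := by rw [← hi]; group
      have h1 : N cs (f * cs.simple i) r := by
        rw [N_mul, N_simple]; tauto
      have h2 := h _ h1
      rw [N_mul, N_simple] at h2
      have h3 : ¬ (f⁻¹ * q * f = cs.simple i) := by
        rw [← hi]; intro h4; exact hne (by simpa using h4)
      tauto

theorem step (cs : CoxeterSystem M W) {u r : W} (hu : cs.IsReflection u) (hr : cs.IsReflection r)
    (hru : ¬ N cs u r)
    (hb : ∀ w, N cs w (u * r * u) → N cs w r ∨ N cs w u)
    (h : ∃ q, SepIdWall cs q r) : ∃ q, SepIdWall cs q (u * r * u) := by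
  have hui : u⁻¹ = u := hu.inv
  have huu : u * u = 1 := hu.mul_self
  have cj : ∀ x, cs.IsReflection x → cs.IsReflection (u * x * u) := by
    intro x hx; have := hx.conj u; rwa [hui] at this
  obtain ⟨q, hq⟩ := h
  rw [sep_iff cs hr] at hq
  obtain ⟨hq, hne, hd⟩ := hq
  have hmul : ∀ w x, N cs (u * w) x ↔ ¬ (N cs u x ↔ N cs w (u * x * u)) := by
    intro w x; have := N_mul cs u w x; rwa [hui] at this
  have key : ∀ w, N cs w (u * r * u) → N cs (u * w) q := by
    intro w hw
    apply hd; rw [hmul]; tauto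
  by_cases hqu : N cs u q
  · refine ⟨q, (sep_iff cs (cj r hr)).2 ⟨hq, ?_, ?_⟩⟩
    · rintro rfl
      have h1 := hmul u r
      rw [huu] at h1
      have := N_one cs r
      tauto
    · intro w hw
      by_contra hn
      have h1 : N cs w u := by
        rcases hb w hw with h1 | h1
        · exact absurd (hd w h1) hn
        · exact h1
      have h2 := key w hw
      rw [hmul] at h2
      obtain ⟨f, i, _, h4, h5⟩ := N_prefix cs u _ w rfl h1
      have h6 := h4 (u * q * u)
      have h7 := h5 q
      rw [hmul] at h7
      tauto
  · refine ⟨u * q * u, (sep_iff cs (cj r hr)).2 ⟨cj q hq, ?_, ?_⟩⟩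
    · simpa using hne
    · intro w hw
      have h2 := key w hw
      rw [hmul] at h2
      tauto

/-- reflections of the dihedral subgroup -/
def rr (cs : CoxeterSystem M W) (s t : B) (i : ℤ) : W :=
  (cs.simple s * cs.simple t) ^ i * cs.simple s

section dihedral
variable (cs : CoxeterSystem M W) (s t : B)

theorem inv_conj (i : ℤ) : cs.simple s * (cs.simple s * cs.simple t) ^ i * cs.simple s =
    (cs.simple s * cs.simple t) ^ (-i) := by
  have h1 : cs.simple s * (cs.simple s * cs.simple t) * (cs.simple s)⁻¹ =
      (cs.simple s * cs.simple t)⁻¹ := by simp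
  have h2 := conj_zpow (i := i) (a := cs.simple s) (b := cs.simple s * cs.simple t)
  rw [h1, cs.inv_simple, inv_zpow] at h2
  rw [← h2, zpow_neg]

theorem rr_conj_s (i : ℤ) : cs.simple s * rr cs s t i * cs.simple s = rr cs s t (-i) := by
  unfold rr; rw [← inv_conj]; simp [mul_assoc]

theorem rr_zero : rr cs s t 0 = cs.simple s := by simp [rr]

theorem rr_neg_one : rr cs s t (-1) = cs.simple t := by simp [rr]

theorem rr_conj_t (i : ℤ) : cs.simple t * rr cs s t i * cs.simple t = rr cs s t (-2 - i) := by
  have h := inv_conj cs s t (i + 1)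
  have e : (cs.simple s * cs.simple t) ^ (-2 - i) =
      (cs.simple s * cs.simple t) ^ (-1 : ℤ) * (cs.simple s * cs.simple t) ^ (-(i + 1)) := by
    rw [← zpow_add]; congr 1; ring
  unfold rr
  rw [e, ← h, zpow_add_one]
  simp [mul_assoc]

theorem rr_eq_iff (i j : ℤ) : rr cs s t i = rr cs s t j ↔
    ((orderOf (cs.simple s * cs.simple t) : ℕ) : ℤ) ∣ i - j := by
  unfold rr
  rw [mul_left_inj, orderOf_dvd_iff_zpow_eq_one, zpow_sub, mul_inv_eq_one]

theorem N_s_mul (y : W) (i : ℤ) : N cs (cs.simple s * y) (rr cs s t i) ↔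
    ¬ (((orderOf (cs.simple s * cs.simple t) : ℕ) : ℤ) ∣ i ↔ N cs y (rr cs s t (-i))) := by
  rw [N_mul, N_simple, cs.inv_simple, rr_conj_s]
  have e := rr_eq_iff cs s t i 0
  rw [rr_zero, sub_zero] at e
  rw [e]

theorem N_t_mul (y : W) (i : ℤ) : N cs (cs.simple t * y) (rr cs s t i) ↔
    ¬ (((orderOf (cs.simple s * cs.simple t) : ℕ) : ℤ) ∣ i + 1 ↔ N cs y (rr cs s t (-2 - i))) := by
  rw [N_mul, N_simple, cs.inv_simple, rr_conj_t]
  have e := rr_eq_iff cs s t i (-1)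
  rw [rr_neg_one, sub_neg_eq_add] at e
  rw [e]

theorem rr_refl (i : ℤ) : cs.IsReflection (rr cs s t i) := by
  have h : ∀ k j : ℤ, (cs.simple s * cs.simple t) ^ k * rr cs s t j *
      ((cs.simple s * cs.simple t) ^ k)⁻¹ = rr cs s t (k + j + k) := by
    intro k j
    have h1 := inv_conj cs s t k
    unfold rr
    rw [zpow_add, zpow_add, ← zpow_neg, ← h1]
    simp [mul_assoc]
  rcases Int.even_or_odd i with ⟨k, hk⟩ | ⟨k, hk⟩
  · rw [show i = k + 0 + k by omega, ← h, rr_zero]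
    exact (cs.isReflection_simple s).conj _
  · rw [show i = (k + 1) + (-1) + (k + 1) by omega, ← h, rr_neg_one]
    exact (cs.isReflection_simple t).conj _

theorem rr_mem (i : ℤ) :
    rr cs s t i ∈ Subgroup.closure ({cs.simple s, cs.simple t} : Set W) := by
  have h1 : cs.simple s ∈ Subgroup.closure ({cs.simple s, cs.simple t} : Set W) :=
    Subgroup.subset_closure (by simp)
  have h2 : cs.simple t ∈ Subgroup.closure ({cs.simple s, cs.simple t} : Set W) :=
    Subgroup.subset_closure (by simp)
  exact mul_mem (zpow_mem (mul_mem h1 h2) i) h1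

/-- Induction over left multiplication by `s`, `t`, from a chamber with no dihedral inversion. -/
theorem dihedral_induction {P : W → Prop}
    (h0 : ∀ z, (∀ i, ¬ N cs z (rr cs s t i)) → P z)
    (h1 : ∀ y, P y → P (cs.simple s * y)) (h2 : ∀ y, P y → P (cs.simple t * y)) (y : W) : P y := by
  set D := Subgroup.closure ({cs.simple s, cs.simple t} : Set W) with hD
  have hne : (Set.range fun x : D => cs.length ((x : W) * y)).Nonempty := ⟨_, ⟨1, rfl⟩⟩
  obtain ⟨⟨x, hx⟩, hx2⟩ := Nat.sInf_mem hne
  have hz : P (x * y) := by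
    apply h0
    intro i hi
    have := (inv_of_N cs hi).2
    have h3 : sInf (Set.range fun x : D => cs.length ((x : W) * y)) ≤
        cs.length (rr cs s t i * (x * y)) :=
      Nat.sInf_le ⟨⟨rr cs s t i * x, mul_mem (rr_mem cs s t i) hx⟩, by simp [mul_assoc]⟩
    simp only at hx2
    omega
  have all : ∀ v ∈ D, P (v * (x * y)) := by
    intro v hv
    induction hv using Subgroup.closure_induction_left with
    | one => simpa using hz
    | mul_left a ha b hb ih =>
      rcases ha with rfl | rfl
      · rw [mul_assoc]; exact h1 _ ih
      · rw [mul_assoc]; exact h2 _ ih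
    | inv_mul_cancel a ha b hb ih =>
      rcases ha with rfl | rfl
      · rw [mul_assoc, cs.inv_simple]; exact h1 _ ih
      · rw [mul_assoc, cs.inv_simple]; exact h2 _ ih
  simpa using all x⁻¹ (inv_mem hx)

theorem seg_infinite (hm : orderOf (cs.simple s * cs.simple t) = 0) (y : W) :
    ∃ n : ℤ, 0 ≤ n ∧ ((∀ i : ℤ, N cs y (rr cs s t i) ↔ (0 ≤ i ∧ i < n)) ∨
      (∀ i : ℤ, N cs y (rr cs s t i) ↔ (-n ≤ i ∧ i < 0))) := by
  induction y using dihedral_induction cs s t with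
  | h0 z hz => exact ⟨0, le_rfl, Or.inl fun i => by have := hz i; constructor; tauto; omega⟩
  | h1 y ih =>
    obtain ⟨n, hn, h⟩ := ih
    simp only [N_s_mul, hm, Nat.cast_zero, zero_dvd_iff]
    rcases h with h | h
    · simp only [h]
      by_cases h0 : n = 0
      · exact ⟨1, by omega, Or.inl fun i => by omega⟩
      · exact ⟨n - 1, by omega, Or.inr fun i => by omega⟩
    · simp only [h]
      exact ⟨n + 1, by omega, Or.inl fun i => by omega⟩
  | h2 y ih =>
    obtain ⟨n, hn, h⟩ := ih
    simp only [N_t_mul, hm, Nat.cast_zero, zero_dvd_iff]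
    rcases h with h | h
    · simp only [h]
      exact ⟨n + 1, by omega, Or.inr fun i => by omega⟩
    · simp only [h]
      by_cases h0 : n = 0
      · exact ⟨1, by omega, Or.inr fun i => by omega⟩
      · exact ⟨n - 1, by omega, Or.inl fun i => by omega⟩

theorem rr_congr {m : ℤ} (hm : ((orderOf (cs.simple s * cs.simple t) : ℕ) : ℤ) = m) (i j : ℤ)
    (h : i - j = m) : rr cs s t i = rr cs s t j := by
  rw [rr_eq_iff, hm, h]

theorem dvd_small {m i : ℤ} (h0 : 0 ≤ i) (h1 : i < m) : m ∣ i ↔ i = 0 :=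
  ⟨fun h => Int.eq_zero_of_dvd_of_nonneg_of_lt h0 h1 h, fun h => h ▸ dvd_zero _⟩

theorem N_s_mul' {m : ℤ} (hm : ((orderOf (cs.simple s * cs.simple t) : ℕ) : ℤ) = m) (y : W) (i : ℤ)
    (h0 : 0 ≤ i) (h1 : i < m) : N cs (cs.simple s * y) (rr cs s t i) ↔
    ¬ (i = 0 ↔ N cs y (rr cs s t (if i = 0 then 0 else m - i))) := by
  rw [N_s_mul, hm, dvd_small h0 h1]
  split_ifs with h
  · subst h; simp
  · rw [rr_congr cs s t hm (m - i) (-i) (by ring)]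

theorem N_t_mul' {m : ℤ} (hm : ((orderOf (cs.simple s * cs.simple t) : ℕ) : ℤ) = m) (y : W) (i : ℤ)
    (h0 : 0 ≤ i) (h1 : i < m) : N cs (cs.simple t * y) (rr cs s t i) ↔
    ¬ (i = m - 1 ↔ N cs y (rr cs s t (if i = m - 1 then m - 1 else m - 2 - i))) := by
  rw [N_t_mul, hm]
  have e : m ∣ i + 1 ↔ i = m - 1 := by
    constructor
    · intro h; have := Int.le_of_dvd (by omega) h; omega
    · intro h; rw [h]; simp
  rw [e]
  split_ifs with h
  · subst h
    rw [rr_congr cs s t hm (m - 1) (-1) (by ring), rr_congr cs s t hm (-1) (-2 - (m - 1)) (by ring)]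
  · rw [rr_congr cs s t hm (m - 2 - i) (-2 - i) (by ring)]

theorem seg_finite {m : ℤ} (hm : ((orderOf (cs.simple s * cs.simple t) : ℕ) : ℤ) = m) (hpos : 0 < m)
    (y : W) :
    ∃ n : ℤ, 0 ≤ n ∧ n ≤ m ∧ ((∀ i : ℤ, 0 ≤ i → i < m → (N cs y (rr cs s t i) ↔ i < n)) ∨
      (∀ i : ℤ, 0 ≤ i → i < m → (N cs y (rr cs s t i) ↔ n ≤ i))) := by
  induction y using dihedral_induction cs s t with
  | h0 z hz =>
    exact ⟨0, le_rfl, by omega, Or.inl fun i _ _ => by have := hz i; constructor; tauto; omega⟩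
  | h1 y ih =>
    obtain ⟨n, hn, hn', h⟩ := ih
    have key : ∀ i, 0 ≤ i → i < m → _ := fun i h0 h1 => N_s_mul' cs s t hm y i h0 h1
    rcases h with h | h
    · by_cases h0 : n = 0
      · refine ⟨1, by omega, by omega, Or.inl fun i a b => ?_⟩
        rw [key i a b, h _ (by split_ifs <;> omega) (by split_ifs <;> omega)]
        split_ifs <;> omega
      · refine ⟨m - n + 1, by omega, by omega, Or.inr fun i a b => ?_⟩
        rw [key i a b, h _ (by split_ifs <;> omega) (by split_ifs <;> omega)]
        split_ifs <;> omega
    · by_cases h0 : n = 0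
      · refine ⟨1, by omega, by omega, Or.inr fun i a b => ?_⟩
        rw [key i a b, h _ (by split_ifs <;> omega) (by split_ifs <;> omega)]
        split_ifs <;> omega
      · refine ⟨m - n + 1, by omega, by omega, Or.inl fun i a b => ?_⟩
        rw [key i a b, h _ (by split_ifs <;> omega) (by split_ifs <;> omega)]
        split_ifs <;> omega
  | h2 y ih =>
    obtain ⟨n, hn, hn', h⟩ := ih
    have key : ∀ i, 0 ≤ i → i < m → _ := fun i h0 h1 => N_t_mul' cs s t hm y i h0 h1
    rcases h with h | h
    · by_cases h0 : n = m
      · refine ⟨m - 1, by omega, by omega, Or.inl fun i a b => ?_⟩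
        rw [key i a b, h _ (by split_ifs <;> omega) (by split_ifs <;> omega)]
        split_ifs <;> omega
      · refine ⟨m - 1 - n, by omega, by omega, Or.inr fun i a b => ?_⟩
        rw [key i a b, h _ (by split_ifs <;> omega) (by split_ifs <;> omega)]
        split_ifs <;> omega
    · by_cases h0 : n = m
      · refine ⟨m - 1, by omega, by omega, Or.inr fun i a b => ?_⟩
        rw [key i a b, h _ (by split_ifs <;> omega) (by split_ifs <;> omega)]
        split_ifs <;> omega
      · refine ⟨m - 1 - n, by omega, by omega, Or.inl fun i a b => ?_⟩
        rw [key i a b, h _ (by split_ifs <;> omega) (by split_ifs <;> omega)]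
        split_ifs <;> omega

theorem rr_reduce {m : ℤ} (hm : ((orderOf (cs.simple s * cs.simple t) : ℕ) : ℤ) = m) (hpos : 0 < m)
    (i : ℤ) : ∃ j, 0 ≤ j ∧ j < m ∧ rr cs s t i = rr cs s t j :=
  ⟨i % m, Int.emod_nonneg _ hpos.ne', Int.emod_lt_of_pos _ hpos, by
    rw [rr_eq_iff, hm]; exact Int.dvd_self_sub_emod⟩

theorem conj_mem_rr (x : W) (hx : x ∈ Subgroup.closure ({cs.simple s, cs.simple t} : Set W))
    (j : ℤ) : ∃ i, x * rr cs s t j * x⁻¹ = rr cs s t i := by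
  have a1 : ∀ y : W, (∃ i, y * rr cs s t j * y⁻¹ = rr cs s t i) →
      ∃ i, cs.simple s * y * rr cs s t j * (cs.simple s * y)⁻¹ = rr cs s t i := by
    rintro y ⟨i, hi⟩
    refine ⟨-i, ?_⟩
    rw [← rr_conj_s, ← hi]; simp [mul_assoc]
  have a2 : ∀ y : W, (∃ i, y * rr cs s t j * y⁻¹ = rr cs s t i) →
      ∃ i, cs.simple t * y * rr cs s t j * (cs.simple t * y)⁻¹ = rr cs s t i := by
    rintro y ⟨i, hi⟩
    refine ⟨-2-i, ?_⟩
    rw [← rr_conj_t, ← hi]; simp [mul_assoc]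
  induction hx using Subgroup.closure_induction_left with
  | one => exact ⟨j, by simp⟩
  | mul_left a ha b hb ih =>
    rcases ha with rfl | rfl
    · exact a1 _ ih
    · exact a2 _ ih
  | inv_mul_cancel a ha b hb ih =>
    rcases ha with rfl | rfl
    · rw [cs.inv_simple]; exact a1 _ ih
    · rw [cs.inv_simple]; exact a2 _ ih

end dihedral

/-- the step lemma inside a residue all of whose reflections are inversions -/
theorem residue_step (cs : CoxeterSystem M W) (g : W) (u : B) (r : W) (hr : cs.IsReflection r)
    (hne : r ≠ cs.simple u)
    (i1 : N cs g⁻¹ r) (i2 : N cs g⁻¹ (cs.simple u)) (i3 : N cs g⁻¹ (cs.simple u * r * cs.simple u))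
    (hb : ∀ y, N cs y r → N cs y (cs.simple u) → N cs y (cs.simple u * r * cs.simple u))
    (h : ∃ q, SepIdWall cs q (g * r * g⁻¹)) :
    ∃ q, SepIdWall cs q (g * (cs.simple u * r * cs.simple u) * g⁻¹) := by
  have cg : ∀ d y, N cs g⁻¹ d → (N cs (g * y) (g * d * g⁻¹) ↔ ¬ N cs y d) := by
    intro d y hd
    have h1 := N_mul cs g g⁻¹ (g * d * g⁻¹)
    have h2 := N_mul cs g y (g * d * g⁻¹)
    have e : g⁻¹ * (g * d * g⁻¹) * g = d := by group
    rw [e] at h1 h2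
    rw [mul_inv_cancel] at h1
    have := N_one cs (g * d * g⁻¹)
    tauto
  have e : g * (cs.simple u * r * cs.simple u) * g⁻¹ =
      (g * cs.simple u * g⁻¹) * (g * r * g⁻¹) * (g * cs.simple u * g⁻¹) := by group
  rw [e]
  refine step cs ((cs.isReflection_simple u).conj g) (hr.conj g) ?_ ?_ h
  · rw [mul_assoc g, cg _ _ i1, N_mul, N_simple, cs.inv_simple]; tauto
  · intro w
    rw [← e]
    obtain ⟨y, rfl⟩ : ∃ y, w = g * y := ⟨g⁻¹ * w, by simp⟩
    rw [cg _ _ i1, cg _ _ i2, cg _ _ i3]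
    have := hb y
    tauto

theorem exists_sep (cs : CoxeterSystem M W) {r : W} (hr : cs.IsReflection r)
    (h : ¬ IsElementary cs r) : ∃ q, SepIdWall cs q r := by
  by_contra hn; exact h ⟨hr, hn⟩

theorem all_sep (cs : CoxeterSystem M W) (g : W) (s t : B)
    (hst : cs.simple s ≠ cs.simple t)
    (hs : cs.length (g * cs.simple s) < cs.length g)
    (ht : cs.length (g * cs.simple t) < cs.length g)
    (hes : ¬ IsElementary cs (g * cs.simple s * g⁻¹))
    (het : ¬ IsElementary cs (g * cs.simple t * g⁻¹)) (i : ℤ) :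
    ∃ q, SepIdWall cs q (g * rr cs s t i * g⁻¹) := by
  have desc : ∀ j, cs.length (g * cs.simple j) < cs.length g → N cs g⁻¹ (cs.simple j) := by
    intro j hj
    rw [N_iff cs (cs.isReflection_simple j), ← cs.length_inv]; simpa using hj
  have Ns := desc s hs
  have Nt := desc t ht
  obtain ⟨m, hm⟩ : ∃ m : ℤ, ((orderOf (cs.simple s * cs.simple t) : ℕ) : ℤ) = m := ⟨_, rfl⟩
  have hm0 : m ≠ 0 := by
    intro h0
    obtain ⟨n, hn, h⟩ := seg_infinite cs s t (by omega) g⁻¹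
    rw [← rr_zero cs s t] at Ns
    rw [← rr_neg_one cs s t] at Nt
    rcases h with h | h
    · rw [h] at Nt; omega
    · rw [h] at Ns; omega
  have hpos : 0 < m := by omega
  have et : rr cs s t (m - 1) = cs.simple t := by
    rw [rr_congr cs s t hm (m - 1) (-1) (by ring), rr_neg_one]
  have all : ∀ i, 0 ≤ i → i < m → N cs g⁻¹ (rr cs s t i) := by
    intro i a b
    obtain ⟨n, hn, hn', h⟩ := seg_finite cs s t hm hpos g⁻¹
    rw [← rr_zero cs s t] at Ns
    rw [← et] at Nt
    rcases h with h | h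
    · rw [h _ (by omega) (by omega)] at *; omega
    · rw [h _ (by omega) (by omega)] at *; omega
  have inj : ∀ i j, 0 ≤ i → i < m → 0 ≤ j → j < m → rr cs s t i = rr cs s t j → i = j := by
    intro i j a b c d h
    rw [rr_eq_iff, hm] at h
    have := Int.eq_zero_of_abs_lt_dvd h (by rw [abs_lt]; constructor <;> omega)
    omega
  have main : ∀ k : ℕ, 2 * (k : ℤ) + 1 ≤ m → (∃ q, SepIdWall cs q (g * rr cs s t k * g⁻¹)) ∧
      (∃ q, SepIdWall cs q (g * rr cs s t (m - 1 - k) * g⁻¹)) := by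
    intro k
    induction k with
    | zero =>
      intro _
      simp only [Nat.cast_zero, sub_zero, et, rr_zero]
      exact ⟨exists_sep cs ((cs.isReflection_simple s).conj g) hes,
        exists_sep cs ((cs.isReflection_simple t).conj g) het⟩
    | succ k ih =>
      intro hk
      push_cast at hk ⊢
      obtain ⟨q1, q2⟩ := ih (by omega)
      have e1 : cs.simple s * rr cs s t (m - 1 - k) * cs.simple s = rr cs s t (k + 1) := by
        rw [rr_conj_s]
        exact (rr_congr cs s t hm _ _ (by ring)).symm
      have e2 : cs.simple t * rr cs s t k * cs.simple t = rr cs s t (m - 1 - (k + 1)) := by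
        rw [rr_conj_t]
        exact (rr_congr cs s t hm _ _ (by ring)).symm
      constructor
      · rw [← e1]
        refine residue_step cs g s _ (rr_refl cs s t _) ?_ (all _ (by omega) (by omega)) Ns ?_ ?_ q2
        · rw [← rr_zero cs s t]; intro h
          have := inj _ _ (by omega) (by omega) (by omega) (by omega) h; omega
        · rw [e1]; exact all _ (by omega) (by omega)
        · intro y
          rw [e1, ← rr_zero cs s t]
          obtain ⟨n, hn, hn', h⟩ := seg_finite cs s t hm hpos y
          rcases h with h | h
          · rw [h _ (by omega) (by omega), h _ (by omega) (by omega), h _ (by omega) (by omega)]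
            omega
          · rw [h _ (by omega) (by omega), h _ (by omega) (by omega), h _ (by omega) (by omega)]
            omega
      · rw [← e2]
        refine residue_step cs g t _ (rr_refl cs s t _) ?_ (all _ (by omega) (by omega)) Nt ?_ ?_ q1
        · rw [← et]; intro h
          have := inj _ _ (by omega) (by omega) (by omega) (by omega) h; omega
        · rw [e2]; exact all _ (by omega) (by omega)
        · intro y
          rw [e2, ← et]
          obtain ⟨n, hn, hn', h⟩ := seg_finite cs s t hm hpos y
          rcases h with h | h
          · rw [h _ (by omega) (by omega), h _ (by omega) (by omega), h _ (by omega) (by omega)]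
            omega
          · rw [h _ (by omega) (by omega), h _ (by omega) (by omega), h _ (by omega) (by omega)]
            omega
  obtain ⟨j, j0, j1, hj⟩ := rr_reduce cs s t hm hpos i
  rw [hj]
  by_cases hjm : 2 * j + 1 ≤ m
  · have := (main j.toNat (by omega)).1
    rwa [Int.toNat_of_nonneg j0] at this
  · have := (main (m - 1 - j).toNat (by omega)).2
    rwa [Int.toNat_of_nonneg (by omega), show m - 1 - (m - 1 - j) = j by ring] at this

end ShiAux

/-- Shi parts are closed under finite residues at local maxima: if `s ≠ t ∈ S` are
descents of `g` and neither `gsg⁻¹` nor `gtg⁻¹` is elementary, then every element of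
the residue `g⟨s,t⟩` lies in the Shi part of `g`. -/
theorem shi_residue_closed [Finite B] (cs : CoxeterSystem M W) (g : W) (s t : B)
    (hst : cs.simple s ≠ cs.simple t)
    (hs : cs.length (g * cs.simple s) < cs.length g)
    (ht : cs.length (g * cs.simple t) < cs.length g)
    (hes : ¬ IsElementary cs (g * cs.simple s * g⁻¹))
    (het : ¬ IsElementary cs (g * cs.simple t * g⁻¹)) :
    ∀ u ∈ Subgroup.closure ({cs.simple s, cs.simple t} : Set W),
      SameShiPart cs g (g * u) := by
  have key := ShiAux.all_sep cs g s t hst hs ht hes het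
  have st : ∀ x ∈ Subgroup.closure ({cs.simple s, cs.simple t} : Set W), ∀ j : B,
      (∃ k, ShiAux.rr cs s t k = cs.simple j) → SameShiPart cs g (g * x) →
      SameShiPart cs g (g * (x * cs.simple j)) := by
    rintro x hx j ⟨k, hk⟩ h
    refine Relation.ReflTransGen.tail h ⟨j, by rw [mul_assoc], ?_⟩
    obtain ⟨i, hi⟩ := ShiAux.conj_mem_rr cs s t x hx k
    have e : g * x * cs.simple j * (g * x)⁻¹ = g * ShiAux.rr cs s t i * g⁻¹ := by
      rw [← hi, hk]; group
    rw [e]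
    exact fun hc => hc.2 (key i)
  intro u hu
  induction hu using Subgroup.closure_induction_right with
  | one => rw [mul_one]; exact Relation.ReflTransGen.refl
  | mul_right a ha b hb ih =>
    rcases hb with rfl | rfl
    · exact st _ ha s ⟨0, ShiAux.rr_zero cs s t⟩ ih
    · exact st _ ha t ⟨-1, ShiAux.rr_neg_one cs s t⟩ ih
  | mul_inv_cancel a ha b hb ih =>
    rcases hb with rfl | rfl
    · rw [cs.inv_simple]; exact st _ ha s ⟨0, ShiAux.rr_zero cs s t⟩ ih
    · rw [cs.inv_simple]; exact st _ ha t ⟨-1, ShiAux.rr_neg_one cs s t⟩ ih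
end

section
/- Cone type parts are closed under finite residues at local maxima: let g ∈ W and s, t ∈ S with s ≠ t, ℓ(gs) < ℓ(g) and ℓ(gt) < ℓ(g). If T((gs)⁻¹) = T(g⁻¹) and T((gt)⁻¹) = T(g⁻¹), then T((gu)⁻¹) = T(g⁻¹) for every u ∈ ⟨s,t⟩. -/
/-!
Let `(W,S)` be a Coxeter system, given by a Coxeter matrix `M : CoxeterMatrix B`
and `cs : CoxeterSystem M W`; the set `S` of simple reflections is the range of
`cs.simple`, and `S` is finite since `B` is finite.
-/

variable {B W : Type*} [Group W] {M : CoxeterMatrix B}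

open CoxeterSystem

theorem end_mul_apply {X : Type*} (a b : Function.End X) (x : X) : (a * b) x = a (b x) := rfl

open Classical in
/-- The generators of the reflection action on `W × ZMod 2`. -/
noncomputable def rfl_gen (cs : CoxeterSystem M W) (i : B) : Function.End (W × ZMod 2) :=
  fun p => (cs.simple i * p.1 * cs.simple i, p.2 + if p.1 = cs.simple i then 1 else 0)

theorem simple_mul_pow_aux (cs : CoxeterSystem M W) (i j : B) (k : ℕ) :
    cs.simple j * (cs.simple i * cs.simple j) ^ k
      = ((cs.simple i * cs.simple j) ^ k)⁻¹ * cs.simple j := by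
  induction k with
  | zero => simp
  | succ k ih =>
    rw [pow_succ, ← mul_assoc, ih]
    simp only [mul_inv_rev, inv_simple, mul_assoc]
    have h : (cs.simple i * cs.simple j) * (cs.simple i * cs.simple j) ^ k
        = (cs.simple i * cs.simple j) ^ k * (cs.simple i * cs.simple j) :=
      (pow_succ' _ k).symm.trans (pow_succ _ k)
    have h2 := congrArg (fun z => z⁻¹) h
    simp only [mul_inv_rev, inv_simple] at h2
    have h3 := congrArg (fun z => z * cs.simple j) h2
    simpa only [mul_assoc] using h3

open Classical in
theorem rfl_gen_pow (cs : CoxeterSystem M W) (i j : B) (m : ℕ) (r : W) (e : ZMod 2) :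
    ((rfl_gen cs i * rfl_gen cs j) ^ m) (r, e) =
      ((cs.simple i * cs.simple j) ^ m * r * ((cs.simple i * cs.simple j) ^ m)⁻¹,
        e + ∑ k ∈ Finset.range (2 * m),
          if r = cs.simple j * (cs.simple i * cs.simple j) ^ k then 1 else 0) := by
  induction m with
  | zero => simp [Function.End.one_def]
  | succ m ih =>
    rw [pow_succ', end_mul_apply, ih, end_mul_apply]
    have e1 : (cs.simple i * cs.simple j) ^ m * r * ((cs.simple i * cs.simple j) ^ m)⁻¹
        = cs.simple j ↔ r = cs.simple j * (cs.simple i * cs.simple j) ^ (2 * m) := by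
      rw [two_mul, pow_add, ← mul_assoc, simple_mul_pow_aux, mul_inv_eq_iff_eq_mul,
        mul_assoc, eq_inv_mul_iff_mul_eq]
    have e2 : cs.simple j * ((cs.simple i * cs.simple j) ^ m * r *
        ((cs.simple i * cs.simple j) ^ m)⁻¹) * cs.simple j
        = cs.simple i ↔ r = cs.simple j * (cs.simple i * cs.simple j) ^ (2 * m + 1) := by
      have : 2 * m + 1 = m + 1 + m := by ring
      rw [this, pow_add, pow_succ, ← mul_assoc, ← mul_assoc, simple_mul_pow_aux]
      generalize (cs.simple i * cs.simple j) ^ m = c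
      constructor
      · intro h
        rw [← h]
        simp [mul_assoc]
      · rintro rfl
        simp [mul_assoc]
    have : 2 * (m + 1) = 2 * m + 1 + 1 := by ring
    rw [this, Finset.sum_range_succ, Finset.sum_range_succ]
    simp only [rfl_gen, e1, e2, Prod.mk.injEq]
    constructor
    · rw [pow_succ']
      simp [mul_assoc]
    · simp only [add_assoc]

theorem rfl_gen_liftable (cs : CoxeterSystem M W) : M.IsLiftable (rfl_gen cs) := by
  classical
  intro i j
  funext ⟨r, e⟩
  rw [rfl_gen_pow, two_mul, Finset.sum_range_add]
  simp only [pow_add, simple_mul_simple_pow, one_mul, inv_one, mul_one, CharTwo.add_self_eq_zero,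
    add_zero, Function.End.one_def, id]

open Classical in
theorem lift_word (cs : CoxeterSystem M W) (ω : List B) (r : W) (e : ZMod 2) :
    cs.lift ⟨rfl_gen cs, rfl_gen_liftable cs⟩ (cs.wordProd ω) (r, e) =
      (cs.wordProd ω * r * (cs.wordProd ω)⁻¹, e + ((cs.rightInvSeq ω).count r : ZMod 2)) := by
  induction ω with
  | nil => simp [Function.End.one_def]
  | cons i ω ih =>
    rw [wordProd_cons, map_mul, lift_apply_simple, end_mul_apply, ih]
    have e1 : cs.wordProd ω * r * (cs.wordProd ω)⁻¹ = cs.simple i ↔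
        (cs.wordProd ω)⁻¹ * cs.simple i * cs.wordProd ω = r := by
      constructor
      · intro h
        rw [← h]; group
      · rintro rfl
        group
    simp only [rfl_gen, rightInvSeq, List.count_cons, e1, beq_iff_eq, Prod.mk.injEq]
    constructor
    · simp [mul_assoc]
    · push_cast
      rw [add_assoc]

theorem exchange_s14 (cs : CoxeterSystem M W) (ω : List B) (i : B)
    (h : cs.length (cs.wordProd ω * cs.simple i) < cs.length (cs.wordProd ω)) :
    ∃ j < ω.length, cs.wordProd ω * cs.simple i = cs.wordProd (ω.eraseIdx j) := by
  classical
  obtain ⟨ω', hr, hp⟩ := cs.exists_isReduced (cs.wordProd ω * cs.simple i)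
  have hp2 : cs.wordProd (ω'.concat i) = cs.wordProd ω := by
    rw [wordProd_concat, ← hp]; simp
  have hred : cs.IsReduced (ω'.concat i) := by
    unfold CoxeterSystem.IsReduced at *
    rw [hp2]
    have := cs.length_mul_simple (cs.wordProd ω) i
    rw [← hp] at hr
    simp
    omega
  have hmem : cs.simple i ∈ cs.rightInvSeq (ω'.concat i) := by
    rw [rightInvSeq_concat]; simp
  have hc : (cs.rightInvSeq (ω'.concat i)).count (cs.simple i) = 1 :=
    List.count_eq_one_of_mem hred.nodup_rightInvSeq hmem
  have h1 := lift_word cs ω (cs.simple i) 0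
  have h2 := lift_word cs (ω'.concat i) (cs.simple i) 0
  rw [hp2, h1, hc] at h2
  have h3 := (Prod.mk.inj h2).2
  have hm : cs.simple i ∈ cs.rightInvSeq ω := by
    by_contra hn
    rw [List.count_eq_zero_of_not_mem hn] at h3
    simp at h3
  obtain ⟨j, hj, he⟩ := List.getElem_of_mem hm
  refine ⟨j, by simpa using hj, ?_⟩
  rw [← wordProd_mul_getD_rightInvSeq, List.getD_eq_getElem _ _ hj, he]

theorem exchange2 (cs : CoxeterSystem M W) (ω : List B) (b : W) (i : B)
    (h : cs.length (cs.wordProd ω * b * cs.simple i) < cs.length (cs.wordProd ω * b)) :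
    cs.length (b * cs.simple i) < cs.length b ∨
    ∃ j < ω.length, cs.wordProd ω * b * cs.simple i = cs.wordProd (ω.eraseIdx j) * b := by
  obtain ⟨β, hr, rfl⟩ := cs.exists_isReduced b
  rw [← wordProd_append] at h
  obtain ⟨j, hj, he⟩ := exchange_s14 cs _ i h
  by_cases hjl : j < ω.length
  · right
    refine ⟨j, hjl, ?_⟩
    rw [← wordProd_append, he, List.eraseIdx_append_of_lt_length hjl, wordProd_append]
  · left
    push Not at hjl
    rw [List.eraseIdx_append_of_length_le hjl, wordProd_append, wordProd_append, mul_assoc,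
      mul_right_inj] at he
    rw [he, hr.eq]
    have := cs.length_wordProd_le (β.eraseIdx (j - ω.length))
    rw [List.length_eraseIdx] at this
    simp at hj
    split_ifs at this <;> omega

theorem alt_zero (cs : CoxeterSystem M W) (s t : B) : cs.wordProd (alternatingWord s t 0) = 1 := by
  simp [alternatingWord]

theorem alt_succ (cs : CoxeterSystem M W) (s t : B) (n : ℕ) :
    cs.wordProd (alternatingWord s t (n + 1)) = cs.wordProd (alternatingWord t s n) * cs.simple t := by
  rw [alternatingWord_succ, wordProd_concat]

theorem alt_le (cs : CoxeterSystem M W) (s t : B) (n : ℕ) :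
    cs.length (cs.wordProd (alternatingWord s t n)) ≤ n := by
  simpa using cs.length_wordProd_le (alternatingWord s t n)

theorem alt_eq (cs : CoxeterSystem M W) (s t : B) (n : ℕ)
    (hl : cs.length (cs.wordProd (alternatingWord t s n)) = n)
    (hd : cs.length (cs.wordProd (alternatingWord t s n) * cs.simple t) < n) :
    cs.wordProd (alternatingWord t s n) = cs.wordProd (alternatingWord s t n) := by
  induction n with
  | zero => simp at hd
  | succ n ih =>
    have hw := alternatingWord_succ' t s n
    have hp : cs.wordProd (alternatingWord t s (n+1)) =
      cs.wordProd [if Even n then s else t] * cs.wordProd (alternatingWord t s n) := by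
      rw [hw, wordProd_cons, wordProd_singleton]
    have hln : cs.length (cs.wordProd (alternatingWord t s n)) = n := by
      have h1 := cs.length_mul_le (cs.wordProd [if Even n then s else t])
        (cs.wordProd (alternatingWord t s n))
      rw [← hp, hl, wordProd_singleton, length_simple] at h1
      have := alt_le cs t s n
      omega
    rcases exchange2 cs [if Even n then s else t] (cs.wordProd (alternatingWord t s n)) t
      (by rw [← hp, hl]; exact hd) with h | ⟨j, hj, h⟩
    · exfalso
      rw [hln] at h
      have h2 := ih hln h
      cases n with
      | zero => simp at h
      | succ n =>
        rw [alt_succ, ← h2, alt_succ, simple_mul_simple_cancel_right] at hl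
        have := alt_le cs s t n
        omega
    · rw [← hp] at h
      simp at hj
      subst hj
      simp at h
      rw [alt_succ cs s t, ← h, simple_mul_simple_cancel_right]

theorem exists_top (cs : CoxeterSystem M W) (g : W) (s t : B)
    (hs : cs.length (g * cs.simple s) < cs.length g)
    (ht : cs.length (g * cs.simple t) < cs.length g) :
    ∃ (n : ℕ) (x : W), 1 ≤ n ∧ g = x * cs.wordProd (alternatingWord s t n) ∧
      cs.length g = cs.length x + n ∧
      cs.wordProd (alternatingWord t s n) = cs.wordProd (alternatingWord s t n) := by
  classical
  let P : ℕ → Prop := fun n => ∃ y, cs.length g = cs.length y + n ∧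
    (g = y * cs.wordProd (alternatingWord s t n) ∨ g = y * cs.wordProd (alternatingWord t s n))
  have key : ∀ (s t : B) (n : ℕ) (y : W), cs.length (g * cs.simple t) < cs.length g →
      cs.length g = cs.length y + n → g = y * cs.wordProd (alternatingWord t s n) →
      cs.wordProd (alternatingWord t s n) = cs.wordProd (alternatingWord s t n) ∨
      ∃ y', cs.length g = cs.length y' + (n + 1) ∧
        g = y' * cs.wordProd (alternatingWord s t (n + 1)) := by
    intro s t n y ht hl hg
    have hln : cs.length (cs.wordProd (alternatingWord t s n)) = n := by
      have h1 := cs.length_mul_le y (cs.wordProd (alternatingWord t s n))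
      rw [← hg] at h1
      have := alt_le cs t s n
      omega
    obtain ⟨ω, hr, rfl⟩ := cs.exists_isReduced y
    rcases exchange2 cs ω (cs.wordProd (alternatingWord t s n)) t (by rw [← hg]; exact ht) with
      h | ⟨j, hj, h⟩
    · left
      exact alt_eq cs s t n hln (by omega)
    · right
      refine ⟨cs.wordProd (ω.eraseIdx j), ?_, ?_⟩
      · have h1 := cs.length_wordProd_le (ω.eraseIdx j)
        rw [List.length_eraseIdx_of_lt hj] at h1
        have h2 := cs.length_mul_le (cs.wordProd (ω.eraseIdx j)) (cs.wordProd (alternatingWord t s n))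
        rw [← h, ← hg] at h2
        have h3 := cs.length_mul_simple g t
        have h4 := hr.eq
        omega
      · rw [alt_succ, ← mul_assoc, ← h, ← hg, simple_mul_simple_cancel_right]
  have hP1 : P 1 := by
    refine ⟨g * cs.simple s, ?_, Or.inr ?_⟩
    · have := cs.length_mul_simple g s
      omega
    · simp [alternatingWord]
  have hb : ∀ n, P n → n ≤ cs.length g := by
    rintro n ⟨y, h, -⟩
    omega
  have h1g := hb 1 hP1
  set n := Nat.findGreatest P (cs.length g) with hn
  have hPn : P n := Nat.findGreatest_spec h1g hP1
  have hn1 : 1 ≤ n := Nat.le_findGreatest h1g hP1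
  have hmax : ¬ P (n + 1) := by
    intro h
    have := Nat.le_findGreatest (hb _ h) h
    omega
  obtain ⟨y, hl, hg | hg⟩ := hPn
  · rcases key t s n y hs hl hg with h | ⟨y', h1, h2⟩
    · exact ⟨n, y, hn1, hg, hl, h.symm⟩
    · exact absurd ⟨y', h1, Or.inr h2⟩ hmax
  · rcases key s t n y ht hl hg with h | ⟨y', h1, h2⟩
    · exact ⟨n, y, hn1, by rw [← h]; exact hg, hl, h⟩
    · exact absurd ⟨y', h1, Or.inl h2⟩ hmax

theorem alt_suffix (cs : CoxeterSystem M W) (s t : B) (k d : ℕ) :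
    ∃ v, cs.length v ≤ d ∧
      cs.wordProd (alternatingWord s t (k + d)) = v * cs.wordProd (alternatingWord s t k) := by
  induction d with
  | zero => exact ⟨1, by simp, by simp⟩
  | succ d ih =>
    obtain ⟨v, h1, h2⟩ := ih
    refine ⟨cs.simple (if Even (k + d) then t else s) * v, ?_, ?_⟩
    · have := cs.length_mul_le (cs.simple (if Even (k + d) then t else s)) v
      rw [length_simple] at this
      omega
    · rw [← add_assoc, alternatingWord_succ', wordProd_cons, h2, mul_assoc]

theorem mem_closure_alt (cs : CoxeterSystem M W) (s t : B) (n : ℕ) (hn : 1 ≤ n)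
    (h : cs.wordProd (alternatingWord t s n) = cs.wordProd (alternatingWord s t n)) (u : W)
    (hu : u ∈ Subgroup.closure ({cs.simple s, cs.simple t} : Set W)) :
    ∃ k ≤ n, u = cs.wordProd (alternatingWord s t k) ∨ u = cs.wordProd (alternatingWord t s k) := by
  have step : ∀ (s t : B), cs.wordProd (alternatingWord t s n) = cs.wordProd (alternatingWord s t n)
      → ∀ k ≤ n, ∀ z : W, z = cs.simple s ∨ z = cs.simple t → ∃ k' ≤ n,
      cs.wordProd (alternatingWord s t k) * z = cs.wordProd (alternatingWord s t k') ∨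
      cs.wordProd (alternatingWord s t k) * z = cs.wordProd (alternatingWord t s k') := by
    intro s t h k hk z hz
    rcases hz with rfl | rfl
    · rcases hk.lt_or_eq with hk | rfl
      · exact ⟨k + 1, hk, Or.inr (alt_succ cs t s k).symm⟩
      · obtain ⟨m, rfl⟩ : ∃ m, k = m + 1 := ⟨k - 1, by omega⟩
        refine ⟨m, by omega, Or.inl ?_⟩
        rw [← h, alt_succ, simple_mul_simple_cancel_right]
    · cases k with
      | zero => exact ⟨1, hn, Or.inl (by simp [alternatingWord])⟩
      | succ m =>
        refine ⟨m, by omega, Or.inr ?_⟩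
        rw [alt_succ, simple_mul_simple_cancel_right]
  have step2 : ∀ u : W, (∃ k ≤ n, u = cs.wordProd (alternatingWord s t k) ∨
      u = cs.wordProd (alternatingWord t s k)) → ∀ z : W, z = cs.simple s ∨ z = cs.simple t →
      ∃ k ≤ n, u * z = cs.wordProd (alternatingWord s t k) ∨
      u * z = cs.wordProd (alternatingWord t s k) := by
    rintro u ⟨k, hk, rfl | rfl⟩ z hz
    · exact step s t h k hk z hz
    · obtain ⟨k', h1, h2⟩ := step t s h.symm k hk z hz.symm
      exact ⟨k', h1, h2.symm⟩
  induction hu using Subgroup.closure_induction_right with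
  | one => exact ⟨0, by omega, Or.inl (by simp [alternatingWord])⟩
  | mul_right x hx y hy ih => exact step2 x ih y (by simpa using hy)
  | mul_inv_cancel x hx y hy ih =>
    refine step2 x ih _ ?_
    rcases hy with rfl | rfl <;> simp

theorem word_mem (cs : CoxeterSystem M W) (s t : B) (ω : List B) (h : ∀ i ∈ ω, i = s ∨ i = t) :
    cs.wordProd ω ∈ Subgroup.closure ({cs.simple s, cs.simple t} : Set W) := by
  induction ω with
  | nil => simp
  | cons i ω ih =>
    rw [wordProd_cons]
    refine mul_mem (Subgroup.subset_closure ?_) (ih fun j hj => h j (by simp [hj]))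
    rcases h i (by simp) with rfl | rfl <;> simp

theorem mem_alt (s t : B) (n : ℕ) : ∀ i ∈ alternatingWord s t n, i = s ∨ i = t := by
  induction n with
  | zero => simp [alternatingWord]
  | succ n ih =>
    intro i hi
    rw [alternatingWord_succ'] at hi
    rcases List.mem_cons.1 hi with rfl | hi
    · split_ifs <;> simp
    · exact ih i hi

theorem cone_prefix (cs : CoxeterSystem M W) (a b : W)
    (h : cs.length (a * b) = cs.length a + cs.length b) :
    ConeType cs (a * b)⁻¹ ⊆ ConeType cs a⁻¹ := by
  intro z hz
  simp only [ConeType, Set.mem_ofPred_eq, length_inv] at *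
  have h1 := cs.length_mul_le b⁻¹ (a⁻¹ * z)
  have h2 := cs.length_mul_le a⁻¹ z
  rw [← mul_assoc, ← mul_inv_rev, length_inv] at h1
  rw [length_inv] at h2
  omega

/-- Cone type parts are closed under finite residues at local maxima: if
`s ≠ t ∈ S` are descents of `g` and `T((gs)⁻¹) = T(g⁻¹) = T((gt)⁻¹)`, then
`T((gu)⁻¹) = T(g⁻¹)` for every `u ∈ ⟨s,t⟩`. -/
theorem cone_type_residue_closed [Finite B] (cs : CoxeterSystem M W) (g : W) (s t : B)
    (hst : cs.simple s ≠ cs.simple t)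
    (hs : cs.length (g * cs.simple s) < cs.length g)
    (ht : cs.length (g * cs.simple t) < cs.length g)
    (hcs : ConeType cs (g * cs.simple s)⁻¹ = ConeType cs g⁻¹)
    (hct : ConeType cs (g * cs.simple t)⁻¹ = ConeType cs g⁻¹) :
    ∀ u ∈ Subgroup.closure ({cs.simple s, cs.simple t} : Set W),
      ConeType cs (g * u)⁻¹ = ConeType cs g⁻¹ := by
  obtain ⟨n, x, hn, hg, hl, hw⟩ := exists_top cs g s t hs ht
  set H := Subgroup.closure ({cs.simple s, cs.simple t} : Set W) with hH
  have hA := mem_closure_alt cs s t n hn hw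
  rw [← hH] at hA
  have hE := exchange2 cs (alternatingWord s t n)
  have hmemE : ∀ j, cs.wordProd ((alternatingWord s t n).eraseIdx j) ∈ H := fun j =>
    word_mem cs s t _ fun i hi => mem_alt s t n i (List.mem_of_mem_eraseIdx hi)
  have hwH : cs.wordProd (alternatingWord s t n) ∈ H := word_mem cs s t _ (mem_alt s t n)
  have hlen : cs.length (cs.wordProd (alternatingWord s t n)) = n := by
    have h1 := cs.length_mul_le x (cs.wordProd (alternatingWord s t n))
    rw [← hg] at h1
    have := alt_le cs s t n
    omega
  -- lengths and suffixes of alternating words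
  have hsuf : ∀ k ≤ n, ∀ u, (u = cs.wordProd (alternatingWord s t k) ∨
      u = cs.wordProd (alternatingWord t s k)) → cs.length u = k ∧
      ∃ v, cs.length v + k = n ∧ cs.wordProd (alternatingWord s t n) = v * u := by
    intro k hk u hu
    obtain ⟨d, rfl⟩ := Nat.exists_eq_add_of_le hk
    obtain ⟨v, hv, he⟩ : ∃ v, cs.length v ≤ d ∧
        cs.wordProd (alternatingWord s t (k + d)) = v * u := by
      rcases hu with rfl | rfl
      · exact alt_suffix cs s t k d
      · rw [← hw]; exact alt_suffix cs t s k d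
    have hle : cs.length u ≤ k := by
      rcases hu with rfl | rfl <;> exact alt_le cs _ _ k
    have h1 := cs.length_mul_le v u
    rw [← he, hlen] at h1
    exact ⟨by omega, v, by omega, he⟩
  generalize cs.wordProd (alternatingWord s t n) = w at *
  have hmul : ∀ u ∈ H, cs.length (w * u) + cs.length u = n := by
    intro u hu
    obtain ⟨k, hk, h⟩ := hA u⁻¹ (inv_mem hu)
    obtain ⟨h1, v, h2, h3⟩ := hsuf k hk _ h
    rw [length_inv] at h1
    rw [h3, inv_mul_cancel_right]
    omega
  have hww : w * w = 1 := by
    have := hmul w hwH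
    rw [← cs.length_eq_zero_iff]
    omega
  have hwi : w⁻¹ = w := inv_eq_of_mul_eq_one_left hww
  have hone : ∀ u ∈ H, cs.length u = 1 → u = cs.simple s ∨ u = cs.simple t := by
    intro u hu h1
    obtain ⟨k, hk, h⟩ := hA u hu
    have := (hsuf k hk u h).1
    obtain rfl : k = 1 := by omega
    simpa [alternatingWord, or_comm] using h
  have hinvmul : ∀ u ∈ H, cs.length (u⁻¹ * w) + cs.length u = n := by
    intro u hu
    have h1 := hmul u hu
    rw [← cs.length_inv (w * u), mul_inv_rev, hwi] at h1
    exact h1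
  have hxu : ∀ u ∈ H, cs.length (x * u) = cs.length x + cs.length u := by
    intro u hu
    have h1 := cs.length_mul_le (x * u) (u⁻¹ * w)
    have h2 : x * u * (u⁻¹ * w) = g := by rw [hg]; group
    have h3 := cs.length_mul_le x u
    have h4 := hinvmul u hu
    rw [h2] at h1
    omega
  have hgi : g⁻¹ = w * x⁻¹ := by rw [hg, mul_inv_rev, hwi]
  have main : ∀ (N : ℕ) (h : W), cs.length h = N → h ∈ ConeType cs x⁻¹ → h ∈ ConeType cs g⁻¹ := by
    intro N
    induction N with
    | zero =>
      intro h h0 _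
      rw [cs.length_eq_zero_iff] at h0
      subst h0
      simp [ConeType]
    | succ N ih =>
      intro h h0 hx
      by_contra hcon
      have hne : h ≠ 1 := by
        rintro rfl
        simp at h0
      obtain ⟨i, hi⟩ := cs.exists_rightDescent_of_ne_one hne
      rw [isRightDescent_iff] at hi
      obtain ⟨p, hp⟩ : ∃ p, p = h * cs.simple i := ⟨_, rfl⟩
      have hh : h = p * cs.simple i := by rw [hp, simple_mul_simple_cancel_right]
      rw [← hp] at hi
      have hxp : p ∈ ConeType cs x⁻¹ := by
        simp only [ConeType, Set.mem_ofPred_eq] at hx ⊢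
        have h1 := cs.length_mul_le (x⁻¹ * p) (cs.simple i)
        rw [mul_assoc, ← hh, length_simple] at h1
        have h2 := cs.length_mul_le x⁻¹ p
        omega
      have hgp := ih p (by omega) hxp
      obtain ⟨q, hq⟩ : ∃ q, q = x⁻¹ * p := ⟨_, rfl⟩
      simp only [ConeType, Set.mem_ofPred_eq, hgi, mul_assoc] at hx hxp hgp hcon
      have hqh : x⁻¹ * h = q * cs.simple i := by rw [hq, hh, mul_assoc]
      have hgl : cs.length (w * x⁻¹) = cs.length x + n := by rw [← hgi, length_inv, hl]
      rw [hqh, length_inv] at hx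
      rw [← hq, length_inv] at hxp
      rw [← hq, hgl] at hgp
      rw [hqh, hgl, ← mul_assoc] at hcon
      have hlt : cs.length (w * q * cs.simple i) < cs.length (w * q) := by
        have := cs.length_mul_simple (w * q) i
        omega
      rcases hE q i hlt with h1 | ⟨j, -, h1⟩
      · omega
      · obtain ⟨ρ, hρ⟩ : ∃ ρ, ρ = w * cs.wordProd ((alternatingWord s t n).eraseIdx j) := ⟨_, rfl⟩
        have hρH : ρ ∈ H := hρ ▸ mul_mem hwH (hmemE j)
        have hqi : q * cs.simple i = ρ * q := by
          rw [hρ, mul_assoc, ← h1, ← mul_assoc, ← mul_assoc, hww, one_mul]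
        have h2 := cs.length_mul_le (w * ρ⁻¹) (ρ * q)
        have h3 : w * ρ⁻¹ * (ρ * q) = w * q := by group
        have h4 := hmul ρ⁻¹ (inv_mem hρH)
        have h5 := cs.length_mul_le ρ q
        rw [length_inv] at h4
        rw [h3] at h2
        rw [← hqi] at h2 h5
        have hρ1 : cs.length ρ = 1 := by omega
        have hρρ : ρ * ρ = 1 := by
          rcases hone ρ hρH hρ1 with h | h <;> rw [h, simple_mul_simple_self]
        have hρi : ρ⁻¹ = ρ := inv_eq_of_mul_eq_one_left hρρ
        have h6 := hinvmul ρ hρH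
        rw [hρi] at h6
        have h7 := hmul (ρ * w) (mul_mem hρH hwH)
        have h8 := hone _ (mul_mem hwH (mul_mem hρH hwH)) (by omega)
        have h9 : cs.length (g * (w * (ρ * w))) < cs.length g ∧
            ConeType cs (g * (w * (ρ * w)))⁻¹ = ConeType cs g⁻¹ := by
          rcases h8 with h | h <;> rw [h]
          · exact ⟨hs, hcs⟩
          · exact ⟨ht, hct⟩
        have h10 : g * (w * (ρ * w)) = x * (ρ * w) := by
          rw [hg, mul_assoc, ← mul_assoc w w, hww, one_mul]
        rw [h10, hxu _ (mul_mem hρH hwH)] at h9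
        have h11 : h ∈ ConeType cs (x * (ρ * w))⁻¹ := by
          simp only [ConeType, Set.mem_ofPred_eq]
          rw [length_inv, hxu _ (mul_mem hρH hwH)]
          have : (x * (ρ * w))⁻¹ * h = w * q := by
            rw [mul_inv_rev, mul_inv_rev, hwi, hρi, mul_assoc, hqh, hqi, mul_assoc,
              ← mul_assoc ρ ρ, hρρ, one_mul]
          rw [this]
          omega
        rw [h9.2] at h11
        simp only [ConeType, Set.mem_ofPred_eq, hgi, mul_assoc] at h11
        rw [hqh, hgl, ← mul_assoc] at h11
        exact hcon h11
  intro u hu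
  have hv : w * u ∈ H := mul_mem hwH hu
  have hgu : g * u = x * (w * u) := by rw [hg, mul_assoc]
  apply Set.Subset.antisymm
  · intro h hh
    rw [hgu] at hh
    exact main _ h rfl (cone_prefix cs x (w * u) (hxu _ hv) hh)
  · have h1 : g = g * u * ((w * u)⁻¹ * w) := by
      rw [hgu, hg]; group
    have h2 := cone_prefix cs (g * u) ((w * u)⁻¹ * w) (by
      rw [← h1, hgu, hxu _ hv]
      have := hinvmul _ hv
      omega)
    rwa [← h1] at h2
end

section
/- An element h ∈ W is the smallest element of its cone type part (i.e., h = μ(h)) if and only if for every s ∈ S with ℓ(hs) < ℓ(h), the reflection hsh⁻¹ belongs to ∂T, where T = T(h⁻¹). -/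
/-!
Let `(W,S)` be a Coxeter system, given by a Coxeter matrix `M : CoxeterMatrix B`
and `cs : CoxeterSystem M W`; the set `S` of simple reflections is the range of
`cs.simple`, and `S` is finite since `B` is finite.
-/

variable {B W : Type*} [Group W] {M : CoxeterMatrix B}

/-- For a cone type `T`, `∂T` is the set of reflections `xsx⁻¹` with `x ∈ T`,
`s ∈ S`, `xs ∉ T`. -/
def ConeBoundary (cs : CoxeterSystem M W) (T : Set W) : Set W :=
  {r : W | ∃ x ∈ T, ∃ i : B, r = x * cs.simple i * x⁻¹ ∧ x * cs.simple i ∉ T}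

open Classical in
/-- The elementary step of the permutation representation. -/
noncomputable def stepEnd (cs : CoxeterSystem M W) (i : B) : Function.End (W × ZMod 2) :=
  fun p => (cs.simple i * p.1 * cs.simple i, p.2 + if p.1 = cs.simple i then 1 else 0)

theorem conj_pow_aux {G : Type*} [Group G] (a b : G) (ha : a * a = 1) (hb : b * b = 1) (k : ℕ) :
    b * (a * b) ^ k = ((a * b)⁻¹) ^ k * b := by
  have ha' : a⁻¹ = a := inv_eq_of_mul_eq_one_left ha
  have hb' : b⁻¹ = b := inv_eq_of_mul_eq_one_left hb
  have h : SemiconjBy b (a * b) ((a * b)⁻¹) := by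
    unfold SemiconjBy
    rw [mul_inv_rev, ha', hb', mul_assoc]
  exact (h.pow_right k)

theorem step_aux {G : Type*} [Group G] (a b t : G) (k : ℕ) (hj : b * b = 1)
    (hi' : a⁻¹ = a) (hj' : b⁻¹ = b) (hc : b * (a * b) ^ k = ((a * b)⁻¹) ^ k * b) :
    (((a * b) ^ k * t * ((a * b) ^ k)⁻¹ = b) ↔ t = ((a * b)⁻¹) ^ (2 * k) * b) ∧
    ((b * ((a * b) ^ k * t * ((a * b) ^ k)⁻¹) * b = a) ↔
        t = ((a * b)⁻¹) ^ (2 * k + 1) * b) := by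
  have h1 : ((a * b) ^ k * t * ((a * b) ^ k)⁻¹ = b) ↔ t = ((a * b)⁻¹) ^ (2 * k) * b := by
    rw [mul_inv_eq_iff_eq_mul, hc, ← eq_inv_mul_iff_mul_eq, ← inv_pow, ← mul_assoc, ← pow_add,
      two_mul]
  have h2 : (b * ((a * b) ^ k * t * ((a * b) ^ k)⁻¹) * b = a) ↔
      t = ((a * b)⁻¹) ^ (2 * k + 1) * b := by
    have : (b * ((a * b) ^ k * t * ((a * b) ^ k)⁻¹) * b = a) ↔
        (a * b) ^ k * t * ((a * b) ^ k)⁻¹ = (a * b)⁻¹ * b := by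
      generalize (a * b) ^ k * t * ((a * b) ^ k)⁻¹ = u
      rw [mul_inv_rev, hi', hj']
      constructor
      · intro h
        rw [← h]
        simp only [mul_assoc, hj, mul_one]
        simp only [← mul_assoc, hj, one_mul]
      · intro h
        rw [h]
        simp only [mul_assoc, hj, mul_one]
        simp only [← mul_assoc, hj, one_mul]
    rw [this, mul_inv_eq_iff_eq_mul, mul_assoc, hc, ← eq_inv_mul_iff_mul_eq, ← inv_pow,
      ← mul_assoc, ← mul_assoc, ← pow_succ, ← pow_add]
    rw [show k + 1 + k = 2 * k + 1 by ring]
  exact ⟨h1, h2⟩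

open Classical in
theorem stepEnd_pow (cs : CoxeterSystem M W) (i j : B) (k : ℕ) (t : W) (e : ZMod 2) :
    ((stepEnd cs i * stepEnd cs j) ^ k) (t, e) =
      ((cs.simple i * cs.simple j) ^ k * t * ((cs.simple i * cs.simple j) ^ k)⁻¹,
        e + ∑ n ∈ Finset.range (2 * k),
          if t = ((cs.simple i * cs.simple j)⁻¹) ^ n * cs.simple j then 1 else 0) := by
  induction k with
  | zero => simp; rfl
  | succ k ih =>
    rw [pow_succ']
    change stepEnd cs i (stepEnd cs j (((stepEnd cs i * stepEnd cs j) ^ k) (t, e))) = _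
    rw [ih]
    have hi := cs.simple_mul_simple_self i
    have hj := cs.simple_mul_simple_self j
    have hi' := cs.inv_simple i
    have hj' := cs.inv_simple j
    have hc := conj_pow_aux _ _ hi hj k
    simp only [stepEnd]
    obtain ⟨h1, h2⟩ := step_aux _ _ t k hj hi' hj' hc
    rw [show 2 * (k + 1) = 2 * k + 1 + 1 by ring, Finset.sum_range_succ, Finset.sum_range_succ]
    simp only [h1, h2]
    refine Prod.ext ?_ ?_
    · simp only [pow_succ', mul_inv_rev, hi', hj', mul_assoc]
    · simp only [add_assoc]

theorem stepEnd_liftable (cs : CoxeterSystem M W) : M.IsLiftable (stepEnd cs) := by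
  classical
  intro i j
  funext p
  obtain ⟨t, e⟩ := p
  rw [stepEnd_pow]
  have h := cs.simple_mul_simple_pow i j
  have h' : ((cs.simple i * cs.simple j)⁻¹) ^ M i j = 1 := by rw [inv_pow, h, inv_one]
  rw [two_mul, Finset.sum_range_add]
  simp only [pow_add, h', h, one_mul, CharTwo.add_self_eq_zero, inv_one, mul_one, add_zero]
  rfl

/-- The permutation representation. -/
noncomputable def permRep (cs : CoxeterSystem M W) : W →* Function.End (W × ZMod 2) :=
  cs.lift ⟨stepEnd cs, stepEnd_liftable cs⟩

theorem permRep_simple (cs : CoxeterSystem M W) (i : B) :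
    permRep cs (cs.simple i) = stepEnd cs i := cs.lift_apply_simple _ i

theorem permRep_mul (cs : CoxeterSystem M W) (a b : W) (p : W × ZMod 2) :
    permRep cs (a * b) p = permRep cs a (permRep cs b p) := by
  rw [map_mul]; rfl

theorem permRep_word (cs : CoxeterSystem M W) (ω : List B) (t : W)
    (ht : t ∉ cs.rightInvSeq ω) (e : ZMod 2) :
    permRep cs (cs.wordProd ω) (t, e) = (cs.wordProd ω * t * (cs.wordProd ω)⁻¹, e) := by
  induction ω with
  | nil => simp; rfl
  | cons i ω ih =>
    rw [CoxeterSystem.rightInvSeq, List.mem_cons, not_or] at ht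
    rw [cs.wordProd_cons, permRep_mul, ih ht.2, permRep_simple]
    have : ¬ (cs.wordProd ω * t * (cs.wordProd ω)⁻¹ = cs.simple i) := by
      intro h
      apply ht.1
      rw [← h]; group
    simp only [stepEnd, this, if_false, add_zero, mul_inv_rev, cs.inv_simple]
    simp only [mul_assoc]

theorem permRep_of_lt (cs : CoxeterSystem M W) (w : W) (i : B)
    (hw : cs.length w < cs.length (w * cs.simple i)) (e : ZMod 2) :
    permRep cs w (cs.simple i, e) = (w * cs.simple i * w⁻¹, e) := by
  obtain ⟨ω, hω, rfl⟩ := cs.exists_isReduced w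
  apply permRep_word
  intro h
  have := (cs.isRightInversion_of_mem_rightInvSeq hω h).2
  omega

/-- Folding condition. -/
theorem folding (cs : CoxeterSystem M W) (w : W) (i j : B)
    (h1 : cs.length w < cs.length (cs.simple i * w))
    (h2 : cs.length w < cs.length (w * cs.simple j))
    (h3 : cs.length (cs.simple i * w * cs.simple j) ≤ cs.length w) :
    cs.simple i * w = w * cs.simple j := by
  by_contra hne
  have hA (e : ZMod 2) : permRep cs (cs.simple i * w) (cs.simple j, e) =
      (cs.simple i * (w * cs.simple j * w⁻¹) * cs.simple i, e) := by
    rw [permRep_mul, permRep_of_lt cs w j h2, permRep_simple]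
    have : ¬ (w * cs.simple j * w⁻¹ = cs.simple i) := by
      intro h
      apply hne
      rw [← h]; group
    simp [stepEnd, this]
  have hB := permRep_of_lt cs (cs.simple i * w * cs.simple j) j (by
    rw [cs.simple_mul_simple_cancel_right]; omega) 0
  rw [permRep_mul, permRep_simple] at hB
  have hC : stepEnd cs j (cs.simple j, 0) = (cs.simple j, 1) := by simp [stepEnd]
  rw [hC, hA] at hB
  exact absurd (congrArg Prod.snd hB) (by simp)

theorem coneType_mono (cs : CoxeterSystem M W) (p h : W) (hp : WeakLe cs p h) :
    ConeType cs h⁻¹ ⊆ ConeType cs p⁻¹ := by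
  intro x hx
  simp only [ConeType, WeakLe, Set.mem_ofPred_eq, cs.length_inv] at *
  have e : h⁻¹ * x = (p⁻¹ * h)⁻¹ * (p⁻¹ * x) := by group
  have := cs.length_mul_le (p⁻¹ * h)⁻¹ (p⁻¹ * x)
  rw [← e, cs.length_inv] at this
  have := cs.length_mul_le p⁻¹ x
  rw [cs.length_inv] at this
  omega

theorem weakLe_mul_simple (cs : CoxeterSystem M W) (h : W) (i : B)
    (hi : cs.length (h * cs.simple i) + 1 = cs.length h) :
    WeakLe cs (h * cs.simple i) h := by
  unfold WeakLe
  have : (h * cs.simple i)⁻¹ * h = cs.simple i := by simp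
  rw [this, cs.length_simple, hi]

theorem boundary_of_not_subset (cs : CoxeterSystem M W) (h : W) (i : B)
    (hi : cs.length (h * cs.simple i) + 1 = cs.length h) (n : ℕ) : ∀ x : W, cs.length x = n →
    x ∈ ConeType cs (h * cs.simple i)⁻¹ → x ∉ ConeType cs h⁻¹ →
      h * cs.simple i * h⁻¹ ∈ ConeBoundary cs (ConeType cs h⁻¹) := by
  induction n with
  | zero =>
    intro x hx _ h2
    rw [cs.length_eq_zero_iff] at hx
    subst hx
    simp [ConeType] at h2
  | succ n ih =>
    intro x hx h1 h2
    have hx1 : x ≠ 1 := by rintro rfl; simp at hx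
    obtain ⟨j, hj⟩ := cs.exists_rightDescent_of_ne_one hx1
    rw [cs.isRightDescent_iff] at hj
    obtain ⟨y, rfl⟩ : ∃ y, x = y * cs.simple j := ⟨x * cs.simple j, by simp⟩
    rw [cs.simple_mul_simple_cancel_right] at hj
    have hy1 : y ∈ ConeType cs (h * cs.simple i)⁻¹ := by
      simp only [ConeType, Set.mem_ofPred_eq, cs.length_inv] at *
      have a := cs.length_mul_le (h * cs.simple i)⁻¹ y
      have b := cs.length_mul_le ((h * cs.simple i)⁻¹ * y) (cs.simple j)
      rw [cs.length_simple, mul_assoc, h1] at b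
      rw [cs.length_inv] at a
      omega
    by_cases hy2 : y ∈ ConeType cs h⁻¹
    · refine ⟨y, hy2, j, ?_, h2⟩
      simp only [ConeType, Set.mem_ofPred_eq, cs.length_inv] at *
      have e : h⁻¹ = cs.simple i * (h * cs.simple i)⁻¹ := by simp
      have c := cs.length_mul_le h⁻¹ (y * cs.simple j)
      rw [cs.length_inv] at c
      have d := cs.length_mul_simple (h⁻¹ * y) j
      have := folding cs ((h * cs.simple i)⁻¹ * y) i j
        (by rw [← mul_assoc, ← e]; omega)
        (by rw [mul_assoc]; omega)
        (by
          rw [← mul_assoc, ← e]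
          rw [mul_assoc] at d ⊢
          omega)
      rw [← mul_assoc, ← e] at this
      have f : cs.simple i * h⁻¹ = h⁻¹ * y * cs.simple j * y⁻¹ := by
        have g : h⁻¹ * y = cs.simple i * h⁻¹ * y * cs.simple j := by
          simpa [mul_assoc] using this
        calc cs.simple i * h⁻¹ = cs.simple i * h⁻¹ * y * cs.simple j * cs.simple j * y⁻¹ := by simp
          _ = h⁻¹ * y * cs.simple j * y⁻¹ := by rw [← g]
      rw [mul_assoc, f]; group
    · exact ih y (by omega) hy1 hy2

/-- `h ∈ W` is the smallest element of its cone type part iff for every `s ∈ S`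
with `ℓ(hs) < ℓ(h)`, the reflection `hsh⁻¹` belongs to `∂T` for `T = T(h⁻¹)`. -/
theorem eq_mu_iff [Finite B] (cs : CoxeterSystem M W) (mu : W → W)
    (hmu : ∀ g : W, ConeType cs (mu g)⁻¹ = ConeType cs g⁻¹ ∧
      ∀ h : W, ConeType cs h⁻¹ = ConeType cs g⁻¹ → WeakLe cs (mu g) h)
    (h : W) :
    h = mu h ↔ ∀ i : B, cs.length (h * cs.simple i) < cs.length h →
      h * cs.simple i * h⁻¹ ∈ ConeBoundary cs (ConeType cs h⁻¹) := by
  obtain ⟨hT, hmin⟩ := hmu h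
  constructor
  · intro heq i hi
    have hi' : cs.length (h * cs.simple i) + 1 = cs.length h := by
      rcases cs.length_mul_simple h i with h1 | h1 <;> omega
    by_contra hb
    have hsub := coneType_mono cs _ _ (weakLe_mul_simple cs h i hi')
    have hEq : ConeType cs (h * cs.simple i)⁻¹ = ConeType cs h⁻¹ := by
      refine Set.Subset.antisymm ?_ hsub
      intro x hx
      by_contra hx'
      exact hb (boundary_of_not_subset cs h i hi' _ x rfl hx hx')
    have := hmin _ hEq
    rw [← heq] at this
    unfold WeakLe at this
    omega
  · intro hall
    by_contra hne
    have hle : WeakLe cs (mu h) h := hmin h rfl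
    have hne1 : (mu h)⁻¹ * h ≠ 1 := by
      intro h1
      exact hne (inv_mul_eq_one.mp h1).symm
    obtain ⟨i, hi⟩ := cs.exists_rightDescent_of_ne_one hne1
    rw [cs.isRightDescent_iff] at hi
    unfold WeakLe at hle
    have a := cs.length_mul_le (mu h) ((mu h)⁻¹ * (h * cs.simple i))
    rw [mul_inv_cancel_left] at a
    rw [mul_assoc] at hi
    have hi' : cs.length (h * cs.simple i) + 1 = cs.length h := by
      rcases cs.length_mul_simple h i with h1 | h1 <;> omega
    have hle' : WeakLe cs (mu h) (h * cs.simple i) := by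
      unfold WeakLe
      omega
    obtain ⟨x, hx, j, hxj, hnot⟩ := hall i (by omega)
    apply hnot
    rw [← hT]
    apply coneType_mono cs _ _ hle'
    have e : (h * cs.simple i)⁻¹ * (x * cs.simple j) = h⁻¹ * x := by
      have : x * cs.simple j = h * cs.simple i * h⁻¹ * x := by rw [hxj]; group
      rw [this]; group
    simp only [ConeType, Set.mem_ofPred_eq, cs.length_inv] at *
    have b := cs.length_mul_le (h * cs.simple i)⁻¹ (x * cs.simple j)
    rw [cs.length_inv, e] at b
    rw [e]
    rcases cs.length_mul_simple x j with h1 | h1 <;> omega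
end
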